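/- arXiv:1405.6390 — 3 statements merged into one kernel-verified Lean document; each statement's English description precedes it below -/
import Mathlib

section
/- If Γ : 𝔤 = ⊕_{j∈ℚ} 𝔤_j is a b-optimal grading for e, then all e-admissible pairs relative to Γ are pairwise equivalent. -/
open Module LieAlgebra

noncomputable section

variable {L : Type*} [LieRing L] [LieAlgebra ℂ L]

/-- The pair `(𝔪, 𝔫)` of subalgebras is `e`-admissible relative to the `ℚ`-grading
`g : ℚ → Submodule ℂ L` with `e ∈ g a` for an integer `a > 1`: `𝔪`, `𝔫` are Lie
subalgebras, are `Γ`-graded, and conditions (A2)–(A6) of Sadaka's Definition 2.2 hold. -/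
def IsAdmissiblePairQ (g : ℚ → Submodule ℂ L) (e : L) (a : ℤ)
    (m n : Submodule ℂ L) : Prop :=
  -- `𝔪` and `𝔫` are Lie subalgebras of `𝔤`
  (∀ x ∈ m, ∀ y ∈ m, ⁅x, y⁆ ∈ m) ∧
  (∀ x ∈ n, ∀ y ∈ n, ⁅x, y⁆ ∈ n) ∧
  -- (A2): `𝔪`, `𝔫` are `Γ`-graded and `𝔤_{≤ -a} ⊆ 𝔪 ⊆ 𝔫 ⊆ 𝔤_{<0}`
  m = (⨆ j : ℚ, g j ⊓ m) ∧
  n = (⨆ j : ℚ, g j ⊓ n) ∧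
  (⨆ j ≤ -(a:ℚ), g j) ≤ m ∧ m ≤ n ∧ n ≤ (⨆ j < (0:ℚ), g j) ∧
  -- (A3): `𝔪^⊥ ∩ [𝔤, e] = [𝔫, e]`
  (LinearMap.BilinForm.orthogonal (killingForm ℂ L) m ⊓ LinearMap.range (ad ℂ L e)
      = Submodule.map (ad ℂ L e) n) ∧
  -- (A4): `𝔫 ∩ 𝔤^e = 0`
  n ⊓ LinearMap.ker (ad ℂ L e) = ⊥ ∧
  -- (A5): `[𝔫, 𝔪] ⊆ 𝔪`
  (∀ x ∈ n, ∀ y ∈ m, ⁅x, y⁆ ∈ m) ∧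
  -- (A6): `dim 𝔪 + dim 𝔫 = dim 𝔤 - dim 𝔤^e`
  Module.finrank ℂ ↥m + Module.finrank ℂ ↥n
    = Module.finrank ℂ L - Module.finrank ℂ ↥(LinearMap.ker (ad ℂ L e))

/-- `g : ℚ → Submodule ℂ L` is a `ℚ`-grading of the Lie algebra `L`. -/
def IsQGrading (g : ℚ → Submodule ℂ L) : Prop :=
  DirectSum.IsInternal g ∧ ∀ i j : ℚ, ∀ x ∈ g i, ∀ y ∈ g j, ⁅x, y⁆ ∈ g (i + j)

/-- Two `e`-admissible pairs are *comparable* if they are `e`-admissible relative to one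
common grading `Γ` and one is squeezed inside the other
(`𝔪 ⊆ 𝔪′ ⊆ 𝔫′ ⊆ 𝔫` or `𝔪′ ⊆ 𝔪 ⊆ 𝔫 ⊆ 𝔫′`). -/
def ComparablePairs (e : L) (p q : Submodule ℂ L × Submodule ℂ L) : Prop :=
  ∃ (g : ℚ → Submodule ℂ L) (a : ℤ), IsQGrading g ∧ 1 < a ∧ e ∈ g (a : ℚ) ∧
    IsAdmissiblePairQ g e a p.1 p.2 ∧ IsAdmissiblePairQ g e a q.1 q.2 ∧
    ((p.1 ≤ q.1 ∧ q.1 ≤ q.2 ∧ q.2 ≤ p.2) ∨ (q.1 ≤ p.1 ∧ p.1 ≤ p.2 ∧ p.2 ≤ q.2))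

/-- Two `e`-admissible pairs are *equivalent* if they are joined by a finite chain of
`e`-admissible pairs in which consecutive pairs are comparable. -/
def EquivalentPairs (e : L) : (Submodule ℂ L × Submodule ℂ L) →
    (Submodule ℂ L × Submodule ℂ L) → Prop :=
  Relation.ReflTransGen (ComparablePairs e)

namespace AdmissiblePairs

/-- The component projections of a `ℚ`-grading. -/
def proj {g : ℚ → Submodule ℂ L} (hg : IsQGrading g) (i : ℚ) : L →ₗ[ℂ] L :=
  letI := hg.1.chooseDecomposition
  (g i).subtype ∘ₗ DirectSum.component ℂ ℚ (fun j => g j) i ∘ₗ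
    (DirectSum.decomposeLinearEquiv g).toLinearMap

variable {g : ℚ → Submodule ℂ L} {e : L} {a : ℤ} {A B : ℚ → Submodule ℂ L}

lemma proj_mem (hg : IsQGrading g) (i : ℚ) (x : L) : proj hg i x ∈ g i := by
  simp [proj]

lemma proj_of_mem (hg : IsQGrading g) {i : ℚ} {x : L} (hx : x ∈ g i) : proj hg i x = x := by
  let := hg.1.chooseDecomposition
  exact DirectSum.decompose_of_mem_same g hx

lemma proj_of_mem_ne (hg : IsQGrading g) {i j : ℚ} {x : L} (hx : x ∈ g j) (h : j ≠ i) :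
    proj hg i x = 0 := by
  let := hg.1.chooseDecomposition
  exact DirectSum.decompose_of_mem_ne g hx h

lemma exists_sum_proj (hg : IsQGrading g) (x : L) : ∃ s : Finset ℚ, ∑ i ∈ s, proj hg i x = x := by
  classical
  let := hg.1.chooseDecomposition
  exact ⟨_, DirectSum.sum_support_decompose g x⟩

lemma proj_mem_of_mem_iSup (hg : IsQGrading g) (hB : ∀ j, B j ≤ g j) {x : L}
    (hx : x ∈ ⨆ j, B j) (i : ℚ) : proj hg i x ∈ B i := by
  have : (⨆ j, B j) ≤ (B i).comap (proj hg i) := by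
    refine iSup_le fun j y hy => ?_
    rw [Submodule.mem_comap]
    by_cases h : j = i
    · subst h
      rwa [proj_of_mem hg (hB j hy)]
    · rw [proj_of_mem_ne hg (hB j hy) h]
      exact zero_mem _
  exact this hx

lemma lie_proj (hg : IsQGrading g) (he : e ∈ g a) (i : ℚ) (x : L) :
    proj hg (a + i) ⁅e, x⁆ = ⁅e, proj hg i x⁆ := by
  have hx : x ∈ ⨆ j, g j := by rw [hg.1.submodule_iSup_eq_top]; trivial
  induction hx using Submodule.iSup_induction' with
  | mem j y hy =>
    have h := hg.2 _ _ _ he _ hy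
    by_cases hj : j = i
    · subst hj
      rw [proj_of_mem hg h, proj_of_mem hg hy]
    · rw [proj_of_mem_ne hg h (by simpa using hj), proj_of_mem_ne hg hy hj, lie_zero]
  | zero => simp
  | add y z _ _ hy hz => simp [hy, hz]

lemma twist_symm (e x y : L) : killingForm ℂ L ⁅e, x⁆ y = - killingForm ℂ L ⁅e, y⁆ x := by
  rw [LieModule.traceForm_apply_lie_apply', LieModule.traceForm_comm]

lemma lie_mem_iSup {C D E : ℚ → Submodule ℂ L}
    (h : ∀ i j, ∀ x ∈ C i, ∀ y ∈ D j, ⁅x, y⁆ ∈ E (i + j)) {x y : L}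
    (hx : x ∈ ⨆ j, C j) (hy : y ∈ ⨆ j, D j) : ⁅x, y⁆ ∈ ⨆ j, E j := by
  induction hx using Submodule.iSup_induction' with
  | mem i x hx =>
    induction hy using Submodule.iSup_induction' with
    | mem j y hy => exact Submodule.mem_iSup_of_mem _ (h i j x hx y hy)
    | zero => simp
    | add y z _ _ hy hz => rw [lie_add]; exact add_mem hy hz
  | zero => simp
  | add y z _ _ hy hz => rw [add_lie]; exact add_mem hy hz

lemma eq_zero_of_killingForm [LieAlgebra.IsKilling ℂ L] {x : L} (h : ∀ y, killingForm ℂ L x y = 0) : x = 0 := by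
  have := LieAlgebra.IsKilling.ker_killingForm_eq_bot ℂ L
  rw [← Submodule.mem_bot ℂ, ← this, LinearMap.mem_ker]
  exact LinearMap.ext h

/-- Homogeneous-component form of `e`-admissibility. -/
structure IsAdmissibleFamily (g : ℚ → Submodule ℂ L) (e : L) (a : ℤ)
    (A B : ℚ → Submodule ℂ L) : Prop where
  le : ∀ j, A j ≤ B j
  le_grading : ∀ j, B j ≤ g j
  eq_grading : ∀ j ≤ -(a : ℚ), A j = g j
  eq_bot : ∀ j, 0 ≤ j → B j = ⊥
  lie_mem : ∀ i j, ∀ x ∈ B i, ∀ y ∈ B j, ⁅x, y⁆ ∈ B (i + j)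
  lie_mem_left : ∀ i j, ∀ x ∈ B i, ∀ y ∈ A j, ⁅x, y⁆ ∈ A (i + j)
  eq_zero : ∀ j, ∀ x ∈ B j, ⁅e, x⁆ = 0 → x = 0
  exists_of_orth : ∀ i, ∀ x ∈ g i, (∀ y ∈ A (-a - i), killingForm ℂ L ⁅e, x⁆ y = 0) →
    ∃ z ∈ B i, ⁅e, x⁆ = ⁅e, z⁆
  orth : ∀ i, ∀ x ∈ B i, ∀ y ∈ A (-a - i), killingForm ℂ L ⁅e, x⁆ y = 0

/-- The family equal to `g j` for `j < c`, to `U` for `j = c`, and zero above `c`. -/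
def midFamily (g : ℚ → Submodule ℂ L) (c : ℚ) (U : Submodule ℂ L) (j : ℚ) : Submodule ℂ L :=
  if j < c then g j else if j = c then U else ⊥

lemma midFamily_mono {c : ℚ} {U V : Submodule ℂ L} (h : U ≤ V) (j : ℚ) :
    midFamily g c U j ≤ midFamily g c V j := by
  unfold midFamily
  split_ifs <;> first | exact h | exact le_rfl

lemma midFamily_le {c : ℚ} {U : Submodule ℂ L} (h : U ≤ g c) (j : ℚ) :
    midFamily g c U j ≤ g j := by
  unfold midFamily
  split_ifs with h1 h2
  · exact le_rfl
  · rwa [h2]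
  · exact bot_le

lemma midFamily_of_lt {c j : ℚ} (U : Submodule ℂ L) (h : j < c) : midFamily g c U j = g j :=
  if_pos h

lemma midFamily_self (c : ℚ) (U : Submodule ℂ L) : midFamily g c U c = U := by
  simp [midFamily]

lemma midFamily_of_gt {c j : ℚ} (U : Submodule ℂ L) (h : c < j) : midFamily g c U j = ⊥ := by
  simp [midFamily, h.not_gt, h.ne']

/-- The conditions that a pair `U ≤ V` of subspaces of the middle degree component `g c`,
`c = -a/2`, must satisfy to yield an admissible pair. -/
structure IsMiddlePair (g : ℚ → Submodule ℂ L) (e : L) (c : ℚ) (U V : Submodule ℂ L) : Prop where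
  le : U ≤ V
  le_grading : V ≤ g c
  eq_zero : ∀ x ∈ V, ⁅e, x⁆ = 0 → x = 0
  exists_of_orth : ∀ x ∈ g c, (∀ y ∈ U, killingForm ℂ L ⁅e, x⁆ y = 0) → ∃ z ∈ V, ⁅e, x⁆ = ⁅e, z⁆
  orth : ∀ x ∈ V, ∀ y ∈ U, killingForm ℂ L ⁅e, x⁆ y = 0

lemma IsAdmissibleFamily.isMiddlePair {c : ℚ} (hc : c = -(a : ℚ) / 2)
    (h : IsAdmissibleFamily g e a A B) : IsMiddlePair g e c (A c) (B c) := by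
  have hcc : -(a : ℚ) - c = c := by rw [hc]; ring
  have h1 := h.exists_of_orth c
  have h2 := h.orth c
  rw [hcc] at h1 h2
  exact ⟨h.le c, h.le_grading c, h.eq_zero c, h1, h2⟩

/-- A middle pair can be enlarged to one whose first subspace is zero. -/
lemma IsMiddlePair.exists_bot_pair {c : ℚ} {U V : Submodule ℂ L} (h : IsMiddlePair g e c U V) :
    ∃ W, V ≤ W ∧ IsMiddlePair g e c ⊥ W := by
  have hdisj : Disjoint V (LinearMap.ker (ad ℂ L e) ⊓ g c) := by
    rw [Submodule.disjoint_def]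
    exact fun x hx hk => h.eq_zero x hx hk.1
  obtain ⟨W, hVW, hW⟩ := hdisj.exists_isCompl
  refine ⟨W ⊓ g c, le_inf hVW h.le_grading, bot_le, inf_le_right, fun x hx hx0 => ?_,
    fun x hx _ => ?_, fun x _ y hy => ?_⟩
  · exact Submodule.disjoint_def.1 hW.disjoint x hx.1 ⟨hx0, hx.2⟩
  · have hxt : x ∈ W ⊔ LinearMap.ker (ad ℂ L e) ⊓ g c := by
      rw [hW.sup_eq_top]; trivial
    obtain ⟨w, hw, k, hk, rfl⟩ := Submodule.mem_sup.1 hxt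
    have hk0 : ⁅e, k⁆ = 0 := hk.1
    refine ⟨w, ⟨hw, ?_⟩, by rw [lie_add, hk0, add_zero]⟩
    simpa using sub_mem hx hk.2
  · rw [(Submodule.mem_bot ℂ).1 hy, map_zero]

lemma equivalentPairs_symm {p q : Submodule ℂ L × Submodule ℂ L} (h : EquivalentPairs e p q) :
    EquivalentPairs e q p := by
  have : Std.Symm (ComparablePairs e) :=
    ⟨fun _ _ ⟨g, a, hg, ha, he, hp, hq, h⟩ => ⟨g, a, hg, ha, he, hq, hp, h.symm⟩⟩
  exact Std.Symm.symm _ _ (r := Relation.ReflTransGen (ComparablePairs e)) h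

/-- The pair of subspaces attached to a pair of subspaces of the middle degree component. -/
def middle (g : ℚ → Submodule ℂ L) (c : ℚ) (U V : Submodule ℂ L) :
    Submodule ℂ L × Submodule ℂ L :=
  (⨆ j, midFamily g c U j, ⨆ j, midFamily g c V j)

/-- Discarding the part of `A` above the middle degree and filling up `B` below it preserves
admissibility. -/
lemma IsAdmissibleFamily.truncate (hg : IsQGrading g) (ha : 0 < a) {c : ℚ}
    (hc : c = -(a : ℚ) / 2) (hinj : ∀ j < c, ∀ x ∈ g j, ⁅e, x⁆ = 0 → x = 0)
    (h : IsAdmissibleFamily g e a A B) :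
    IsAdmissibleFamily g e a (fun j => if c < j then ⊥ else A j)
      (fun j => if j < c then g j else B j) := by
  have ha' : (0 : ℚ) < a := by exact_mod_cast ha
  have hBg : ∀ j, (if j < c then g j else B j) ≤ g j := fun j => by
    split_ifs
    exacts [le_rfl, h.le_grading j]
  have hneg : ∀ {j : ℚ} {x : L}, x ∈ (if j < c then g j else B j) → x ≠ 0 → j < 0 := by
    intro j x hx hx0
    by_contra! hj
    rw [if_neg (by linarith), h.eq_bot j hj] at hx
    exact hx0 hx
  refine ⟨fun j => ?_, hBg, fun j hj => ?_, fun j hj => ?_, fun i j x hx y hy => ?_,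
    fun i j x hx y hy => ?_, fun j x hx hx0 => ?_, fun i x hx hxo => ?_, fun i x hx y hy => ?_⟩
  · split_ifs
    exacts [bot_le, bot_le, (h.le j).trans (h.le_grading j), h.le j]
  · rw [if_neg (by linarith), h.eq_grading j hj]
  · rw [if_neg (by linarith), h.eq_bot j hj]
  · by_cases hx0 : x = 0
    · simp [hx0]
    by_cases hy0 : y = 0
    · simp [hy0]
    have hi := hneg hx hx0
    have hj := hneg hy hy0
    split_ifs with hij
    · exact hg.2 _ _ _ (hBg i hx) _ (hBg j hy)
    · rw [if_neg (by linarith)] at hx hy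
      exact h.lie_mem i j x hx y hy
  · by_cases hx0 : x = 0
    · simp [hx0]
    have hi := hneg hx hx0
    split_ifs at hy with hj
    · rw [(Submodule.mem_bot ℂ).1 hy]
      simp
    · rw [if_neg (by linarith)]
      split_ifs at hx with hic
      · rw [h.eq_grading _ (by linarith)]
        exact hg.2 _ _ _ hx _ (h.le_grading j (h.le j hy))
      · exact h.lie_mem_left i j x hx y hy
  · split_ifs at hx with hj
    exacts [hinj j hj x hx hx0, h.eq_zero j x hx hx0]
  · split_ifs with hi
    · exact ⟨x, hx, rfl⟩
    · rw [if_neg (by linarith)] at hxo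
      exact h.exists_of_orth i x hx hxo
  · split_ifs at hy with hi
    · rw [(Submodule.mem_bot ℂ).1 hy, map_zero]
    · rw [if_neg (by linarith)] at hx
      exact h.orth i x hx y hy

variable [FiniteDimensional ℂ L]

lemma killingForm_eq_zero (hg : IsQGrading g) {i j : ℚ} (hij : i + j ≠ 0) {x y : L}
    (hx : x ∈ g i) (hy : y ∈ g j) : killingForm ℂ L x y = 0 := by
  rw [killingForm_apply_apply]
  refine LinearMap.trace_eq_zero_of_mapsTo_ne hg.1 (fun k => i + (j + k))
    (fun k h => hij (by linarith)) fun k z hz => ?_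
  exact hg.2 _ _ _ hx _ (hg.2 _ _ _ hy _ hz)

/-- For homogeneous `x`, orthogonality against a graded subspace can be tested in one degree. -/
lemma orth_iSup (hg : IsQGrading g) (he : e ∈ g a) (hA : ∀ j, A j ≤ g j) {i : ℚ} {x : L}
    (hx : x ∈ g i) (h : ∀ y ∈ A (-a - i), killingForm ℂ L ⁅e, x⁆ y = 0) :
    ∀ y ∈ ⨆ j, A j, killingForm ℂ L ⁅e, x⁆ y = 0 := by
  have : (⨆ j, A j) ≤ LinearMap.ker (killingForm ℂ L ⁅e, x⁆) := by
    refine iSup_le fun j y hy => ?_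
    rw [LinearMap.mem_ker]
    by_cases hj : j = -a - i
    · subst hj; exact h y hy
    · exact killingForm_eq_zero hg (fun h' => hj (by linarith)) (hg.2 _ _ _ he _ hx) (hA j hy)
  exact fun y hy => this hy

lemma isAdmissibleFamily_of_isAdmissiblePairQ (hg : IsQGrading g) (he : e ∈ g a)
    {m n : Submodule ℂ L} (h : IsAdmissiblePairQ g e a m n) :
    IsAdmissibleFamily g e a (fun j => g j ⊓ m) (fun j => g j ⊓ n) := by
  obtain ⟨-, hnn, hm, hn, hlow, hmn, hhigh, hA3, hA4, hnm, -⟩ := h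
  refine ⟨fun j => inf_le_inf_left _ hmn, fun j => inf_le_left, fun j hj => ?_, fun j hj => ?_,
    ?_, ?_, ?_, ?_, ?_⟩
  · exact inf_eq_left.2 ((le_iSup₂_of_le j hj le_rfl).trans hlow)
  · rw [eq_bot_iff]
    rintro x ⟨hx, hxn⟩
    have : (⨆ i < (0 : ℚ), g i) ≤ LinearMap.ker (proj hg j) :=
      iSup₂_le fun i hi y hy => proj_of_mem_ne hg hy (by linarith)
    have h0 := this (hhigh hxn)
    rwa [LinearMap.mem_ker, proj_of_mem hg hx] at h0
  · exact fun i j x hx y hy => ⟨hg.2 i j x hx.1 y hy.1, hnn x hx.2 y hy.2⟩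
  · exact fun i j x hx y hy => ⟨hg.2 i j x hx.1 y hy.1, hnm x hx.2 y hy.2⟩
  · intro j x hx hxe
    have : x ∈ n ⊓ LinearMap.ker (ad ℂ L e) := ⟨hx.2, hxe⟩
    rwa [hA4] at this
  · intro i x hx hxo
    have hmem : ad ℂ L e x ∈ Submodule.map (ad ℂ L e) n := by
      rw [← hA3]
      refine ⟨fun y hy => ?_, LinearMap.mem_range_self _ x⟩
      rw [LieModule.traceForm_comm, LieAlgebra.ad_apply]
      rw [hm] at hy
      exact orth_iSup hg he (fun _ => inf_le_left) hx hxo y hy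
    obtain ⟨z, hz, hze⟩ := hmem
    rw [LieAlgebra.ad_apply, LieAlgebra.ad_apply] at hze
    refine ⟨proj hg i z, ?_, ?_⟩
    · rw [SetLike.mem_coe, hn] at hz
      exact proj_mem_of_mem_iSup (B := fun j => g j ⊓ n) hg (fun _ => inf_le_left) hz i
    · rw [← lie_proj hg he, hze, lie_proj hg he, proj_of_mem hg hx]
  · intro i x hx y hy
    have hmem : ad ℂ L e x ∈ Submodule.map (ad ℂ L e) n := ⟨x, hx.2, rfl⟩
    rw [← hA3] at hmem
    have := hmem.1 y hy.2
    rwa [LieModule.traceForm_comm, LieAlgebra.ad_apply] at this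

variable [LieAlgebra.IsKilling ℂ L]

lemma lie_eq_zero_of_orth (hg : IsQGrading g) (he : e ∈ g a) {i : ℚ} {x : L}
    (hx : x ∈ g i) (h : ∀ y ∈ g (-a - i), killingForm ℂ L ⁅e, x⁆ y = 0) : ⁅e, x⁆ = 0 := by
  refine eq_zero_of_killingForm fun y => orth_iSup hg he (fun _ => le_rfl) hx h y ?_
  rw [hg.1.submodule_iSup_eq_top]; trivial

lemma finrank_add_finrank_of_orth {m n : Submodule ℂ L} (hmn : m ≤ n)
    (hA3 : LinearMap.BilinForm.orthogonal (killingForm ℂ L) m ⊓ LinearMap.range (ad ℂ L e)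
      = Submodule.map (ad ℂ L e) n)
    (hA4 : n ⊓ LinearMap.ker (ad ℂ L e) = ⊥) :
    finrank ℂ m + finrank ℂ n = finrank ℂ L - finrank ℂ (LinearMap.ker (ad ℂ L e)) := by
  let φ : LinearMap.BilinForm ℂ L := (killingForm ℂ L).compLeft (ad ℂ L e)
  have hφ : ∀ x y, φ x y = killingForm ℂ L ⁅e, x⁆ y := fun _ _ => rfl
  have hker : LinearMap.ker φ = LinearMap.ker (ad ℂ L e) := by
    ext x
    simp only [LinearMap.mem_ker, LieAlgebra.ad_apply]
    refine ⟨fun h => eq_zero_of_killingForm fun y => ?_, fun h => LinearMap.ext fun y => ?_⟩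
    · rw [← hφ, h]; rfl
    · rw [hφ, h]; simp
  have horth : φ.orthogonal m = n ⊔ LinearMap.ker (ad ℂ L e) := by
    rw [← Submodule.comap_map_eq, ← hA3]
    ext x
    simp only [LinearMap.BilinForm.mem_orthogonal_iff, Submodule.mem_comap, Submodule.mem_inf,
      LinearMap.mem_range_self, and_true, hφ]
    refine forall₂_congr fun y _ => ?_
    rw [LieAlgebra.ad_apply]
    rw [twist_symm, neg_eq_zero, LieModule.traceForm_comm]
  have h1 := LinearMap.BilinForm.finrank_add_finrank_orthogonal' (B := φ) m
  rw [hker, horth, eq_bot_iff.2 ((inf_le_inf_right _ hmn).trans hA4.le), finrank_bot] at h1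
  have h2 := Submodule.finrank_sup_add_finrank_inf_eq n (LinearMap.ker (ad ℂ L e))
  rw [hA4, finrank_bot] at h2
  omega

lemma IsAdmissibleFamily.isAdmissiblePairQ (hg : IsQGrading g) (he : e ∈ g a)
    (h : IsAdmissibleFamily g e a A B) :
    IsAdmissiblePairQ g e a (⨆ j, A j) (⨆ j, B j) := by
  have hAg j : A j ≤ g j := (h.le j).trans (h.le_grading j)
  have hAB : (⨆ j, A j) ≤ ⨆ j, B j := iSup_mono h.le
  have graded : ∀ C : ℚ → Submodule ℂ L, (∀ j, C j ≤ g j) →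
      (⨆ j, C j) = ⨆ j, g j ⊓ ⨆ k, C k := fun C hC =>
    le_antisymm (iSup_mono fun j => le_inf (hC j) (le_iSup C j)) (iSup_le fun j => inf_le_right)
  have hA3 : LinearMap.BilinForm.orthogonal (killingForm ℂ L) (⨆ j, A j) ⊓
      LinearMap.range (ad ℂ L e) = Submodule.map (ad ℂ L e) (⨆ j, B j) := by
    apply le_antisymm
    · rintro _ ⟨hx, x, rfl⟩
      have key : ∀ i, ∃ z ∈ B i, ⁅e, proj hg i x⁆ = ⁅e, z⁆ := by
        refine fun i => h.exists_of_orth i _ (proj_mem hg i x) fun y hy => ?_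
        have h1 := hx y (Submodule.mem_iSup_of_mem _ hy)
        rw [LieModule.traceForm_comm, LieAlgebra.ad_apply,
          twist_symm, neg_eq_zero] at h1
        have hey := hg.2 _ _ _ he _ (hAg _ hy)
        obtain ⟨s, hs⟩ := exists_sum_proj hg x
        rw [twist_symm, neg_eq_zero]
        by_cases hi : proj hg i x = 0
        · simp [hi]
        rw [← h1]
        conv_rhs => rw [← hs, map_sum]
        rw [Finset.sum_eq_single i]
        · intro k _ hk
          exact killingForm_eq_zero hg (fun h' => hk (by linarith)) hey (proj_mem hg k x)
        · intro his
          exfalso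
          apply hi
          rw [← hs, map_sum]
          refine Finset.sum_eq_zero fun k hk => ?_
          exact proj_of_mem_ne hg (proj_mem hg k x) (fun h' => his (h' ▸ hk))
      choose z hz hze using key
      obtain ⟨s, hs⟩ := exists_sum_proj hg x
      refine ⟨∑ i ∈ s, z i, sum_mem fun i _ => Submodule.mem_iSup_of_mem i (hz i), ?_⟩
      conv_rhs => rw [← hs]
      simp only [LieAlgebra.ad_apply, lie_sum, hze]
    · rintro _ ⟨x, hx, rfl⟩
      refine ⟨fun y hy => ?_, LinearMap.mem_range_self _ x⟩
      rw [LieModule.traceForm_comm, LieAlgebra.ad_apply]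
      rw [SetLike.mem_coe] at hx
      induction hx using Submodule.iSup_induction' with
      | mem i x hx => exact orth_iSup hg he hAg (h.le_grading i hx) (h.orth i x hx) y hy
      | zero => simp
      | add u v _ _ hu hv => simp [hu, hv]
  have hA4 : (⨆ j, B j) ⊓ LinearMap.ker (ad ℂ L e) = ⊥ := by
    rw [eq_bot_iff]
    rintro x ⟨hx, hxe⟩
    rw [SetLike.mem_coe, LinearMap.mem_ker, LieAlgebra.ad_apply] at hxe
    obtain ⟨s, hs⟩ := exists_sum_proj hg x
    rw [Submodule.mem_bot, ← hs]
    refine Finset.sum_eq_zero fun i _ => h.eq_zero i _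
      (proj_mem_of_mem_iSup hg h.le_grading hx i) ?_
    rw [← lie_proj hg he, hxe, map_zero]
  refine ⟨fun x hx y hy => lie_mem_iSup h.lie_mem_left (hAB hx) hy,
    fun x hx y hy => lie_mem_iSup h.lie_mem hx hy, graded A hAg, graded B h.le_grading,
    iSup₂_le fun j hj => (h.eq_grading j hj).ge.trans (le_iSup A j), hAB, iSup_le fun j => ?_,
    hA3, hA4, fun x hx y hy => lie_mem_iSup h.lie_mem_left hx hy,
    finrank_add_finrank_of_orth hAB hA3 hA4⟩
  rcases lt_or_ge j 0 with hj | hj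
  · exact (h.le_grading j).trans (le_iSup₂_of_le j hj le_rfl)
  · rw [h.eq_bot j hj]
    exact bot_le

lemma IsMiddlePair.isAdmissibleFamily (hg : IsQGrading g) (he : e ∈ g a) (ha : 0 < a) {c : ℚ}
    (hc : c = -(a : ℚ) / 2) (hinj : ∀ j < c, ∀ x ∈ g j, ⁅e, x⁆ = 0 → x = 0)
    {U V : Submodule ℂ L} (h : IsMiddlePair g e c U V) :
    IsAdmissibleFamily g e a (midFamily g c U) (midFamily g c V) := by
  have ha' : (0 : ℚ) < a := by exact_mod_cast ha
  have hle : ∀ {W : Submodule ℂ L} {j : ℚ} {x : L}, x ∈ midFamily g c W j → x ≠ 0 → j ≤ c := by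
    intro W j x hx hx0
    by_contra! hj
    rw [midFamily_of_gt _ hj] at hx
    exact hx0 hx
  have hlie : ∀ {W : Submodule ℂ L}, W ≤ g c → ∀ i j, ∀ x ∈ midFamily g c V i,
      ∀ y ∈ midFamily g c W j, ⁅x, y⁆ ∈ midFamily g c W (i + j) := by
    intro W hW i j x hx y hy
    by_cases hx0 : x = 0
    · simp [hx0]
    by_cases hy0 : y = 0
    · simp [hy0]
    have hi := hle hx hx0
    have hj := hle hy hy0
    rw [midFamily_of_lt _ (by linarith)]
    exact hg.2 _ _ _ (midFamily_le h.le_grading i hx) _ (midFamily_le hW j hy)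
  refine ⟨midFamily_mono h.le, midFamily_le h.le_grading,
    fun j hj => midFamily_of_lt _ (by linarith), fun j hj => midFamily_of_gt _ (by linarith),
    hlie h.le_grading, hlie (h.le.trans h.le_grading), fun j x hx hx0 => ?_,
    fun i x hx hxo => ?_, fun i x hx y hy => ?_⟩
  · rcases lt_trichotomy j c with hj | rfl | hj
    · exact hinj j hj x (midFamily_le h.le_grading j hx) hx0
    · rw [midFamily_self] at hx
      exact h.eq_zero x hx hx0
    · rwa [midFamily_of_gt _ hj] at hx
  · rcases lt_trichotomy i c with hi | rfl | hi
    · exact ⟨x, by rwa [midFamily_of_lt _ hi], rfl⟩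
    · rw [show -(a : ℚ) - i = i by linarith, midFamily_self] at hxo
      rw [midFamily_self]
      exact h.exists_of_orth x hx hxo
    · rw [midFamily_of_lt _ (by linarith)] at hxo
      exact ⟨0, zero_mem _, by rw [lie_zero, lie_eq_zero_of_orth hg he hx hxo]⟩
  · rcases lt_trichotomy i c with hi | rfl | hi
    · rw [midFamily_of_gt _ (by linarith)] at hy
      rw [(Submodule.mem_bot ℂ).1 hy, map_zero]
    · rw [show -(a : ℚ) - i = i by linarith, midFamily_self] at hy
      rw [midFamily_self] at hx
      exact h.orth x hx y hy
    · rw [midFamily_of_gt _ hi] at hx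
      rw [(Submodule.mem_bot ℂ).1 hx]
      simp

lemma IsAdmissibleFamily.equivalentPairs (hg : IsQGrading g) (ha : 1 < a) (he : e ∈ g a)
    {A' B' : ℚ → Submodule ℂ L} (h : IsAdmissibleFamily g e a A B)
    (h' : IsAdmissibleFamily g e a A' B') (hA : ∀ j, A j ≤ A' j) (hB : ∀ j, B' j ≤ B j) :
    EquivalentPairs e (⨆ j, A j, ⨆ j, B j) (⨆ j, A' j, ⨆ j, B' j) :=
  .single ⟨g, a, hg, ha, he, h.isAdmissiblePairQ hg he, h'.isAdmissiblePairQ hg he,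
    .inl ⟨iSup_mono hA, iSup_mono h'.le, iSup_mono hB⟩⟩

lemma IsMiddlePair.equivalentPairs (hg : IsQGrading g) (ha : 1 < a) (he : e ∈ g a) {c : ℚ}
    (hc : c = -(a : ℚ) / 2) (hinj : ∀ j < c, ∀ x ∈ g j, ⁅e, x⁆ = 0 → x = 0)
    {U V U' V' : Submodule ℂ L} (h : IsMiddlePair g e c U V) (h' : IsMiddlePair g e c U' V')
    (hU : U ≤ U') (hV : V' ≤ V) :
    EquivalentPairs e (middle g c U V) (middle g c U' V') :=
  (h.isAdmissibleFamily hg he (by lia) hc hinj).equivalentPairs hg ha he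
    (h'.isAdmissibleFamily hg he (by lia) hc hinj) (midFamily_mono hU) (midFamily_mono hV)

lemma IsAdmissibleFamily.equivalentPairs_middle (hg : IsQGrading g) (ha : 1 < a) (he : e ∈ g a)
    {c : ℚ} (hc : c = -(a : ℚ) / 2) (hinj : ∀ j < c, ∀ x ∈ g j, ⁅e, x⁆ = 0 → x = 0)
    (h : IsAdmissibleFamily g e a A B) :
    EquivalentPairs e (⨆ j, A j, ⨆ j, B j) (middle g c (A c) (B c)) := by
  have ht := h.truncate hg (by lia) hc hinj
  have hm := (h.isMiddlePair hc).isAdmissibleFamily hg he (by lia) hc hinj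
  refine (equivalentPairs_symm (ht.equivalentPairs hg ha he h (fun j => ?_) fun j => ?_)).trans
    (ht.equivalentPairs hg ha he hm (fun j => ?_) fun j => ?_)
  · split_ifs
    exacts [bot_le, le_rfl]
  · split_ifs
    exacts [h.le_grading j, le_rfl]
  · split_ifs with hj
    · exact bot_le
    · rcases (not_lt.1 hj).lt_or_eq with hj | rfl
      · rw [midFamily_of_lt _ hj]
        exact (h.le j).trans (h.le_grading j)
      · rw [midFamily_self]
  · split_ifs with hj
    · rw [midFamily_of_lt _ hj]
    · rcases (not_lt.1 hj).lt_or_eq with hj | rfl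
      · rw [midFamily_of_gt _ hj]
        exact bot_le
      · rw [midFamily_self]

/-- A hyperplane of the second subspace of a middle pair `(⊥, V)` is the second subspace of a
middle pair. -/
lemma IsMiddlePair.exists_hyperplane_pair (hg : IsQGrading g) (he : e ∈ g a) {c : ℚ}
    (hc : c = -(a : ℚ) / 2) {V : Submodule ℂ L} (h : IsMiddlePair g e c ⊥ V) (f : L →ₗ[ℂ] ℂ) :
    ∃ U, IsMiddlePair g e c U (V ⊓ LinearMap.ker f) := by
  let φ : V →ₗ[ℂ] Dual ℂ V :=
    ((killingForm ℂ L).compl₁₂ (ad ℂ L e) LinearMap.id).domRestrict₁₂ V V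
  have hφ : ∀ x y : V, φ x y = killingForm ℂ L ⁅e, (x : L)⁆ y := fun _ _ => rfl
  have hrep : ∀ x ∈ g c, ∃ z ∈ V, ⁅e, x⁆ = ⁅e, z⁆ := fun x hx =>
    h.exists_of_orth x hx fun y hy => by rw [(Submodule.mem_bot ℂ).1 hy, map_zero]
  have hinj : Function.Injective φ := by
    rw [injective_iff_map_eq_zero]
    intro x hx
    refine Subtype.ext (h.eq_zero x x.2 (lie_eq_zero_of_orth hg he (h.le_grading x.2) ?_))
    rw [show -(a : ℚ) - c = c by linarith]
    intro y hy
    obtain ⟨z, hz, hyz⟩ := hrep y hy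
    rw [twist_symm, hyz, ← twist_symm]
    exact LinearMap.congr_fun hx ⟨z, hz⟩
  obtain ⟨u, hu⟩ := (LinearMap.injective_iff_surjective_of_finrank_eq_finrank
    Subspace.dual_finrank_eq.symm).1 hinj (f ∘ₗ V.subtype)
  have hfu : ∀ z ∈ V, killingForm ℂ L ⁅e, z⁆ u = - f z := fun z hz => by
    rw [twist_symm, neg_inj]
    exact LinearMap.congr_fun hu ⟨z, hz⟩
  refine ⟨ℂ ∙ (u : L), ?_, inf_le_left.trans h.le_grading, fun x hx => h.eq_zero x hx.1,
    fun x hx hxo => ?_, fun x hx y hy => ?_⟩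
  · rw [Submodule.span_singleton_le_iff_mem]
    refine ⟨u.2, ?_⟩
    have h1 := hfu u u.2
    have h2 := twist_symm e (u : L) u
    rw [h1] at h2
    exact self_eq_neg.1 (neg_inj.1 (by simpa using h2))
  · obtain ⟨z, hz, hxz⟩ := hrep x hx
    refine ⟨z, ⟨hz, ?_⟩, hxz⟩
    have h1 := hxo u (Submodule.mem_span_singleton_self _)
    rw [hxz, hfu z hz] at h1
    exact neg_eq_zero.1 h1
  · obtain ⟨t, rfl⟩ := Submodule.mem_span_singleton.1 hy
    have : f x = 0 := hx.2
    rw [map_smul, hfu x hx.1, this, neg_zero, smul_zero]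

lemma IsMiddlePair.equivalentPairs_bot (hg : IsQGrading g) (ha : 1 < a) (he : e ∈ g a)
    {c : ℚ} (hc : c = -(a : ℚ) / 2) (hinj : ∀ j < c, ∀ x ∈ g j, ⁅e, x⁆ = 0 → x = 0)
    {V W : Submodule ℂ L} (hV : IsMiddlePair g e c ⊥ V) (hW : IsMiddlePair g e c ⊥ W) :
    EquivalentPairs e (middle g c ⊥ V) (middle g c ⊥ W) := by
  have hbot : ∀ y ∈ (⊥ : Submodule ℂ L), ∀ x, killingForm ℂ L ⁅e, x⁆ y = 0 := fun y hy x => by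
    rw [(Submodule.mem_bot ℂ).1 hy, map_zero]
  induction hk : finrank ℂ L - finrank ℂ ↥(V ⊓ W) using Nat.strong_induction_on
    generalizing V with
  | _ k ih =>
  by_cases hVW : V ≤ W
  · have : V = W := by
      refine le_antisymm hVW fun x hx => ?_
      obtain ⟨z, hz, hxz⟩ := hV.exists_of_orth x (hW.le_grading hx) fun y hy => hbot y hy x
      have : x - z = 0 := hW.eq_zero _ (sub_mem hx (hVW hz)) (by rw [lie_sub, hxz, sub_self])
      rwa [sub_eq_zero.1 this]
    rw [this]
    exact .refl
  obtain ⟨x, hxV, hxW⟩ := SetLike.not_le_iff_exists.1 hVW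
  obtain ⟨f, hfx, hfW⟩ := Submodule.exists_le_ker_of_notMem hxW
  obtain ⟨y, hyW, hxy⟩ :=
    hW.exists_of_orth x (hV.le_grading hxV) fun y hy => hbot y hy x
  let T : L →ₗ[ℂ] L := LinearMap.id + f.smulRight ((f x)⁻¹ • (y - x))
  have hT : ∀ v, T v = v + f v • (f x)⁻¹ • (y - x) := fun v => rfl
  have hTe : ∀ v, ⁅e, T v⁆ = ⁅e, v⁆ := fun v => by simp [hT, hxy]
  have hTf : ∀ v, f v = 0 → T v = v := fun v hv => by simp [hT, hv]
  have hTx : T x = y := by simp [hT, smul_smul, hfx]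
  have hV' : IsMiddlePair g e c ⊥ (V.map T) := by
    refine ⟨bot_le, ?_, ?_, fun z hz hzo => ?_, fun z _ w hw => hbot w hw z⟩
    · rintro _ ⟨v, hv, rfl⟩
      exact add_mem (hV.le_grading hv) (Submodule.smul_mem _ _ (Submodule.smul_mem _ _
        (sub_mem (hW.le_grading hyW) (hV.le_grading hxV))))
    · rintro _ ⟨v, hv, rfl⟩ h0
      rw [hV.eq_zero v hv (by rwa [hTe] at h0), map_zero]
    · obtain ⟨v, hv, hzv⟩ := hV.exists_of_orth z hz hzo
      exact ⟨T v, Submodule.mem_map_of_mem hv, by rw [hTe, hzv]⟩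
  obtain ⟨U, hU⟩ := hV.exists_hyperplane_pair hg he hc f
  have h1 := hV.equivalentPairs hg ha he hc hinj hU bot_le inf_le_left
  have h2 := hV'.equivalentPairs hg ha he hc hinj hU bot_le
    fun v hv => ⟨v, hv.1, hTf v hv.2⟩
  refine (h1.trans (equivalentPairs_symm h2)).trans (ih _ ?_ hV' rfl)
  have hlt : V ⊓ W < V.map T ⊓ W := by
    refine lt_of_le_of_ne (fun v hv => ⟨⟨v, hv.1, hTf v (hfW hv.2)⟩, hv.2⟩) fun heq => hxW ?_
    have hyV : y ∈ V ⊓ W := heq ▸ ⟨⟨x, hxV, hTx⟩, hyW⟩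
    have : x - y = 0 := hV.eq_zero _ (sub_mem hxV hyV.1) (by rw [lie_sub, hxy, sub_self])
    rwa [sub_eq_zero.1 this]
  have h3 := Submodule.finrank_lt_finrank_of_lt hlt
  have h4 := Submodule.finrank_le (V.map T ⊓ W)
  lia

lemma IsAdmissibleFamily.equivalentPairs_of_injective (hg : IsQGrading g) (ha : 1 < a)
    (he : e ∈ g a) (hinj : ∀ j < -(a : ℚ) / 2, ∀ x ∈ g j, ⁅e, x⁆ = 0 → x = 0)
    {A' B' : ℚ → Submodule ℂ L} (h : IsAdmissibleFamily g e a A B)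
    (h' : IsAdmissibleFamily g e a A' B') :
    EquivalentPairs e (⨆ j, A j, ⨆ j, B j) (⨆ j, A' j, ⨆ j, B' j) := by
  have key : ∀ {A B : ℚ → Submodule ℂ L}, IsAdmissibleFamily g e a A B →
      ∃ V, IsMiddlePair g e (-(a : ℚ) / 2) ⊥ V ∧
        EquivalentPairs e (middle g (-(a : ℚ) / 2) ⊥ V) (⨆ j, A j, ⨆ j, B j) := by
    intro A B h
    have hm := h.isMiddlePair rfl
    obtain ⟨V, hBV, hV⟩ := hm.exists_bot_pair
    exact ⟨V, hV, (hV.equivalentPairs hg ha he rfl hinj hm bot_le hBV).trans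
      (equivalentPairs_symm (h.equivalentPairs_middle hg ha he rfl hinj))⟩
  obtain ⟨V, hV, hVA⟩ := key h
  obtain ⟨V', hV', hVA'⟩ := key h'
  exact ((equivalentPairs_symm hVA).trans
    (hV.equivalentPairs_bot hg ha he rfl hinj hV')).trans hVA'

end AdmissiblePairs

/-- **Theorem 6.7 (Sadaka).** Let `Γ : 𝔤 = ⊕_{j∈ℚ} 𝔤_j` be a `b`-optimal grading for `e`,
i.e. `𝔤_{<−b} ∩ 𝔤^e = 0` and there is an integer `a ≥ 2` with `e ∈ 𝔤_a` and `a ≥ 2b`.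
Then all `e`-admissible pairs relative to `Γ` are pairwise equivalent. -/
theorem stmt_14 {L : Type*} [LieRing L] [LieAlgebra ℂ L]
    [FiniteDimensional ℂ L] [LieAlgebra.IsSimple ℂ L]
    (e : L) (he : IsNilpotent (ad ℂ L e))
    (g : ℚ → Submodule ℂ L) (hg : IsQGrading g)
    (b : ℚ) (hb : 0 < b)
    (hopt : (⨆ j < -b, g j) ⊓ LinearMap.ker (ad ℂ L e) = ⊥)
    (a : ℤ) (ha : 2 ≤ a) (hea : e ∈ g (a : ℚ)) (hab : 2 * b ≤ (a : ℚ)) :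
    ∀ (a₁ a₂ : ℤ) (m₁ n₁ m₂ n₂ : Submodule ℂ L),
      1 < a₁ → e ∈ g (a₁ : ℚ) → 1 < a₂ → e ∈ g (a₂ : ℚ) →
      IsAdmissiblePairQ g e a₁ m₁ n₁ → IsAdmissiblePairQ g e a₂ m₂ n₂ →
      EquivalentPairs e (m₁, n₁) (m₂, n₂) := by
  intro a₁ a₂ m₁ n₁ m₂ n₂ ha₁ he₁ ha₂ he₂ h₁ h₂
  by_cases he0 : e = 0
  · have hbot : ∀ {a : ℤ} {m n : Submodule ℂ L}, IsAdmissiblePairQ g e a m n → m = ⊥ ∧ n = ⊥ := by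
      rintro a m n ⟨-, -, -, -, -, hmn, -, -, hA4, -, -⟩
      have hn : n = ⊥ := by
        rwa [he0, map_zero, LinearMap.ker_zero, inf_top_eq] at hA4
      exact ⟨eq_bot_iff.2 (hmn.trans hn.le), hn⟩
    rw [(hbot h₁).1, (hbot h₁).2, (hbot h₂).1, (hbot h₂).2]
    exact .refl
  have huniq : ∀ k : ℤ, e ∈ g (k : ℚ) → k = a := by
    intro k hk
    by_contra hne
    apply he0
    rw [← AdmissiblePairs.proj_of_mem hg hea,
      AdmissiblePairs.proj_of_mem_ne hg hk (by exact_mod_cast hne)]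
  obtain rfl := huniq a₁ he₁
  obtain rfl := huniq a₂ he₂
  have hinj : ∀ j < -(a₂ : ℚ) / 2, ∀ x ∈ g j, ⁅e, x⁆ = 0 → x = 0 := by
    intro j hj x hx hx0
    have : x ∈ (⨆ j < -b, g j) ⊓ LinearMap.ker (ad ℂ L e) :=
      ⟨Submodule.mem_iSup_of_mem j (Submodule.mem_iSup_of_mem (by linarith) hx), hx0⟩
    rwa [hopt] at this
  have h := (AdmissiblePairs.isAdmissibleFamily_of_isAdmissiblePairQ hg hea
    h₁).equivalentPairs_of_injective hg ha₁ hea hinj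
      (AdmissiblePairs.isAdmissibleFamily_of_isAdmissiblePairQ hg hea h₂)
  obtain ⟨-, -, hm₁, hn₁, -⟩ := h₁
  obtain ⟨-, -, hm₂, hn₂, -⟩ := h₂
  rwa [← hm₁, ← hn₁, ← hm₂, ← hn₂] at h
end
end

section
/- The e-admissible pairs relative to any b-optimal grading for e are equivalent to the optimal e-admissible pair (⊕_{j≤−2} 𝔤(j), ⊕_{j<0} 𝔤(j)) of a Dynkin grading associated to e. In particular, the associated W-algebras are isomorphic. -/
open Module LieAlgebra

noncomputable section

variable {L : Type*} [LieRing L] [LieAlgebra ℂ L]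

/-- The universal enveloping algebra of `𝔤`. -/
abbrev UEA (L : Type*) [LieRing L] [LieAlgebra ℂ L] := UniversalEnvelopingAlgebra ℂ L

/-- The left ideal `I(𝔪)` of `U(𝔤)` generated by the elements `x − χ(x)`, `x ∈ 𝔪`,
where `χ = ⟨e, ·⟩`. -/
def lideal (e : L) (m : Submodule ℂ L) : Submodule (UEA L) (UEA L) :=
  Submodule.span (UEA L)
    ((fun x : L => (UniversalEnvelopingAlgebra.ι ℂ x : UEA L)
        - algebraMap ℂ (UEA L) (killingForm ℂ L e x)) '' (m : Set L))

/-- `I(𝔪)`, viewed as a `ℂ`-subspace of `U(𝔤)`. -/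
def lidealC (e : L) (m : Submodule ℂ L) : Submodule ℂ (UEA L) :=
  (lideal e m).restrictScalars ℂ

/-- The `ℂ`-subspace of `U(𝔤)` of elements `u` with `[ι x, u] ∈ I(𝔪)` for all `x ∈ 𝔫`
(i.e. elements whose class in `Q(𝔪)` is `ad 𝔫`-invariant). -/
def invSet (e : L) (m n : Submodule ℂ L) : Submodule ℂ (UEA L) :=
  ⨅ x ∈ n, Submodule.comap
    (LinearMap.mulLeft ℂ ((UniversalEnvelopingAlgebra.ι ℂ x : UEA L))
      - LinearMap.mulRight ℂ ((UniversalEnvelopingAlgebra.ι ℂ x : UEA L)))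
    (lidealC e m)

/-- The W-algebra `H(𝔪, 𝔫) = Q(𝔪)^{ad 𝔫}`, as a `ℂ`-subspace of `Q(𝔪) = U(𝔤)/I(𝔪)`. -/
def Hsub (e : L) (m n : Submodule ℂ L) : Submodule ℂ (UEA L ⧸ lidealC e m) :=
  (invSet e m n).map (lidealC e m).mkQ

/-- The statement that the W-algebras `H(𝔪₁, 𝔫₁)` and `H(𝔪₂, 𝔫₂)` are isomorphic as
unital `ℂ`-algebras: there is a `ℂ`-linear equivalence preserving the class of `1` and
compatible with the multiplications induced from `U(𝔤)`. -/
def WAlgebraIso (e : L) (m₁ n₁ m₂ n₂ : Submodule ℂ L) : Prop :=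
  ∃ φ : ↥(Hsub e m₁ n₁) ≃ₗ[ℂ] ↥(Hsub e m₂ n₂),
    (∀ p : ↥(Hsub e m₁ n₁), (p : UEA L ⧸ lidealC e m₁) = Submodule.Quotient.mk 1 →
      ((φ p : UEA L ⧸ lidealC e m₂) = Submodule.Quotient.mk 1)) ∧
    ∀ p q r : ↥(Hsub e m₁ n₁),
      (∃ u v : UEA L, u ∈ invSet e m₁ n₁ ∧ v ∈ invSet e m₁ n₁ ∧
        (p : UEA L ⧸ lidealC e m₁) = Submodule.Quotient.mk u ∧
        (q : UEA L ⧸ lidealC e m₁) = Submodule.Quotient.mk v ∧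
        (r : UEA L ⧸ lidealC e m₁) = Submodule.Quotient.mk (u * v)) →
      (∃ u' v' : UEA L, u' ∈ invSet e m₂ n₂ ∧ v' ∈ invSet e m₂ n₂ ∧
        (φ p : UEA L ⧸ lidealC e m₂) = Submodule.Quotient.mk u' ∧
        (φ q : UEA L ⧸ lidealC e m₂) = Submodule.Quotient.mk v' ∧
        (φ r : UEA L ⧸ lidealC e m₂) = Submodule.Quotient.mk (u' * v'))

section Weyl

variable {V : Type*} [AddCommGroup V] [Module ℂ V]

lemma weyl_ker_inf_range {δ ρ : V →ₗ[ℂ] V} (hc : ∀ u, δ (ρ u) = ρ (δ u) + u)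
    (v : V) (k : ℕ) (hk : (δ ^ k) v = 0) (hv : δ (ρ v) = 0) : v = 0 := by
  have hδ : ∀ j u, δ ((δ ^ j) u) = (δ ^ (j + 1)) u := fun j u => by rw [pow_succ']; rfl
  induction k with
  | zero => simpa using hk
  | succ k ih =>
    apply ih
    have comm : ∀ j : ℕ, ∀ u, (δ ^ (j + 1)) (ρ u)
        = ρ ((δ ^ (j + 1)) u) + ((j : ℂ) + 1) • (δ ^ j) u := by
      intro j
      induction j with
      | zero => intro u; simp [hc]
      | succ j ihj =>
        intro u
        rw [← hδ (j + 1), ihj, map_add, hc, map_smul, hδ, hδ]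
        push_cast
        module
    have h1 := comm k v
    rw [pow_succ, Module.End.mul_apply, hv, map_zero, ← pow_succ, hk, map_zero, zero_add] at h1
    exact (smul_eq_zero.mp h1.symm).resolve_left (by exact_mod_cast Nat.succ_ne_zero k)

lemma weyl_decompose {δ ρ : V →ₗ[ℂ] V} (hc : ∀ u, δ (ρ u) = ρ (δ u) + u)
    (k : ℕ) (u : V) (hk : (δ ^ k) u = 0) : ∃ v w, u = v + ρ w ∧ δ v = 0 := by
  have hδ : ∀ j u, δ ((δ ^ j) u) = (δ ^ (j + 1)) u := fun j u => by rw [pow_succ']; rfl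
  induction k generalizing u with
  | zero => exact ⟨0, 0, by simpa using hk, by simp⟩
  | succ k ih =>
    rcases Nat.eq_zero_or_pos k with rfl | hpos
    · exact ⟨u, 0, by simp, by simpa using hk⟩
    have comm : ∀ j : ℕ, ∀ u, (δ ^ j) (ρ (δ u)) = ρ ((δ ^ (j + 1)) u) + (j : ℂ) • (δ ^ j) u := by
      intro j
      induction j with
      | zero => intro u; simp
      | succ j ihj =>
        intro u
        rw [← hδ j (ρ (δ u)), ihj, map_add, hc, map_smul, hδ, hδ]
        push_cast
        module
    have hk0 : (k : ℂ) ≠ 0 := by exact_mod_cast hpos.ne'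
    obtain ⟨v, w, h1, h2⟩ := ih (u - ρ ((k : ℂ)⁻¹ • δ u)) (by
      rw [map_sub, map_smul, map_smul, comm, hk, map_zero, zero_add, smul_smul,
        inv_mul_cancel₀ hk0, one_smul, sub_self])
    exact ⟨v, w + (k : ℂ)⁻¹ • δ u, by rw [map_add, ← add_assoc, ← h1]; simp, h2⟩

variable (I : Submodule ℂ V) {δ ρ : V →ₗ[ℂ] V}

lemma weyl_ker_inf_range_mod (hδ : ∀ u ∈ I, δ u ∈ I) (hρ : ∀ u ∈ I, ρ u ∈ I)
    (hc : ∀ u, δ (ρ u) - ρ (δ u) - u ∈ I) (hn : ∀ u, ∃ k : ℕ, (δ ^ k) u = 0)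
    {v : V} (hv : δ (ρ v) ∈ I) : v ∈ I := by
  obtain ⟨k, hk⟩ := hn v
  rw [← Submodule.Quotient.mk_eq_zero]
  refine weyl_ker_inf_range (δ := I.mapQ I δ hδ) (ρ := I.mapQ I ρ hρ) ?_ _ k ?_ ?_
  · intro u
    obtain ⟨u, rfl⟩ := Submodule.Quotient.mk_surjective I u
    simp only [Submodule.mapQ_apply]
    rw [← Submodule.Quotient.mk_add, Submodule.Quotient.eq]
    simpa [sub_sub] using hc u
  · have : I ≤ I.comap (δ ^ k) := by
      intro u hu
      have : ∀ j : ℕ, (δ ^ j) u ∈ I := by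
        intro j
        induction j with
        | zero => simpa using hu
        | succ j ih => rw [pow_succ']; exact hδ _ ih
      exact this k
    rw [← Submodule.mapQ_pow (h := hδ) (k := k) (h' := this), Submodule.mapQ_apply, hk,
      Submodule.Quotient.mk_zero]
  · simpa only [Submodule.mapQ_apply, Submodule.Quotient.mk_eq_zero] using hv

lemma weyl_decompose_mod (hδ : ∀ u ∈ I, δ u ∈ I) (hρ : ∀ u ∈ I, ρ u ∈ I)
    (hc : ∀ u, δ (ρ u) - ρ (δ u) - u ∈ I) (hn : ∀ u, ∃ k : ℕ, (δ ^ k) u = 0)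
    (u : V) : ∃ v w, u = v + ρ w ∧ δ v ∈ I := by
  obtain ⟨k, hk⟩ := hn u
  obtain ⟨v, w, h1, h2⟩ := weyl_decompose (δ := I.mapQ I δ hδ) (ρ := I.mapQ I ρ hρ)
    (u := Submodule.Quotient.mk u) (k := k) (by
      intro u
      obtain ⟨u, rfl⟩ := Submodule.Quotient.mk_surjective I u
      simp only [Submodule.mapQ_apply]
      rw [← Submodule.Quotient.mk_add, Submodule.Quotient.eq]
      simpa [sub_sub] using hc u) (by
      have : I ≤ I.comap (δ ^ k) := by
        intro u hu
        have : ∀ j : ℕ, (δ ^ j) u ∈ I := by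
          intro j
          induction j with
          | zero => simpa using hu
          | succ j ih => rw [pow_succ']; exact hδ _ ih
        exact this k
      rw [← Submodule.mapQ_pow (h := hδ) (k := k) (h' := this), Submodule.mapQ_apply, hk,
        Submodule.Quotient.mk_zero])
  obtain ⟨v, rfl⟩ := Submodule.Quotient.mk_surjective I v
  obtain ⟨w, rfl⟩ := Submodule.Quotient.mk_surjective I w
  rw [Submodule.mapQ_apply, ← Submodule.Quotient.mk_add, Submodule.Quotient.eq] at h1
  rw [Submodule.mapQ_apply, Submodule.Quotient.mk_eq_zero] at h2
  refine ⟨u - ρ w, w, by simp, ?_⟩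
  have : u - ρ w = (u - (v + ρ w)) + v := by abel
  rw [this, map_add]
  exact I.add_mem (hδ _ h1) h2

end Weyl

section Enveloping

attribute [local instance 100] LieRing.ofAssociativeRing

/-! ### Local nilpotency of inner derivations of the enveloping algebra -/

lemma commutator_pow_mul_eq_zero {A : Type*} [Ring A] [Algebra ℂ A] (x : A) :
    ∀ (n k l : ℕ), k + l = n → ∀ u v : A,
      ((LinearMap.mulLeft ℂ x - LinearMap.mulRight ℂ x) ^ k) u = 0 →
      ((LinearMap.mulLeft ℂ x - LinearMap.mulRight ℂ x) ^ l) v = 0 →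
      ((LinearMap.mulLeft ℂ x - LinearMap.mulRight ℂ x) ^ n) (u * v) = 0 := by
  intro n
  induction n with
  | zero =>
    intro k l hkl u v hu _
    obtain rfl : k = 0 := by omega
    simp_all
  | succ n ih =>
    intro k l hkl u v hu hv
    rcases k with _ | k
    · simp_all
    rcases l with _ | l
    · simp_all
    have e1 : (LinearMap.mulLeft ℂ x - LinearMap.mulRight ℂ x) (u * v)
        = (LinearMap.mulLeft ℂ x - LinearMap.mulRight ℂ x) u * v
          + u * (LinearMap.mulLeft ℂ x - LinearMap.mulRight ℂ x) v := by
      simp [sub_mul, mul_sub, mul_assoc]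
    rw [pow_succ, Module.End.mul_apply, e1, map_add,
      ih k (l + 1) (by omega) _ _ (by rwa [← Module.End.mul_apply, ← pow_succ]) hv,
      ih (k + 1) l (by omega) _ _ hu (by rwa [← Module.End.mul_apply, ← pow_succ]), add_zero]

lemma commutator_ι_locally_nilpotent {x : L} (hx : IsNilpotent (ad ℂ L x)) (u : UEA L) :
    ∃ k : ℕ, ((LinearMap.mulLeft ℂ (UniversalEnvelopingAlgebra.ι ℂ x : UEA L)
      - LinearMap.mulRight ℂ (UniversalEnvelopingAlgebra.ι ℂ x : UEA L)) ^ k) u = 0 := by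
  set δ := LinearMap.mulLeft ℂ (UniversalEnvelopingAlgebra.ι ℂ x : UEA L)
      - LinearMap.mulRight ℂ (UniversalEnvelopingAlgebra.ι ℂ x : UEA L) with hδ
  have mono : ∀ {j k : ℕ} {v : UEA L}, (δ ^ j) v = 0 → j ≤ k → (δ ^ k) v = 0 := by
    intro j k v hj hjk
    rw [← Nat.sub_add_cancel hjk, pow_add, Module.End.mul_apply, hj, map_zero]
  let S : Subalgebra ℂ (UEA L) :=
    { carrier := {u | ∃ k : ℕ, (δ ^ k) u = 0}
      mul_mem' := by
        rintro a b ⟨k, hk⟩ ⟨l, hl⟩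
        exact ⟨k + l, commutator_pow_mul_eq_zero _ _ k l rfl _ _ hk hl⟩
      add_mem' := by
        rintro a b ⟨k, hk⟩ ⟨l, hl⟩
        exact ⟨max k l, by rw [map_add, mono hk (le_max_left _ _), mono hl (le_max_right _ _),
          add_zero]⟩
      algebraMap_mem' := fun r => ⟨1, by simp [hδ, Algebra.commutes]⟩ }
  have hι : ∀ y : L, UniversalEnvelopingAlgebra.ι ℂ y ∈ S := by
    obtain ⟨k, hk⟩ := hx
    intro y
    have key : ∀ j : ℕ, (δ ^ j) (UniversalEnvelopingAlgebra.ι ℂ y)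
        = UniversalEnvelopingAlgebra.ι ℂ (((ad ℂ L x) ^ j) y) := by
      intro j
      induction j with
      | zero => simp
      | succ j ih =>
        rw [pow_succ', Module.End.mul_apply, ih, pow_succ', Module.End.mul_apply, ad_apply,
          LieHom.map_lie, LieRing.of_associative_ring_bracket]
        simp [hδ]
    exact ⟨k, by rw [key, hk]; simp⟩
  let f : L →ₗ⁅ℂ⁆ S :=
    { toFun := fun y => ⟨UniversalEnvelopingAlgebra.ι ℂ y, hι y⟩
      map_add' := fun a b => Subtype.ext (by simp)
      map_smul' := fun c a => Subtype.ext (by simp)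
      map_lie' := fun {a b} => Subtype.ext (by
        simp [LieRing.of_associative_ring_bracket]) }
  have hid : S.val.comp (UniversalEnvelopingAlgebra.lift ℂ f) = AlgHom.id ℂ (UEA L) := by
    apply UniversalEnvelopingAlgebra.hom_ext
    ext y
    simp [f]
  have := (UniversalEnvelopingAlgebra.lift ℂ f u).2
  have h2 : ((UniversalEnvelopingAlgebra.lift ℂ f u : S) : UEA L) = u :=
    DFunLike.congr_fun hid u
  rwa [h2] at this

/-! ### The left ideals `I(𝔪)` and invariants -/

lemma mem_lidealC {e : L} {m : Submodule ℂ L} {u : UEA L} :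
    u ∈ lidealC e m ↔ u ∈ lideal e m := Iff.rfl

lemma mem_invSet {e : L} {m n : Submodule ℂ L} {u : UEA L} :
    u ∈ invSet e m n ↔ ∀ x ∈ n, (UniversalEnvelopingAlgebra.ι ℂ x : UEA L) * u
      - u * UniversalEnvelopingAlgebra.ι ℂ x ∈ lideal e m := by
  simp [invSet, Submodule.mem_iInf, mem_lidealC]

lemma lideal_mono {e : L} {m m' : Submodule ℂ L} (h : m ≤ m') : lideal e m ≤ lideal e m' :=
  Submodule.span_mono (Set.image_mono h)

lemma ι_sub_mem_lideal (e : L) {m : Submodule ℂ L} {x : L} (hx : x ∈ m) :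
    (UniversalEnvelopingAlgebra.ι ℂ x : UEA L) - algebraMap ℂ (UEA L) (killingForm ℂ L e x)
      ∈ lideal e m :=
  Submodule.subset_span ⟨x, hx, rfl⟩

lemma mul_ι_mem_lideal {e : L} {m : Submodule ℂ L} {x : L} (hx : x ∈ m)
    (hχ : killingForm ℂ L e x = 0) (u : UEA L) :
    u * UniversalEnvelopingAlgebra.ι ℂ x ∈ lideal e m := by
  have := (lideal e m).smul_mem u (ι_sub_mem_lideal e hx)
  rwa [hχ, map_zero, sub_zero, smul_eq_mul] at this

lemma mul_mem_lideal {e : L} {m : Submodule ℂ L} {u : UEA L} (hu : u ∈ lideal e m) (v : UEA L) :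
    v * u ∈ lideal e m := (lideal e m).smul_mem v hu

/-- If `w` normalizes `𝔪` and the character `χ` of `𝔪`, then `ad w` preserves `I(𝔪)`. -/
lemma commutator_mem_lideal {e : L} {m : Submodule ℂ L} {w : L}
    (hw : ∀ y ∈ m, ⁅w, y⁆ ∈ m) (hχ : ∀ y ∈ m, killingForm ℂ L e ⁅w, y⁆ = 0)
    {u : UEA L} (hu : u ∈ lideal e m) :
    (UniversalEnvelopingAlgebra.ι ℂ w : UEA L) * u - u * UniversalEnvelopingAlgebra.ι ℂ w
      ∈ lideal e m := by
  induction hu using Submodule.span_induction with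
  | mem x h =>
    obtain ⟨y, hy, rfl⟩ := h
    have := mul_ι_mem_lideal (hw y hy) (hχ y hy) 1
    rw [one_mul, LieHom.map_lie, LieRing.of_associative_ring_bracket] at this
    convert this using 1
    simp only [mul_sub, sub_mul, Algebra.commutes]
    abel
  | zero => simp
  | add x y _ _ hx hy =>
    convert (lideal e m).add_mem hx hy using 1
    noncomm_ring
  | smul a x hx' hx =>
    have h2 := (lideal e m).smul_mem
      (UniversalEnvelopingAlgebra.ι ℂ w * a - a * UniversalEnvelopingAlgebra.ι ℂ w) hx'
    have h1 := (lideal e m).smul_mem a hx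
    convert (lideal e m).add_mem h1 h2 using 1
    simp only [smul_eq_mul]
    noncomm_ring

/-- Right multiplication by `y - χ(y)` preserves `I(𝔪)` if `y` normalizes `𝔪` and its
character `χ`. -/
lemma mul_sub_mem_lideal {e : L} {m : Submodule ℂ L} {y : L}
    (hy : ∀ z ∈ m, ⁅y, z⁆ ∈ m) (hχ : ∀ z ∈ m, killingForm ℂ L e ⁅y, z⁆ = 0)
    {u : UEA L} (hu : u ∈ lideal e m) :
    u * ((UniversalEnvelopingAlgebra.ι ℂ y : UEA L)
      - algebraMap ℂ (UEA L) (killingForm ℂ L e y)) ∈ lideal e m := by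
  have h1 := commutator_mem_lideal hy hχ hu
  have h2 := mul_mem_lideal hu
    (UniversalEnvelopingAlgebra.ι ℂ y - algebraMap ℂ (UEA L) (killingForm ℂ L e y))
  convert (lideal e m).sub_mem h2 h1 using 1
  simp only [mul_sub, sub_mul, Algebra.commutes]
  abel

lemma mem_lideal_sup_span {e y : L} {m : Submodule ℂ L} {u : UEA L}
    (hu : u ∈ lideal e (m ⊔ Submodule.span ℂ {y})) :
    ∃ w : UEA L, u - w * ((UniversalEnvelopingAlgebra.ι ℂ y : UEA L)
      - algebraMap ℂ (UEA L) (killingForm ℂ L e y)) ∈ lideal e m := by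
  induction hu using Submodule.span_induction with
  | mem x h =>
    obtain ⟨z', hz', rfl⟩ := h
    obtain ⟨z, hz, t, ht, rfl⟩ := Submodule.mem_sup.mp hz'
    obtain ⟨c, rfl⟩ := Submodule.mem_span_singleton.mp ht
    refine ⟨algebraMap ℂ _ c, ?_⟩
    convert ι_sub_mem_lideal e hz using 1
    simp only [map_add, map_smul, Algebra.smul_def, mul_sub, map_mul, Algebra.algebraMap_self,
      RingHom.id_apply]
    abel
  | zero => exact ⟨0, by simp⟩
  | add a b _ _ ha hb =>
    obtain ⟨w, hw⟩ := ha
    obtain ⟨w', hw'⟩ := hb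
    refine ⟨w + w', ?_⟩
    convert (lideal e m).add_mem hw hw' using 1
    rw [add_mul]; abel
  | smul a b _ hb =>
    obtain ⟨w, hw⟩ := hb
    refine ⟨a * w, ?_⟩
    convert (lideal e m).smul_mem a hw using 1
    simp only [smul_eq_mul, mul_sub, mul_assoc]

/-- The pairs `(𝔪, 𝔫)` and `(𝔪', 𝔫')` with `𝔪 ⊆ 𝔪' ⊆ 𝔫' ⊆ 𝔫` are such that the natural map
`Q(𝔪) → Q(𝔪')` restricts to a bijection `H(𝔪, 𝔫) → H(𝔪', 𝔫')`. -/
structure NaturalIso (e : L) (m n m' n' : Submodule ℂ L) : Prop where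
  le_left : m ≤ m'
  le_right : n' ≤ n
  inj : ∀ u ∈ invSet e m n, u ∈ lideal e m' → u ∈ lideal e m
  surj : ∀ u ∈ invSet e m' n', ∃ v ∈ invSet e m n, u - v ∈ lideal e m'

lemma invSet_mono {e : L} {m n m' n' : Submodule ℂ L} (hm : m ≤ m') (hn : n' ≤ n) :
    invSet e m n ≤ invSet e m' n' := fun _ hu =>
  mem_invSet.mpr fun x hx => lideal_mono hm (mem_invSet.mp hu x (hn hx))

lemma NaturalIso.refl (e : L) (m n : Submodule ℂ L) : NaturalIso e m n m n :=
  ⟨le_rfl, le_rfl, fun _ _ h => h, fun u hu => ⟨u, hu, by simp⟩⟩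

lemma NaturalIso.trans {e : L} {m n m' n' m'' n'' : Submodule ℂ L}
    (h : NaturalIso e m n m' n') (h' : NaturalIso e m' n' m'' n'') :
    NaturalIso e m n m'' n'' where
  le_left := h.le_left.trans h'.le_left
  le_right := h'.le_right.trans h.le_right
  inj u hu hu' := h.inj u hu (h'.inj u (invSet_mono h.le_left h.le_right hu) hu')
  surj u hu := by
    obtain ⟨v, hv, h1⟩ := h'.surj u hu
    obtain ⟨w, hw, h2⟩ := h.surj v hv
    refine ⟨w, hw, ?_⟩
    have := (lideal e m'').add_mem h1 (lideal_mono h'.le_left h2)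
    rwa [sub_add_sub_cancel] at this

lemma killingForm_bracket_jacobi (e x z y : L) :
    killingForm ℂ L e ⁅⁅x, z⁆, y⁆ = killingForm ℂ L e ⁅x, ⁅z, y⁆⁆ - killingForm ℂ L e ⁅z, ⁅x, y⁆⁆ := by
  rw [lie_lie, map_sub]

/-- Adjoining to `𝔪` one vector `y` that is central in `𝔫` modulo `𝔪`, and replacing `𝔫` by the
annihilator of `y`, does not change the W-algebra. -/
lemma NaturalIso.of_span_singleton {e x y : L} {m n n' : Submodule ℂ L}
    (hnn : ∀ z ∈ n, ∀ w ∈ n, ⁅z, w⁆ ∈ n)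
    (hnm : ∀ z ∈ n, ∀ w ∈ m, ⁅z, w⁆ ∈ m) (hχ : ∀ z ∈ n, ∀ w ∈ m, killingForm ℂ L e ⁅z, w⁆ = 0)
    (hyn : y ∈ n) (hy : ∀ z ∈ n, ⁅z, y⁆ ∈ m) (hxn : x ∈ n) (hxy : killingForm ℂ L e ⁅x, y⁆ = 1)
    (hx : IsNilpotent (ad ℂ L x))
    (hn' : ∀ z, z ∈ n' ↔ z ∈ n ∧ killingForm ℂ L e ⁅z, y⁆ = 0) :
    NaturalIso e m n (m ⊔ Submodule.span ℂ {y}) n' := by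
  set I := lideal e m with hI
  set I' := lideal e (m ⊔ Submodule.span ℂ {y}) with hI'
  have hII' : I ≤ I' := lideal_mono le_sup_left
  set ix : UEA L := UniversalEnvelopingAlgebra.ι ℂ x with hix
  set iy : UEA L := UniversalEnvelopingAlgebra.ι ℂ y - algebraMap ℂ (UEA L) (killingForm ℂ L e y)
    with hiy
  set δ : UEA L →ₗ[ℂ] UEA L := LinearMap.mulLeft ℂ ix - LinearMap.mulRight ℂ ix with hδdef
  set ρ : UEA L →ₗ[ℂ] UEA L := LinearMap.mulRight ℂ iy with hρdef
  have hδa : ∀ u, δ u = ix * u - u * ix := fun u => by simp [hδdef]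
  have hρa : ∀ u, ρ u = u * iy := fun u => by simp [hρdef]
  have hadn : ∀ z ∈ n, ∀ u ∈ I, (UniversalEnvelopingAlgebra.ι ℂ z : UEA L) * u
      - u * UniversalEnvelopingAlgebra.ι ℂ z ∈ I := fun z hz u hu =>
    commutator_mem_lideal (hnm z hz) (hχ z hz) hu
  have hδ : ∀ u ∈ lidealC e m, δ u ∈ lidealC e m := fun u hu => by
    rw [hδa]; exact hadn x hxn u hu
  have hρ : ∀ u ∈ lidealC e m, ρ u ∈ lidealC e m := fun u hu => by
    rw [hρa]; exact mul_sub_mem_lideal (hnm y hyn) (hχ y hyn) hu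
  have hc : ∀ u, δ (ρ u) - ρ (δ u) - u ∈ lidealC e m := fun u => by
    have h1 := (lideal e m).smul_mem u (ι_sub_mem_lideal e (hy x hxn))
    rw [hxy, LieHom.map_lie, LieRing.of_associative_ring_bracket, map_one, smul_eq_mul] at h1
    rw [mem_lidealC]
    convert h1 using 1
    simp only [hδa, hρa, hiy, mul_sub, sub_mul, ← hix, Algebra.commutes, mul_assoc, mul_one]
    simp only [← Algebra.commutes]
    noncomm_ring
  have hnil := commutator_ι_locally_nilpotent hx
  have hρI' : ∀ u, ρ u ∈ I' := fun u => by
    rw [hρa]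
    exact mul_mem_lideal (ι_sub_mem_lideal e
      (Submodule.mem_sup_right (Submodule.mem_span_singleton_self y))) u
  refine ⟨le_sup_left, fun z hz => ((hn' z).mp hz).1, ?_, ?_⟩
  · intro u hu hu'
    obtain ⟨w, hw⟩ := mem_lideal_sup_span hu'
    have h1 : δ u ∈ I := by rw [hδa]; exact mem_invSet.mp hu x hxn
    have h2 : δ (ρ w) ∈ I := by
      have h3 := I.sub_mem h1 (hδ _ hw)
      rw [← map_sub] at h3
      rwa [sub_sub_cancel, ← hρa] at h3
    have h3 : w ∈ lidealC e m := weyl_ker_inf_range_mod (lidealC e m) hδ hρ hc hnil h2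
    have h4 := I.add_mem hw (hρ w h3)
    rwa [hρa, sub_add_cancel] at h4
  · intro u hu
    obtain ⟨v, w, huv, hv⟩ := weyl_decompose_mod (lidealC e m) hδ hρ hc hnil u
    have hsub : u - v ∈ I' := by
      rw [huv, add_sub_cancel_left]; exact hρI' w
    have hadn' : ∀ z ∈ n', ∀ u ∈ I', (UniversalEnvelopingAlgebra.ι ℂ z : UEA L) * u
        - u * UniversalEnvelopingAlgebra.ι ℂ z ∈ I' := by
      intro z hz u hu
      obtain ⟨hzn, hzy⟩ := (hn' z).mp hz
      refine commutator_mem_lideal ?_ ?_ hu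
      · intro t ht
        obtain ⟨t, htm, s, hs, rfl⟩ := Submodule.mem_sup.mp ht
        obtain ⟨c, rfl⟩ := Submodule.mem_span_singleton.mp hs
        rw [lie_add, lie_smul]
        exact Submodule.mem_sup_left (m.add_mem (hnm z hzn t htm) (m.smul_mem c (hy z hzn)))
      · intro t ht
        obtain ⟨t, htm, s, hs, rfl⟩ := Submodule.mem_sup.mp ht
        obtain ⟨c, rfl⟩ := Submodule.mem_span_singleton.mp hs
        rw [lie_add, lie_smul, map_add, map_smul, hzy, hχ z hzn t htm]
        simp
    have key : ∀ k : ℕ, ∀ z ∈ n', ((ad ℂ L x) ^ k) z = 0 →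
        (UniversalEnvelopingAlgebra.ι ℂ z : UEA L) * v - v * UniversalEnvelopingAlgebra.ι ℂ z
          ∈ I := by
      intro k
      induction k with
      | zero =>
        intro z _ hz
        obtain rfl : z = 0 := by simpa using hz
        simp
      | succ k ih =>
        intro z hz hzk
        obtain ⟨hzn, hzy⟩ := (hn' z).mp hz
        set iz : UEA L := UniversalEnvelopingAlgebra.ι ℂ z with hiz
        have h1 : iz * v - v * iz ∈ I' := by
          have h2 := I'.sub_mem (mem_invSet.mp hu z hz) (hadn' z hz _ hsub)
          convert h2 using 1
          noncomm_ring
        obtain ⟨w', hw'⟩ := mem_lideal_sup_span h1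
        have hxz : ⁅x, z⁆ ∈ n' := by
          refine (hn' _).mpr ⟨hnn x hxn z hzn, ?_⟩
          rw [killingForm_bracket_jacobi, hχ x hxn _ (hy z hzn), hχ z hzn _ (hy x hxn), sub_zero]
        have h2 := ih ⁅x, z⁆ hxz (by
          rwa [pow_succ, Module.End.mul_apply, ad_apply] at hzk)
        rw [LieHom.map_lie, LieRing.of_associative_ring_bracket] at h2
        have h3 := hadn z hzn _ hv
        have h4 : δ (iz * v - v * iz) ∈ I := by
          convert I.add_mem h2 h3 using 1
          simp only [hδa, ← hix, ← hiz]
          noncomm_ring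
        have h5 : δ (ρ w') ∈ I := by
          have h3 := I.sub_mem h4 (hδ _ hw')
          rw [← map_sub] at h3
          rwa [sub_sub_cancel, ← hρa] at h3
        have h6 : w' ∈ lidealC e m := weyl_ker_inf_range_mod (lidealC e m) hδ hρ hc hnil h5
        have h7 := I.add_mem hw' (hρ w' h6)
        rwa [hρa, sub_add_cancel] at h7
    refine ⟨v, mem_invSet.mpr fun z hz => ?_, hsub⟩
    obtain ⟨k, hk⟩ := hx
    have h1 : z - killingForm ℂ L e ⁅z, y⁆ • x ∈ n' := by
      refine (hn' _).mpr ⟨n.sub_mem hz (n.smul_mem _ hxn), ?_⟩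
      rw [sub_lie, smul_lie, map_sub, map_smul, hxy]
      simp
    have h2 := key k _ h1 (by rw [hk]; simp)
    have h3 := (lidealC e m).smul_mem (killingForm ℂ L e ⁅z, y⁆) hv
    rw [hδa] at h3
    have h4 := I.add_mem h2 h3
    convert h4 using 1
    simp only [map_sub, map_smul, sub_mul, mul_sub, smul_sub, ← hix, smul_mul_assoc,
      mul_smul_comm]
    abel

/-! ### From natural isomorphisms to isomorphisms of W-algebras -/

lemma mk_mem_Hsub {e : L} {m n : Submodule ℂ L} {u : UEA L} (hu : u ∈ invSet e m n) :
    (Submodule.Quotient.mk u : UEA L ⧸ lidealC e m) ∈ Hsub e m n := ⟨u, hu, rfl⟩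

lemma exists_rep_of_mem_Hsub {e : L} {m n : Submodule ℂ L} (p : Hsub e m n) :
    ∃ u ∈ invSet e m n, (p : UEA L ⧸ lidealC e m) = Submodule.Quotient.mk u := by
  obtain ⟨u, hu, h⟩ := p.2
  exact ⟨u, hu, h.symm⟩

lemma WAlgebraIso.refl (e : L) (m n : Submodule ℂ L) : WAlgebraIso e m n m n :=
  ⟨LinearEquiv.refl ℂ _, fun _ h => h, fun _ _ _ h => h⟩

lemma WAlgebraIso.trans {e : L} {m₁ n₁ m₂ n₂ m₃ n₃ : Submodule ℂ L}
    (h : WAlgebraIso e m₁ n₁ m₂ n₂) (h' : WAlgebraIso e m₂ n₂ m₃ n₃) :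
    WAlgebraIso e m₁ n₁ m₃ n₃ := by
  obtain ⟨φ, h1, h2⟩ := h
  obtain ⟨ψ, h3, h4⟩ := h'
  exact ⟨φ.trans ψ, fun p hp => h3 _ (h1 p hp), fun p q r hpqr => h4 _ _ _ (h2 p q r hpqr)⟩

lemma mul_mem_lideal_of_mem_invSet {e : L} {m n : Submodule ℂ L} (hmn : m ≤ n) {u v : UEA L}
    (hu : u ∈ lideal e m) (hv : v ∈ invSet e m n) : u * v ∈ lideal e m := by
  induction hu using Submodule.span_induction with
  | mem x h =>
    obtain ⟨y, hy, rfl⟩ := h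
    have h1 := mem_invSet.mp hv y (hmn hy)
    have h2 := mul_mem_lideal (ι_sub_mem_lideal e hy) v
    convert (lideal e m).add_mem h1 h2 using 1
    simp only [mul_sub, sub_mul, Algebra.commutes]
    abel
  | zero => simp
  | add a b _ _ ha hb => rw [add_mul]; exact (lideal e m).add_mem ha hb
  | smul a b _ hb => rw [smul_mul_assoc]; exact (lideal e m).smul_mem a hb

lemma mul_sub_mul_mem_lideal {e : L} {m n : Submodule ℂ L} (hmn : m ≤ n) {u u' v v' : UEA L}
    (hv' : v' ∈ invSet e m n) (hu : u - u' ∈ lideal e m) (hv : v - v' ∈ lideal e m) :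
    u * v - u' * v' ∈ lideal e m := by
  convert (lideal e m).add_mem (mul_mem_lideal hv u)
    (mul_mem_lideal_of_mem_invSet hmn hu hv') using 1
  noncomm_ring

lemma mul_mem_invSet {e : L} {m n : Submodule ℂ L} (hmn : m ≤ n) {u v : UEA L}
    (hu : u ∈ invSet e m n) (hv : v ∈ invSet e m n) : u * v ∈ invSet e m n := by
  refine mem_invSet.mpr fun x hx => ?_
  convert (lideal e m).add_mem (mul_mem_lideal_of_mem_invSet hmn (mem_invSet.mp hu x hx) hv)
    (mul_mem_lideal (mem_invSet.mp hv x hx) u) using 1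
  noncomm_ring

lemma WAlgebraIso.symm {e : L} {m₁ n₁ m₂ n₂ : Submodule ℂ L} (hmn₁ : m₁ ≤ n₁) (hmn : m₂ ≤ n₂)
    (h : WAlgebraIso e m₁ n₁ m₂ n₂) : WAlgebraIso e m₂ n₂ m₁ n₁ := by
  obtain ⟨φ, h1, h2⟩ := h
  have one_mem : (1 : UEA L) ∈ invSet e m₁ n₁ := mem_invSet.mpr fun x _ => by simp
  refine ⟨φ.symm, fun p hp => ?_, ?_⟩
  · have h3 := h1 ⟨_, mk_mem_Hsub one_mem⟩ rfl
    have h4 : p = φ ⟨_, mk_mem_Hsub one_mem⟩ := Subtype.ext (hp.trans h3.symm)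
    rw [h4, LinearEquiv.symm_apply_apply]
  · rintro p q r ⟨u, v, hu, hv, hp, hq, hr⟩
    obtain ⟨u', hu', hp'⟩ := exists_rep_of_mem_Hsub (φ.symm p)
    obtain ⟨v', hv', hq'⟩ := exists_rep_of_mem_Hsub (φ.symm q)
    refine ⟨u', v', hu', hv', hp', hq', ?_⟩
    have hmul := mul_mem_invSet hmn₁ hu' hv'
    obtain ⟨u₂, v₂, hu₂, hv₂, hp₂, hq₂, hr₂⟩ := h2 (φ.symm p) (φ.symm q)
      ⟨_, mk_mem_Hsub hmul⟩ ⟨u', v', hu', hv', hp', hq', rfl⟩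
    rw [LinearEquiv.apply_symm_apply, hp, Submodule.Quotient.eq] at hp₂
    rw [LinearEquiv.apply_symm_apply, hq, Submodule.Quotient.eq] at hq₂
    have h5 : r = φ ⟨_, mk_mem_Hsub hmul⟩ := by
      refine Subtype.ext (hr.trans (Eq.trans ?_ hr₂.symm))
      rw [Submodule.Quotient.eq]
      exact mul_sub_mul_mem_lideal hmn hv₂ hp₂ hq₂
    rw [h5, LinearEquiv.symm_apply_apply]

lemma NaturalIso.wAlgebraIso {e : L} {m n m' n' : Submodule ℂ L}
    (h : NaturalIso e m n m' n') : WAlgebraIso e m n m' n' := by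
  have hle : lidealC e m ≤ (lidealC e m').comap LinearMap.id := fun u hu => lideal_mono h.le_left hu
  let f : UEA L ⧸ lidealC e m →ₗ[ℂ] UEA L ⧸ lidealC e m' :=
    (lidealC e m).mapQ (lidealC e m') LinearMap.id hle
  have hf : ∀ p ∈ Hsub e m n, f p ∈ Hsub e m' n' := by
    rintro _ ⟨u, hu, rfl⟩
    exact ⟨u, invSet_mono h.le_left h.le_right hu, rfl⟩
  let g := f.restrict hf
  have hg : Function.Bijective g := by
    constructor
    · rw [← LinearMap.ker_eq_bot, LinearMap.ker_eq_bot']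
      rintro ⟨_, u, hu, rfl⟩ h0
      have h1 : (Submodule.Quotient.mk u : UEA L ⧸ lidealC e m') = 0 := congrArg Subtype.val h0
      rw [Submodule.Quotient.mk_eq_zero] at h1
      exact Subtype.ext ((Submodule.Quotient.mk_eq_zero _).mpr (h.inj u hu h1))
    · rintro ⟨_, u, hu, rfl⟩
      obtain ⟨v, hv, huv⟩ := h.surj u hu
      refine ⟨⟨_, mk_mem_Hsub hv⟩, Subtype.ext ?_⟩
      exact ((Submodule.Quotient.eq _).mpr huv).symm
  refine ⟨LinearEquiv.ofBijective g hg, fun p hp => ?_, ?_⟩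
  · change f p = _
    rw [hp]; rfl
  · rintro p q r ⟨u, v, hu, hv, hp, hq, hr⟩
    refine ⟨u, v, invSet_mono h.le_left h.le_right hu, invSet_mono h.le_left h.le_right hv,
      ?_, ?_, ?_⟩
    · change f p = _
      rw [hp]; rfl
    · change f q = _
      rw [hq]; rfl
    · change f r = _
      rw [hr]; rfl

end Enveloping

/-! ### Gradings defined by a rational semisimple element -/

/-- The eigenspace of `ad d` with eigenvalue `j`. -/
def wt (d : L) (j : ℚ) : Submodule ℂ L := Module.End.eigenspace (ad ℂ L d) (j : ℂ)

/-- The sum of the eigenspaces of `ad d` whose eigenvalue belongs to `S`. -/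
def gr (d : L) (S : Set ℚ) : Submodule ℂ L := ⨆ j ∈ S, wt d j

/-- `ad d` is diagonalizable with rational eigenvalues. -/
def IsRational (d : L) : Prop := ⨆ j, wt d j = ⊤

/-- `m` is stable under `ad d`, i.e. graded for the grading defined by `d`. -/
def IsStable (d : L) (m : Submodule ℂ L) : Prop := ∀ x ∈ m, ⁅d, x⁆ ∈ m

lemma mem_wt {d x : L} {j : ℚ} : x ∈ wt d j ↔ ⁅d, x⁆ = (j : ℂ) • x := by
  rw [wt, Module.End.mem_eigenspace_iff, ad_apply]

lemma lie_mem_wt {d x y : L} {i j : ℚ} (hx : x ∈ wt d i) (hy : y ∈ wt d j) :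
    ⁅x, y⁆ ∈ wt d (i + j) := by
  rw [mem_wt] at *
  rw [leibniz_lie, hx, hy, smul_lie, lie_smul, ← add_smul]
  push_cast; rfl

lemma iSupIndep_wt (d : L) : iSupIndep (wt d) :=
  (Module.End.eigenspaces_iSupIndep (ad ℂ L d)).comp (f := fun j : ℚ => (j : ℂ))
    Rat.cast_injective

lemma wt_le_gr {d : L} {S : Set ℚ} {j : ℚ} (hj : j ∈ S) : wt d j ≤ gr d S :=
  le_biSup (wt d) hj

lemma mem_gr {d x : L} {S : Set ℚ} {j : ℚ} (hx : x ∈ wt d j) (hj : j ∈ S) : x ∈ gr d S :=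
  wt_le_gr hj hx

lemma gr_le {d : L} {S : Set ℚ} {X : Submodule ℂ L} :
    gr d S ≤ X ↔ ∀ j ∈ S, ∀ x ∈ wt d j, x ∈ X := by
  simp only [gr, iSup_le_iff]; rfl

lemma gr_mono {d : L} {S T : Set ℚ} (h : S ⊆ T) : gr d S ≤ gr d T :=
  gr_le.mpr fun _ hj _ hx => mem_gr hx (h hj)

lemma gr_union (d : L) (S T : Set ℚ) : gr d (S ∪ T) = gr d S ⊔ gr d T :=
  iSup_union

lemma disjoint_gr (d : L) {S T : Set ℚ} (h : Disjoint S T) : Disjoint (gr d S) (gr d T) :=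
  (iSupIndep_wt d).disjoint_biSup_biSup h

lemma eq_zero_of_mem_gr {d x : L} {S T : Set ℚ} (h : Disjoint S T) (hS : x ∈ gr d S)
    (hT : x ∈ gr d T) : x = 0 := by
  simpa using (disjoint_gr d h).le_bot ⟨hS, hT⟩

lemma isStable_gr (d : L) (S : Set ℚ) : IsStable d (gr d S) := by
  have : gr d S ≤ (gr d S).comap (ad ℂ L d) := gr_le.mpr fun j hj x hx => by
    rw [Submodule.mem_comap, ad_apply, mem_wt.mp hx]
    exact Submodule.smul_mem _ _ (mem_gr hx hj)
  exact this

lemma IsStable.sup {d : L} {m n : Submodule ℂ L} (hm : IsStable d m) (hn : IsStable d n) :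
    IsStable d (m ⊔ n) := by
  intro x hx
  obtain ⟨y, hy, z, hz, rfl⟩ := Submodule.mem_sup.mp hx
  rw [lie_add]
  exact Submodule.add_mem_sup (hm y hy) (hn z hz)

lemma IsStable.inf {d : L} {m n : Submodule ℂ L} (hm : IsStable d m) (hn : IsStable d n) :
    IsStable d (m ⊓ n) := fun x hx => ⟨hm x hx.1, hn x hx.2⟩

lemma isStable_of_le_wt {d : L} {m : Submodule ℂ L} {j : ℚ} (h : m ≤ wt d j) : IsStable d m :=
  fun x hx => by rw [mem_wt.mp (h hx)]; exact m.smul_mem _ hx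

/-- Bilinear vanishing/containment criterion on sums of eigenspaces. -/
lemma lie_mem_of_gr {d : L} {S T : Set ℚ} {X : Submodule ℂ L}
    (h : ∀ i ∈ S, ∀ j ∈ T, ∀ x ∈ wt d i, ∀ y ∈ wt d j, ⁅x, y⁆ ∈ X)
    {x y : L} (hx : x ∈ gr d S) (hy : y ∈ gr d T) : ⁅x, y⁆ ∈ X := by
  have h1 : ∀ i ∈ S, ∀ x ∈ wt d i, gr d T ≤ X.comap (ad ℂ L x) := fun i hi x hx =>
    gr_le.mpr fun j hj y hy => h i hi j hj x hx y hy
  have h2 : gr d S ≤ X.comap (ad ℂ L y) := gr_le.mpr fun i hi x hx => by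
    rw [Submodule.mem_comap, ad_apply, ← lie_skew]
    exact X.neg_mem (h1 i hi x hx hy)
  have := X.neg_mem (h2 hx)
  rwa [ad_apply, lie_skew] at this

lemma lie_mem_gr {d : L} {S T U : Set ℚ} (h : ∀ i ∈ S, ∀ j ∈ T, i + j ∈ U)
    {x y : L} (hx : x ∈ gr d S) (hy : y ∈ gr d T) : ⁅x, y⁆ ∈ gr d U :=
  lie_mem_of_gr (fun i hi j hj _ hx _ hy => mem_gr (lie_mem_wt hx hy) (h i hi j hj)) hx hy

lemma killingForm_lie_comm (e x y : L) :
    killingForm ℂ L e ⁅x, y⁆ = killingForm ℂ L ⁅e, x⁆ y :=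
  (LieModule.traceForm_apply_lie_apply ℂ L L e x y).symm

lemma killingForm_symm (x y : L) : killingForm ℂ L x y = killingForm ℂ L y x :=
  LieModule.traceForm_comm ℂ L L x y

/-- Eigenspaces of opposite weight only are paired by `κ`. -/
lemma killingForm_eq_zero_of_wt {d x y : L} {i j : ℚ} (hx : x ∈ wt d i) (hy : y ∈ wt d j)
    (hij : i + j ≠ 0) : killingForm ℂ L x y = 0 := by
  have h1 : killingForm ℂ L d ⁅x, y⁆ = (i : ℂ) * killingForm ℂ L x y := by
    rw [killingForm_lie_comm, mem_wt.mp hx, map_smul, LinearMap.smul_apply, smul_eq_mul]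
  have h2 : killingForm ℂ L d ⁅x, y⁆ = -((j : ℂ) * killingForm ℂ L x y) := by
    rw [← lie_skew, map_neg, killingForm_lie_comm, mem_wt.mp hy, map_smul, LinearMap.smul_apply,
      smul_eq_mul, killingForm_symm y x]
  have h3 : ((i + j : ℚ) : ℂ) * killingForm ℂ L x y = 0 := by
    push_cast; linear_combination h2 - h1
  exact (mul_eq_zero.mp h3).resolve_left (by exact_mod_cast hij)

/-- `ω(x, y) = κ(e, [x, y])` pairs only eigenspaces whose weights add up to minus that of `e`. -/
lemma chi_lie_eq_zero_of_wt {d e x y : L} {a i j : ℚ} (he : e ∈ wt d a) (hx : x ∈ wt d i)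
    (hy : y ∈ wt d j) (hij : i + j ≠ -a) : killingForm ℂ L e ⁅x, y⁆ = 0 :=
  killingForm_eq_zero_of_wt he (lie_mem_wt hx hy) fun h => hij (by linarith)

lemma chi_lie_eq_zero_of_gr {d e x y : L} {a : ℚ} {S T : Set ℚ} (he : e ∈ wt d a)
    (hx : x ∈ gr d S) (hy : y ∈ gr d T) (h : ∀ i ∈ S, ∀ j ∈ T, i + j ≠ -a) :
    killingForm ℂ L e ⁅x, y⁆ = 0 :=
  lie_mem_of_gr (X := LinearMap.ker (killingForm ℂ L e)) (fun i hi j hj _ hx _ hy =>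
    chi_lie_eq_zero_of_wt he hx hy (h i hi j hj)) hx hy

/-- The annihilator of `m` for the alternating form `(x, y) ↦ κ(e, [x, y])`. -/
def annih (e : L) (m : Submodule ℂ L) : Submodule ℂ L where
  carrier := {x | ∀ y ∈ m, killingForm ℂ L e ⁅x, y⁆ = 0}
  add_mem' := fun hx hy z hz => by rw [add_lie, map_add, hx z hz, hy z hz, add_zero]
  zero_mem' := fun z _ => by simp
  smul_mem' := fun c x hx z hz => by rw [smul_lie, map_smul, hx z hz, smul_zero]

lemma mem_annih {e x : L} {m : Submodule ℂ L} :
    x ∈ annih e m ↔ ∀ y ∈ m, killingForm ℂ L e ⁅x, y⁆ = 0 := Iff.rfl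

lemma chi_lie_swap {e x y : L} : killingForm ℂ L e ⁅x, y⁆ = 0 ↔ killingForm ℂ L e ⁅y, x⁆ = 0 := by
  rw [← lie_skew, map_neg, neg_eq_zero]

lemma le_annih_comm {e : L} {m n : Submodule ℂ L} : m ≤ annih e n ↔ n ≤ annih e m :=
  ⟨fun h x hx _ hy => chi_lie_swap.mp (h hy x hx), fun h x hx _ hy => chi_lie_swap.mp (h hy x hx)⟩

lemma annih_anti (e : L) {m m' : Submodule ℂ L} (h : m ≤ m') : annih e m' ≤ annih e m :=
  fun _ hx y hy => hx y (h hy)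

lemma annih_sup {e : L} {m n : Submodule ℂ L} : annih e (m ⊔ n) = annih e m ⊓ annih e n := by
  refine le_antisymm (le_inf (annih_anti e le_sup_left) (annih_anti e le_sup_right)) ?_
  rintro x ⟨h1, h2⟩ _ hyz
  obtain ⟨y, hy, z, hz, rfl⟩ := Submodule.mem_sup.mp hyz
  rw [lie_add, map_add, h1 y hy, h2 z hz, add_zero]

lemma IsStable.annih {d e : L} {a : ℚ} (he : e ∈ wt d a) {m : Submodule ℂ L}
    (hm : IsStable d m) : IsStable d (annih e m) := by
  intro x hx y hy
  rw [lie_lie, map_sub, hx _ (hm y hy), sub_zero, killingForm_lie_comm, ← lie_skew,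
    mem_wt.mp he, map_neg, map_smul, LinearMap.neg_apply, LinearMap.smul_apply, hx y hy]
  simp

lemma isStable_ker {d e : L} {a : ℚ} (he : e ∈ wt d a) :
    IsStable d (LinearMap.ker (ad ℂ L e)) := by
  intro x hx
  rw [LinearMap.mem_ker, ad_apply] at *
  have h := leibniz_lie d e x
  rwa [hx, lie_zero, mem_wt.mp he, smul_lie, hx, smul_zero, zero_add, eq_comm] at h

lemma ker_le_annih (e : L) (m : Submodule ℂ L) : LinearMap.ker (ad ℂ L e) ≤ annih e m := by
  intro x hx y _
  rw [LinearMap.mem_ker, ad_apply] at hx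
  rw [killingForm_lie_comm, hx]; simp

lemma gr_le_annih_gr {d e : L} {a : ℚ} (he : e ∈ wt d a) {S T : Set ℚ}
    (h : ∀ i ∈ S, ∀ j ∈ T, i + j ≠ -a) : gr d S ≤ annih e (gr d T) :=
  fun _ hx _ hy => chi_lie_eq_zero_of_gr he hx hy h

section Rational

variable {d : L}

lemma IsStable.eq_iSup (hd : IsRational d) {m : Submodule ℂ L} (hm : IsStable d m) :
    m = ⨆ j, wt d j ⊓ m := by
  refine le_antisymm ?_ (iSup_le fun j => inf_le_right)
  intro x hx
  have hx' : x ∈ ⨆ j : ℚ, wt d j := by rw [hd]; trivial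
  obtain ⟨f, hf, rfl⟩ := (Submodule.mem_iSup_iff_exists_finsupp _ _).mp hx'
  classical
  have h1 : ∀ s : Finset ℚ, ∀ f : ℚ → L, (∀ i, f i ∈ wt d i) → (∑ i ∈ s, f i) ∈ m →
      ∀ i ∈ s, f i ∈ m := by
    intro s
    induction s using Finset.induction_on with
    | empty => simp
    | insert k s hk ih =>
      intro f hf hsum
      have h2 : ∑ i ∈ s, ((i : ℂ) - k) • f i ∈ m := by
        have h3 := m.sub_mem (hm _ hsum) (m.smul_mem (k : ℂ) hsum)
        convert h3 using 1
        rw [Finset.sum_insert hk, lie_add, smul_add, mem_wt.mp (hf k), add_sub_add_left_eq_sub,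
          Finset.smul_sum, lie_sum, ← Finset.sum_sub_distrib]
        exact Finset.sum_congr rfl fun i _ => by rw [mem_wt.mp (hf i), sub_smul]
      have h4 : ∀ i ∈ s, f i ∈ m := fun i hi => by
        have h5 := ih (fun i => ((i : ℂ) - k) • f i) (fun i => Submodule.smul_mem _ _ (hf i)) h2 i hi
        refine (m.smul_mem_iff ?_).mp h5
        rw [sub_ne_zero]
        intro h; exact hk (Rat.cast_injective h ▸ hi)
      rw [Finset.sum_insert hk] at hsum
      have h6 := (m.add_mem_iff_left (m.sum_mem h4)).mp hsum
      intro i hi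
      rcases Finset.mem_insert.mp hi with rfl | hi
      · exact h6
      · exact h4 i hi
  exact Submodule.sum_mem _ fun i hi => Submodule.mem_iSup_of_mem i
    ⟨hf i, h1 f.support f hf hx i hi⟩

lemma IsStable.le_of_wt (hd : IsRational d) {m X : Submodule ℂ L} (hm : IsStable d m)
    (h : ∀ j, ∀ x ∈ m, x ∈ wt d j → x ∈ X) : m ≤ X := by
  rw [hm.eq_iSup hd]
  exact iSup_le fun j x hx => h j x hx.2 hx.1

lemma gr_univ (hd : IsRational d) : gr d Set.univ = ⊤ := by
  rw [gr, ← hd]; simp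

/-- A homogeneous element that lies in `gr d S` and whose weight is not in `S` vanishes. -/
lemma eq_zero_of_wt {x : L} {S : Set ℚ} {j : ℚ} (hx : x ∈ wt d j) (hS : x ∈ gr d S)
    (hj : j ∉ S) : x = 0 :=
  eq_zero_of_mem_gr (T := {j}) (by simpa) hS (mem_gr hx rfl)

lemma finite_weights [FiniteDimensional ℂ L] (d : L) : {j : ℚ | wt d j ≠ ⊥}.Finite :=
  WellFoundedGT.finite_ne_bot_of_iSupIndep (iSupIndep_wt d)

lemma lie_eq_zero_of_wt [FiniteDimensional ℂ L] [IsKilling ℂ L] (hd : IsRational d) {e x : L} {a : ℚ} (he : e ∈ wt d a)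
    {j : ℚ} (hx : x ∈ wt d j) (h : ∀ y ∈ wt d (-a - j), killingForm ℂ L e ⁅x, y⁆ = 0) : ⁅e, x⁆ = 0 := by
  have h1 : ∀ y, killingForm ℂ L ⁅e, x⁆ y = 0 := by
    have : (⊤ : Submodule ℂ L) ≤ LinearMap.ker (killingForm ℂ L ⁅e, x⁆) := by
      rw [← hd]
      refine iSup_le fun i y hy => ?_
      rw [LinearMap.mem_ker, ← killingForm_lie_comm]
      by_cases hi : j + i = -a
      · exact h y (by rwa [← hi, add_sub_cancel_left])
      · exact chi_lie_eq_zero_of_wt he hx hy hi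
    exact fun y => this (x := y) trivial
  exact (IsKilling.killingForm_nondegenerate ℂ L).1 _ h1

end Rational

/-! ### Rational gradings and admissible pairs -/

lemma IsRational.isQGrading {d : L} (hd : IsRational d) : IsQGrading (wt d) :=
  ⟨DirectSum.isInternal_submodule_of_iSupIndep_of_iSup_eq_top (iSupIndep_wt d) hd,
    fun _ _ _ hx _ hy => lie_mem_wt hx hy⟩

/-- Every rational grading of a Killing Lie algebra is defined by an element of the algebra. -/
lemma IsQGrading.exists_eq_wt [FiniteDimensional ℂ L] [IsKilling ℂ L] {g : ℚ → Submodule ℂ L}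
    (hg : IsQGrading g) : ∃ d : L, IsRational d ∧ g = wt d := by
  classical
  obtain ⟨hint, hlie⟩ := hg
  let E := LinearEquiv.ofBijective (DirectSum.coeLinearMap g) hint
  let D : L →ₗ[ℂ] L :=
    (DirectSum.toModule ℂ ℚ L fun i => (i : ℂ) • (g i).subtype) ∘ₗ E.symm.toLinearMap
  have hD : ∀ i, ∀ x ∈ g i, D x = (i : ℂ) • x := by
    intro i x hx
    have h1 : E.symm x = DirectSum.lof ℂ ℚ (fun i => g i) i ⟨x, hx⟩ := by
      rw [LinearEquiv.symm_apply_eq]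
      exact (DirectSum.coeLinearMap_lof g i ⟨x, hx⟩).symm
    change (DirectSum.toModule ℂ ℚ L fun i => (i : ℂ) • (g i).subtype) (E.symm x) = _
    rw [h1, DirectSum.toModule_lof]
    rfl
  have htop : ⨆ i, g i = ⊤ := hint.submodule_iSup_eq_top
  have hleib : ∀ x y, D ⁅x, y⁆ = ⁅x, D y⁆ - ⁅y, D x⁆ := by
    have h1 : ∀ i, ∀ x ∈ g i, ∀ y, D ⁅x, y⁆ = ⁅x, D y⁆ - ⁅y, D x⁆ := by
      intro i x hx
      have : (⊤ : Submodule ℂ L) ≤ LinearMap.ker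
          (D ∘ₗ (ad ℂ L x : L →ₗ[ℂ] L) - (ad ℂ L x : L →ₗ[ℂ] L) ∘ₗ D
            - (ad ℂ L (D x) : L →ₗ[ℂ] L)) := by
        rw [← htop]
        refine iSup_le fun j y hy => ?_
        rw [LinearMap.mem_ker]
        simp only [LinearMap.sub_apply, LinearMap.comp_apply, ad_apply]
        rw [hD _ _ (hlie i j x hx y hy), hD i x hx, hD j y hy, lie_smul, smul_lie]
        push_cast
        module
      intro y
      have h2 := this (x := y) trivial
      rw [LinearMap.mem_ker] at h2
      simp only [LinearMap.sub_apply, LinearMap.comp_apply, ad_apply] at h2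
      rw [← lie_skew (D x) y] at h2
      rw [← sub_eq_zero]
      rw [← h2]; abel
    intro x y
    have : (⊤ : Submodule ℂ L) ≤ LinearMap.ker
        (D ∘ₗ (ad ℂ L y : L →ₗ[ℂ] L) - (ad ℂ L y : L →ₗ[ℂ] L) ∘ₗ D
            - (ad ℂ L (D y) : L →ₗ[ℂ] L)) := by
      rw [← htop]
      refine iSup_le fun j x hx => ?_
      rw [LinearMap.mem_ker]
      simp only [LinearMap.sub_apply, LinearMap.comp_apply, ad_apply]
      rw [← lie_skew, map_neg, h1 j x hx, ← lie_skew (D y)]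
      abel
    have h2 := this (x := x) trivial
    rw [LinearMap.mem_ker] at h2
    simp only [LinearMap.sub_apply, LinearMap.comp_apply, ad_apply] at h2
    rw [← lie_skew, map_neg, ← sub_eq_zero, ← neg_eq_zero, ← h2, ← lie_skew (D y)]
    abel
  obtain ⟨d, hd⟩ := LieDerivation.IsKilling.exists_eq_ad (R := ℂ) (L := L)
    { toLinearMap := D, leibniz' := hleib }
  have hdD : ∀ x, ⁅d, x⁆ = D x := fun x => by
    have h := DFunLike.congr_fun hd x
    rwa [LieDerivation.ad_apply_apply] at h
  have hle : ∀ i, g i ≤ wt d i := fun i x hx => by rw [mem_wt, hdD, hD i x hx]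
  refine ⟨d, top_unique (htop.ge.trans (iSup_mono hle)), funext fun i => ?_⟩
  refine le_antisymm (hle i) fun x hx => ?_
  have h3 : x ∈ g i ⊔ ⨆ j ≠ i, g j := by
    have : (⊤ : Submodule ℂ L) ≤ g i ⊔ ⨆ j ≠ i, g j := by
      rw [← htop]
      refine iSup_le fun j => ?_
      by_cases h : j = i
      · exact h ▸ le_sup_left
      · exact (le_biSup g h).trans le_sup_right
    exact this trivial
  obtain ⟨y, hy, z, hz, rfl⟩ := Submodule.mem_sup.mp h3
  have hz0 : z = 0 := by
    have h4 : z ∈ wt d i := by simpa using (wt d i).sub_mem hx (hle i hy)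
    have h5 : z ∈ ⨆ j ≠ i, wt d j := (iSup₂_mono fun j _ => hle j) hz
    simpa using (iSupIndep_wt d i).le_bot ⟨h4, h5⟩
  rw [hz0, add_zero]
  exact hy

/-- A reformulation of `e`-admissibility relative to the grading defined by `d`. -/
structure Adm (d e : L) (a : ℚ) (m n : Submodule ℂ L) : Prop where
  stable_left : IsStable d m
  stable_right : IsStable d n
  lie_right : ∀ x ∈ n, ∀ y ∈ n, ⁅x, y⁆ ∈ n
  lie_left : ∀ x ∈ n, ∀ y ∈ m, ⁅x, y⁆ ∈ m
  gr_le : gr d (Set.Iic (-a)) ≤ m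
  le : m ≤ n
  le_gr : n ≤ gr d (Set.Iio 0)
  eq_zero : ∀ x ∈ n, ⁅e, x⁆ = 0 → x = 0
  perp : annih e m = n ⊔ LinearMap.ker (ad ℂ L e)

section Adm

variable {d e : L} {a : ℚ} {m n : Submodule ℂ L}

lemma mem_annih_iff_orthogonal {x : L} :
    x ∈ annih e m ↔ ⁅e, x⁆ ∈ LinearMap.BilinForm.orthogonal (killingForm ℂ L) m := by
  rw [mem_annih, LinearMap.BilinForm.mem_orthogonal_iff]
  refine forall₂_congr fun y _ => ?_
  rw [killingForm_lie_comm, killingForm_symm]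

lemma annih_eq_orthogonal :
    annih e m = LinearMap.BilinForm.orthogonal (killingForm ℂ L) (m.map (ad ℂ L e)) := by
  ext x
  rw [mem_annih, LinearMap.BilinForm.mem_orthogonal_iff]
  simp only [Submodule.mem_map, forall_exists_index, and_imp, forall_apply_eq_imp_iff₂]
  refine forall₂_congr fun y _ => ?_
  rw [ad_apply, chi_lie_swap, killingForm_lie_comm]

lemma annih_eq_iff :
    (LinearMap.BilinForm.orthogonal (killingForm ℂ L) m ⊓ LinearMap.range (ad ℂ L e)
      = Submodule.map (ad ℂ L e) n) ↔ annih e m = n ⊔ LinearMap.ker (ad ℂ L e) := by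
  constructor
  · intro h
    ext x
    rw [mem_annih_iff_orthogonal, ← Submodule.comap_map_eq, ← h, Submodule.mem_comap,
      Submodule.mem_inf, ad_apply]
    exact ⟨fun hx => ⟨hx, x, rfl⟩, fun hx => hx.1⟩
  · intro h
    ext y
    constructor
    · rintro ⟨hy, x, rfl⟩
      rw [ad_apply] at hy
      have := mem_annih_iff_orthogonal.mpr hy
      rwa [h, ← Submodule.comap_map_eq] at this
    · rintro ⟨x, hx, rfl⟩
      refine ⟨mem_annih_iff_orthogonal.mp ?_, x, rfl⟩
      rw [h]; exact Submodule.mem_sup_left hx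

lemma Adm.isAdmissiblePairQ [FiniteDimensional ℂ L] [IsKilling ℂ L] {a : ℤ} (hd : IsRational d)
    (h : Adm d e a m n) :
    IsAdmissiblePairQ (wt d) e a m n := by
  have hdisj : n ⊓ LinearMap.ker (ad ℂ L e) = ⊥ := by
    refine eq_bot_iff.mpr fun x hx => ?_
    exact h.eq_zero x hx.1 hx.2
  refine ⟨fun x hx y hy => h.lie_left x (h.le hx) y hy, h.lie_right, h.stable_left.eq_iSup hd,
    h.stable_right.eq_iSup hd, h.gr_le, h.le, h.le_gr, annih_eq_iff.mpr h.perp, hdisj, h.lie_left,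
    ?_⟩
  have h1 := LinearMap.BilinForm.finrank_orthogonal (IsKilling.killingForm_nondegenerate ℂ L)
    (m.map (ad ℂ L e))
  rw [← annih_eq_orthogonal, h.perp] at h1
  have h2 := Submodule.finrank_sup_add_finrank_inf_eq n (LinearMap.ker (ad ℂ L e))
  rw [hdisj, finrank_bot, add_zero] at h2
  have h3 : Module.finrank ℂ (m.map (ad ℂ L e)) = Module.finrank ℂ m := by
    have hinj : Function.Injective ((ad ℂ L e : L →ₗ[ℂ] L).domRestrict m) := by
      rw [← LinearMap.ker_eq_bot, LinearMap.ker_eq_bot']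
      rintro ⟨x, hx⟩ hx0
      exact Subtype.ext (h.eq_zero x (h.le hx) hx0)
    rw [← LinearMap.finrank_range_of_inj hinj, LinearMap.range_domRestrict]
  have h4 := Submodule.finrank_le (m.map (ad ℂ L e))
  omega

lemma IsAdmissiblePairQ.adm {a : ℤ} (h : IsAdmissiblePairQ (wt d) e a m n) :
    Adm d e a m n := by
  obtain ⟨-, h2, h3, h4, h5, h6, h7, h8, h9, h10, -⟩ := h
  have stable : ∀ m : Submodule ℂ L, m = (⨆ j : ℚ, wt d j ⊓ m) → IsStable d m := by
    intro m hm
    have : (⨆ j : ℚ, wt d j ⊓ m) ≤ m.comap (ad ℂ L d) := iSup_le fun j x hx => by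
      rw [Submodule.mem_comap, ad_apply, mem_wt.mp hx.1]
      exact m.smul_mem _ hx.2
    intro x hx
    rw [hm] at hx
    exact this hx
  refine ⟨stable m h3, stable n h4, h2, h10, h5, h6, h7, fun x hx hx0 => ?_, annih_eq_iff.mp h8⟩
  have : x ∈ n ⊓ LinearMap.ker (ad ℂ L e) := ⟨hx, hx0⟩
  rw [h9] at this
  simpa using this

variable (h : Adm d e a m n)
include h

lemma Adm.right_le_annih : n ≤ annih e m := le_sup_left.trans h.perp.ge

lemma Adm.mem_right_of_mem_annih {m' n' : Submodule ℂ L} (h' : Adm d e a m' n') (hn : n' ≤ n)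
    {x : L} (hx : x ∈ n) (hx' : x ∈ annih e m') : x ∈ n' := by
  rw [h'.perp] at hx'
  obtain ⟨y, hy, k, hk, rfl⟩ := Submodule.mem_sup.mp hx'
  have h1 : k ∈ n := by simpa using n.sub_mem hx (hn hy)
  rw [h.eq_zero k h1 hk, add_zero]
  exact hy

lemma Adm.mem_left_of_mem_annih [FiniteDimensional ℂ L] [IsKilling ℂ L] {x : L} (hx : x ∈ n)
    (hx' : x ∈ annih e n) : x ∈ m := by
  have h1 : ⁅e, x⁆ ∈ LinearMap.BilinForm.orthogonal (killingForm ℂ L) (annih e m) := by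
    rw [← mem_annih_iff_orthogonal, h.perp, annih_sup]
    exact ⟨hx', fun y hy => chi_lie_swap.mp (ker_le_annih e ⊤ hy x trivial)⟩
  rw [annih_eq_orthogonal, LinearMap.BilinForm.orthogonal_orthogonal
    (IsKilling.killingForm_nondegenerate ℂ L) (LieModule.traceForm_isSymm ℂ L L).isRefl] at h1
  obtain ⟨y, hy, hxy⟩ := h1
  rw [ad_apply] at hxy
  have h2 := h.eq_zero (x - y) (n.sub_mem hx (h.le hy)) (by rw [lie_sub, hxy, sub_self])
  rwa [sub_eq_zero.mp h2]

/-- Enlarging `𝔪` to an isotropic normalized subspace of `𝔫` and shrinking `𝔫` accordingly. -/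
lemma Adm.shrink [FiniteDimensional ℂ L] [IsKilling ℂ L] (he : e ∈ wt d a) {m' : Submodule ℂ L}
    (hm' : IsStable d m') (hm : m ≤ m') (hn : m' ≤ n) (hiso : m' ≤ annih e m')
    (hlie : ∀ x ∈ n, x ∈ annih e m' → ∀ y ∈ m', ⁅x, y⁆ ∈ m') :
    Adm d e a m' (n ⊓ annih e m') where
  stable_left := hm'
  stable_right := h.stable_right.inf (hm'.annih he)
  lie_right := by
    rintro x ⟨hx, hx'⟩ y ⟨hy, hy'⟩
    refine ⟨h.lie_right x hx y hy, fun z hz => ?_⟩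
    rw [killingForm_bracket_jacobi, hx' _ (hlie y hy hy' z hz), hy' _ (hlie x hx hx' z hz),
      sub_zero]
  lie_left := fun x hx y hy => hlie x hx.1 hx.2 y hy
  gr_le := h.gr_le.trans hm
  le := le_inf hn hiso
  le_gr := inf_le_left.trans h.le_gr
  eq_zero := fun x hx => h.eq_zero x hx.1
  perp := by
    refine le_antisymm ?_ (sup_le inf_le_right (ker_le_annih e m'))
    intro x hx
    have h1 := annih_anti e hm hx
    rw [h.perp] at h1
    obtain ⟨y, hy, k, hk, rfl⟩ := Submodule.mem_sup.mp h1
    refine Submodule.add_mem_sup ⟨hy, ?_⟩ hk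
    simpa using (annih e m').sub_mem hx (ker_le_annih e m' hk)

end Adm

/-! ### Isomorphisms of W-algebras for nested admissible pairs -/

lemma isNilpotent_ad_of_mem_gr [FiniteDimensional ℂ L] {d x : L} (hd : IsRational d)
    (hx : x ∈ gr d (Set.Iio 0)) : IsNilpotent (ad ℂ L x) := by
  set W := (finite_weights d).toFinset
  have key : ∀ k : ℕ, ∀ j, (W.filter (· ≤ j)).card ≤ k → ∀ y ∈ wt d j,
      ((ad ℂ L x) ^ k) y = 0 := by
    intro k
    induction k with
    | zero =>
      intro j hj y hy
      by_contra hne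
      have : j ∈ W.filter (· ≤ j) := by
        simp only [W, Finset.mem_filter, Set.Finite.mem_toFinset, Set.mem_ofPred_eq, le_refl,
          and_true]
        exact fun h => hne (by rw [h] at hy; simpa using hy)
      rw [Finset.card_eq_zero.mp (Nat.le_zero.mp hj)] at this
      simp at this
    | succ k ih =>
      intro j hj y hy
      by_cases hy0 : y = 0
      · rw [hy0, map_zero]
      have hxy : ⁅x, y⁆ ∈ gr d (Set.Iio j) :=
        lie_mem_gr (fun i hi k hk => by
          simp only [Set.mem_Iio, Set.mem_singleton_iff] at *; linarith) hx
          (mem_gr hy (Set.mem_singleton j))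
      have hker : gr d (Set.Iio j) ≤ LinearMap.ker ((ad ℂ L x) ^ k) := by
        refine gr_le.mpr fun i hi z hz => ih i ?_ z hz
        refine Nat.le_of_lt_succ (lt_of_lt_of_le (Finset.card_lt_card ?_) hj)
        refine Finset.ssubset_iff_of_subset ?_ |>.mpr ⟨j, ?_, ?_⟩
        · exact Finset.monotone_filter_right _ fun l _ hl => hl.trans (le_of_lt hi)
        · simp only [W, Finset.mem_filter, Set.Finite.mem_toFinset, Set.mem_ofPred_eq, le_refl,
            and_true]
          exact fun h => hy0 (by rw [h] at hy; simpa using hy)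
        · simp only [Finset.mem_filter, not_and, not_le]
          exact fun _ => hi
      rw [pow_succ, Module.End.mul_apply, ad_apply]
      exact hker hxy
  refine ⟨W.card, LinearMap.ker_eq_top.mp (top_unique ?_)⟩
  rw [← hd]
  exact iSup_le fun j y hy => key _ j (Finset.card_filter_le _ _) y hy

lemma NaturalIso.of_isotropic [FiniteDimensional ℂ L] {d e : L} (hd : IsRational d)
    {m n m' : Submodule ℂ L}
    (hn : n ≤ gr d (Set.Iio 0)) (hm'd : IsStable d m')
    (hnn : ∀ x ∈ n, ∀ y ∈ n, ⁅x, y⁆ ∈ n) (hnm : ∀ x ∈ n, ∀ y ∈ m, ⁅x, y⁆ ∈ m)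
    (hχ : n ≤ annih e m) (hnd : ∀ x ∈ n, x ∈ annih e n → x ∈ m)
    (hmm' : m ≤ m') (hm'n : m' ≤ n) (hiso : m' ≤ annih e m')
    (hnm' : ∀ x ∈ n, ∀ y ∈ m', ⁅x, y⁆ ∈ m') :
    NaturalIso e m n m' (n ⊓ annih e m') := by
  induction hk : Module.finrank ℂ m' - Module.finrank ℂ m using Nat.strong_induction_on
    generalizing m n with
  | _ k ih =>
  by_cases hle : m' ≤ m
  · obtain rfl : m = m' := le_antisymm hmm' hle
    rw [inf_eq_left.mpr hχ]
    exact NaturalIso.refl e m n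
  obtain ⟨j, ⟨y, hym', hyj, hym⟩, hmin⟩ : ∃ j, (∃ y ∈ m', y ∈ wt d j ∧ y ∉ m) ∧
      ∀ i < j, ∀ z ∈ m', z ∈ wt d i → z ∈ m := by
    have hfin : {j | ∃ y ∈ m', y ∈ wt d j ∧ y ∉ m}.Finite :=
      (finite_weights d).subset fun j ⟨y, _, hyj, hym⟩ hbot => hym (by
        rw [hbot, Submodule.mem_bot] at hyj; rw [hyj]; exact m.zero_mem)
    have hne : {j | ∃ y ∈ m', y ∈ wt d j ∧ y ∉ m}.Nonempty := by
      by_contra hcon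
      refine hle (hm'd.le_of_wt hd fun j y hy hyj => ?_)
      by_contra hym
      exact hcon ⟨j, y, hy, hyj, hym⟩
    obtain ⟨j, hj, hmin⟩ := Set.exists_min_image _ id hfin hne
    refine ⟨j, hj, fun i hi z hz hzi => ?_⟩
    by_contra hzm
    exact absurd (hmin i ⟨z, hz, hzi, hzm⟩) (not_le.mpr hi)
  have hny : ∀ z ∈ n, ⁅z, y⁆ ∈ m := by
    intro z hz
    have h1 : ⁅z, y⁆ ∈ gr d (Set.Iio j) :=
      lie_mem_gr (fun i hi k hk => by
        simp only [Set.mem_Iio, Set.mem_singleton_iff] at *; linarith) (hn hz)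
        (mem_gr hyj (Set.mem_singleton j))
    have h2 : m' ⊓ gr d (Set.Iio j) ≤ m := by
      refine (hm'd.inf (isStable_gr d _)).le_of_wt hd fun i z hz hzi => ?_
      by_cases hij : i < j
      · exact hmin i hij z hz.1 hzi
      · rw [eq_zero_of_wt hzi hz.2 hij]; exact m.zero_mem
    exact h2 ⟨hnm' z hz y hym', h1⟩
  have hyn := hm'n hym'
  obtain ⟨x, hxn, hxy⟩ : ∃ x ∈ n, killingForm ℂ L e ⁅x, y⁆ = 1 := by
    by_contra! hcon
    refine hym (hnd y hyn fun z hz => ?_)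
    by_contra hne
    rw [chi_lie_swap] at hne
    refine hcon ((killingForm ℂ L e ⁅z, y⁆)⁻¹ • z) (n.smul_mem _ hz) ?_
    rw [smul_lie, map_smul, smul_eq_mul, inv_mul_cancel₀ hne]
  set m₁ := m ⊔ Submodule.span ℂ {y} with hm₁
  set n₁ := n ⊓ annih e (Submodule.span ℂ {y}) with hn₁
  have hmem : ∀ z, z ∈ n₁ ↔ z ∈ n ∧ killingForm ℂ L e ⁅z, y⁆ = 0 := by
    intro z
    rw [hn₁, Submodule.mem_inf, mem_annih]
    refine and_congr_right fun _ => ⟨fun h => h y (Submodule.mem_span_singleton_self y), ?_⟩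
    intro h w hw
    obtain ⟨c, rfl⟩ := Submodule.mem_span_singleton.mp hw
    rw [lie_smul, map_smul, h, smul_zero]
  have hle₁ : m₁ ≤ m' := sup_le hmm' (by simpa using hym')
  have step := NaturalIso.of_span_singleton hnn hnm (fun z hz w hw => hχ hz w hw) hyn hny hxn hxy
    (isNilpotent_ad_of_mem_gr hd (hn hxn)) hmem
  have rest : NaturalIso e m₁ n₁ m' (n₁ ⊓ annih e m') := by
    refine ih _ ?_ (inf_le_left.trans hn) ?_ ?_ ?_ ?_ hle₁ ?_ ?_ rfl
    · have h1 : m < m₁ := by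
        refine lt_of_le_of_ne le_sup_left fun h => hym ?_
        rw [h]; exact Submodule.mem_sup_right (Submodule.mem_span_singleton_self y)
      have h2 := Submodule.finrank_lt_finrank_of_lt h1
      have h3 := Submodule.finrank_mono hle₁
      omega
    · intro z hz w hw
      rw [hmem] at *
      refine ⟨hnn z hz.1 w hw.1, ?_⟩
      rw [killingForm_bracket_jacobi, hχ hz.1 _ (hny w hw.1), hχ hw.1 _ (hny z hz.1), sub_zero]
    · intro z hz w hw
      obtain ⟨u, hu, v, hv, rfl⟩ := Submodule.mem_sup.mp hw
      obtain ⟨c, rfl⟩ := Submodule.mem_span_singleton.mp hv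
      rw [lie_add, lie_smul]
      exact Submodule.mem_sup_left (m.add_mem (hnm z hz.1 u hu) (m.smul_mem c (hny z hz.1)))
    · rw [hm₁, annih_sup]
      exact le_inf (inf_le_left.trans hχ) inf_le_right
    · intro z hz hz'
      have hz1 := (hmem z).mp hz
      have h1 : z - killingForm ℂ L e ⁅z, x⁆ • (-y) ∈ m := by
        refine hnd _ (n.sub_mem hz1.1 (n.smul_mem _ (n.neg_mem hyn))) fun w hw => ?_
        have h2 : w - killingForm ℂ L e ⁅w, y⁆ • x ∈ n₁ := by
          refine (hmem _).mpr ⟨n.sub_mem hw (n.smul_mem _ hxn), ?_⟩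
          rw [sub_lie, smul_lie, map_sub, map_smul, hxy]; simp
        have h3 := hz' _ h2
        have hyx : killingForm ℂ L e ⁅y, x⁆ = -1 := by rw [← lie_skew, map_neg, hxy]
        have hyw : killingForm ℂ L e ⁅y, w⁆ = - killingForm ℂ L e ⁅w, y⁆ := by
          rw [← lie_skew, map_neg]
        rw [lie_sub, lie_smul, map_sub, map_smul, smul_eq_mul] at h3
        rw [sub_lie, smul_lie, neg_lie, map_sub, map_smul, map_neg, hyw, smul_eq_mul]
        linear_combination h3
      have h4 := m₁.add_mem (Submodule.mem_sup_left h1) (m₁.smul_mem (killingForm ℂ L e ⁅z, x⁆)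
        (m₁.neg_mem (Submodule.mem_sup_right (Submodule.mem_span_singleton_self y))))
      rwa [sub_add_cancel] at h4
    · exact fun z hz => (hmem z).mpr ⟨hm'n hz, hiso hz y hym'⟩
    · exact fun z hz w hw => hnm' z hz.1 w hw
  have heq : n₁ ⊓ annih e m' = n ⊓ annih e m' := by
    refine le_antisymm (inf_le_inf_right _ inf_le_left) fun z hz => ⟨(hmem z).mpr ⟨hz.1, ?_⟩, hz.2⟩
    exact hz.2 y hym'
  rw [heq] at rest
  exact step.trans rest

/-- Nested admissible pairs with `[𝔫, 𝔪'] ⊆ 𝔪'` have isomorphic W-algebras. -/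
lemma Adm.naturalIso [FiniteDimensional ℂ L] [IsKilling ℂ L] {d e : L} {a : ℚ}
    (hd : IsRational d) {m n m' n' : Submodule ℂ L} (h : Adm d e a m n) (h' : Adm d e a m' n')
    (hm : m ≤ m') (hn : n' ≤ n) (hlie : ∀ x ∈ n, ∀ y ∈ m', ⁅x, y⁆ ∈ m') :
    NaturalIso e m n m' n' := by
  have heq : n' = n ⊓ annih e m' := le_antisymm (le_inf hn h'.right_le_annih)
    fun x hx => h.mem_right_of_mem_annih h' hn hx.1 hx.2
  rw [heq]
  exact NaturalIso.of_isotropic hd h.le_gr h'.stable_left h.lie_right h.lie_left h.right_le_annih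
    (fun x hx hx' => h.mem_left_of_mem_annih hx hx') hm (h'.le.trans hn)
    (h'.le.trans h'.right_le_annih) hlie

/-! ### Chains of admissible pairs for a fixed grading -/

/-- Two pairs that are comparable and for which the natural map of W-algebras is bijective. -/
def Link (e : L) (p q : Submodule ℂ L × Submodule ℂ L) : Prop :=
  ComparablePairs e p q ∧ NaturalIso e p.1 p.2 q.1 q.2 ∧ p.1 ≤ p.2 ∧ q.1 ≤ q.2

/-- The equivalence relation generated by `Link`. -/
abbrev Linked (e : L) : Submodule ℂ L × Submodule ℂ L → Submodule ℂ L × Submodule ℂ L → Prop :=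
  Relation.EqvGen (Link e)

lemma ComparablePairs.symm {e : L} {p q : Submodule ℂ L × Submodule ℂ L}
    (h : ComparablePairs e p q) : ComparablePairs e q p := by
  obtain ⟨g, a, hg, ha, he, hp, hq, hpq⟩ := h
  exact ⟨g, a, hg, ha, he, hq, hp, hpq.symm⟩

lemma Linked.equivalentPairs_and_wAlgebraIso {e : L} {p q : Submodule ℂ L × Submodule ℂ L}
    (h : Linked e p q) : (EquivalentPairs e p q ∧ EquivalentPairs e q p) ∧
      WAlgebraIso e p.1 p.2 q.1 q.2 ∧ WAlgebraIso e q.1 q.2 p.1 p.2 := by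
  induction h with
  | rel p q h =>
    exact ⟨⟨.single h.1, .single h.1.symm⟩, h.2.1.wAlgebraIso,
      h.2.1.wAlgebraIso.symm h.2.2.1 h.2.2.2⟩
  | refl p => exact ⟨⟨.refl, .refl⟩, .refl _ _ _, .refl _ _ _⟩
  | symm p q _ ih => exact ⟨ih.1.symm, ih.2.symm⟩
  | trans p q r _ _ ih₁ ih₂ =>
    exact ⟨⟨ih₁.1.1.trans ih₂.1.1, ih₂.1.2.trans ih₁.1.2⟩, ih₁.2.1.trans ih₂.2.1,
      ih₂.2.2.trans ih₁.2.2⟩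

/-- The grading defined by `d` is rational, `e` has weight `a > 1`, and the centralizer of `e`
has no weights below `-a/2`. -/
structure IsOptimalFor (d e : L) (a : ℤ) : Prop where
  rational : IsRational d
  mem : e ∈ wt d a
  one_lt : 1 < a
  eq_zero : ∀ x ∈ gr d (Set.Iio (-(a / 2 : ℚ))), ⁅e, x⁆ = 0 → x = 0

lemma IsOptimalFor.pos {d e : L} {a : ℤ} (H : IsOptimalFor d e a) : (0 : ℚ) < a := by
  have := H.one_lt
  exact_mod_cast (by omega : 0 < a)

lemma eq_zero_of_forall_wt {d e : L} {a : ℚ} (hd : IsRational d) (he : e ∈ wt d a)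
    {n : Submodule ℂ L} (hn : IsStable d n)
    (h : ∀ j, ∀ x ∈ n, x ∈ wt d j → ⁅e, x⁆ = 0 → x = 0) : ∀ x ∈ n, ⁅e, x⁆ = 0 → x = 0 := by
  intro x hx hex
  have := (hn.inf (isStable_ker he)).le_of_wt (X := ⊥) hd
    fun j x hx hxj => h j x hx.1 hxj hx.2
  exact this ⟨hx, hex⟩

lemma lie_mem_Iio {d : L} {c : ℚ} {x y : L} (hx : x ∈ gr d (Set.Iio 0)) (hy : y ∈ gr d (Set.Iio c)) :
    ⁅x, y⁆ ∈ gr d (Set.Iio c) :=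
  lie_mem_gr (fun i hi j hj => by simp only [Set.mem_Iio] at *; linarith) hx hy

lemma lie_mem_Iic {d : L} {c : ℚ} {x y : L} (hx : x ∈ gr d (Set.Iio 0)) (hy : y ∈ gr d (Set.Iic c)) :
    ⁅x, y⁆ ∈ gr d (Set.Iic c) :=
  lie_mem_gr (fun i hi j hj => by simp only [Set.mem_Iio, Set.mem_Iic] at *; linarith) hx hy

/-- There is a gap above `-a` in the set of weights. -/
lemma exists_gap [FiniteDimensional ℂ L] (d : L) (c : ℚ) :
    ∃ ε > 0, ∀ j < c + ε, wt d j ≠ ⊥ → j ≤ c := by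
  by_cases hne : ((finite_weights d).toFinset.filter (c < ·)).Nonempty
  · obtain ⟨j₀, hj₀, hmin⟩ := Finset.exists_min_image _ id hne
    refine ⟨j₀ - c, sub_pos.mpr (Finset.mem_filter.mp hj₀).2, fun j hj hjb => ?_⟩
    by_contra! hcj
    have := hmin j (Finset.mem_filter.mpr ⟨by simpa using hjb, hcj⟩)
    simp only [id] at this
    linarith
  · refine ⟨1, one_pos, fun j _ hjb => ?_⟩
    by_contra! hcj
    exact hne ⟨j, Finset.mem_filter.mpr ⟨by simpa using hjb, hcj⟩⟩

/-- Complements of the centralizer of `e` in weight `-a/2`. -/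
structure IsHalfComplement (d e : L) (a : ℤ) (s : Submodule ℂ L) : Prop where
  le : s ≤ wt d (-(a / 2 : ℚ))
  eq_zero : ∀ x ∈ s, ⁅e, x⁆ = 0 → x = 0
  sup : wt d (-(a / 2 : ℚ)) ≤ s ⊔ LinearMap.ker (ad ℂ L e)

lemma lie_mem_of_Iio_le {d e : L} {a : ℤ} (H : IsOptimalFor d e a) {m n : Submodule ℂ L}
    (h : gr d (Set.Iio (-(a / 2 : ℚ))) ≤ m) (hm : m ≤ gr d (Set.Iic (-(a / 2 : ℚ))))
    (hn : n ≤ gr d (Set.Iic (-(a / 2 : ℚ)))) : ∀ x ∈ n, ∀ y ∈ m, ⁅x, y⁆ ∈ m := by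
  have ha := H.pos
  refine fun x hx y hy => h (lie_mem_gr (fun i hi j hj => ?_) (hn hx) (hm hy))
  simp only [Set.mem_Iio, Set.mem_Iic] at *; linarith

lemma IsHalfComplement.sup_le_gr {d e : L} {a : ℤ} {s : Submodule ℂ L} (hs : IsHalfComplement d e a s) :
    gr d (Set.Iio (-(a / 2 : ℚ))) ⊔ s ≤ gr d (Set.Iic (-(a / 2 : ℚ))) :=
  sup_le (gr_mono Set.Iio_subset_Iic_self) (hs.le.trans (wt_le_gr (Set.mem_Iic.mpr le_rfl)))

lemma Adm.truncate {d e : L} {a : ℤ} (H : IsOptimalFor d e a) {m n : Submodule ℂ L} (h : Adm d e a m n) {k : ℚ}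
    (hk : -(a / 2 : ℚ) ≤ k) :
    Adm d e a (m ⊓ gr d (Set.Iic k)) (n ⊔ gr d (Set.Iio (-a - k))) := by
  have ha := H.pos
  have hIio : gr d (Set.Iio (-a - k)) ≤ gr d (Set.Iio 0) := gr_mono fun j hj => by
    simp only [Set.mem_Iio] at *; linarith
  have hnst : IsStable d (n ⊔ gr d (Set.Iio (-a - k))) := h.stable_right.sup (isStable_gr d _)
  have hnle : n ⊔ gr d (Set.Iio (-a - k)) ≤ gr d (Set.Iio 0) := sup_le h.le_gr hIio
  refine ⟨h.stable_left.inf (isStable_gr d _), hnst, ?_, ?_, ?_, ?_, hnle, ?_, ?_⟩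
  · intro x hx y hy
    obtain ⟨x, hxn, u, hu, rfl⟩ := Submodule.mem_sup.mp hx
    obtain ⟨y, hyn, v, hv, rfl⟩ := Submodule.mem_sup.mp hy
    have h1 := lie_mem_Iio (hIio hu) hv
    have h2 := lie_mem_Iio (h.le_gr hxn) hv
    have h3 := lie_mem_Iio (h.le_gr hyn) hu
    rw [add_lie, lie_add, lie_add, add_assoc]
    refine Submodule.add_mem_sup (h.lie_right x hxn y hyn) (Submodule.add_mem _ h2
      (Submodule.add_mem _ ?_ h1))
    rw [← lie_skew]; exact Submodule.neg_mem _ h3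
  · rintro x hx y ⟨hym, hy⟩
    obtain ⟨x, hxn, u, hu, rfl⟩ := Submodule.mem_sup.mp hx
    refine ⟨?_, lie_mem_Iic (hnle hx) hy⟩
    rw [add_lie]
    refine m.add_mem (h.lie_left x hxn y hym) (h.gr_le ?_)
    exact lie_mem_gr (fun i hi j hj => by simp only [Set.mem_Iio, Set.mem_Iic] at *; linarith) hu hy
  · exact le_inf h.gr_le (gr_mono fun j hj => by simp only [Set.mem_Iic] at *; linarith)
  · exact inf_le_left.trans (h.le.trans le_sup_left)
  · refine eq_zero_of_forall_wt H.rational H.mem hnst fun j x hx hxj hex => ?_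
    by_cases hj : j < -(a / 2 : ℚ)
    · exact H.eq_zero x (mem_gr hxj hj) hex
    · refine h.eq_zero x ?_ hex
      have hstab := h.stable_right
      have h1 : n ≤ (n ⊓ gr d (Set.Iio (-a - k))) ⊔ (n ⊓ gr d (Set.Ici (-a - k))) :=
        hstab.le_of_wt H.rational fun i y hy hyi => by
          by_cases hi : i < -a - k
          · exact Submodule.mem_sup_left ⟨hy, mem_gr hyi hi⟩
          · exact Submodule.mem_sup_right ⟨hy, mem_gr hyi (not_lt.mp hi)⟩
      obtain ⟨y, hyn, u, hu, rfl⟩ := Submodule.mem_sup.mp hx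
      obtain ⟨y₁, hy₁, y₂, hy₂, rfl⟩ := Submodule.mem_sup.mp (h1 hyn)
      have h2 : y₁ + u ∈ gr d (Set.Iio (-a - k)) := Submodule.add_mem _ hy₁.2 hu
      have h3 : y₁ + u ∈ gr d (Set.Ici (-a - k)) := by
        have h4 : y₁ + y₂ + u ∈ gr d (Set.Ici (-a - k)) :=
          mem_gr hxj (by simp only [Set.mem_Ici]; linarith)
        have h5 := Submodule.sub_mem _ h4 hy₂.2
        rwa [add_right_comm, add_sub_cancel_right] at h5
      have h4 := eq_zero_of_mem_gr (Set.disjoint_left.mpr fun i hi hi' =>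
        not_lt.mpr (Set.mem_Ici.mp hi') (Set.mem_Iio.mp hi)) h2 h3
      rw [add_right_comm, h4, zero_add]
      exact hy₂.1
  · apply le_antisymm
    · refine ((h.stable_left.inf (isStable_gr d _)).annih H.mem).le_of_wt H.rational
        fun i x hx hxi => ?_
      by_cases hi : i < -a - k
      · exact Submodule.mem_sup_left (Submodule.mem_sup_right (mem_gr hxi hi))
      · have h1 : x ∈ annih e m := by
          have h2 : m ≤ annih e (Submodule.span ℂ {x}) :=
            h.stable_left.le_of_wt H.rational fun j y hy hyj z hz => by
              obtain ⟨c, rfl⟩ := Submodule.mem_span_singleton.mp hz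
              rw [lie_smul, map_smul, chi_lie_swap.mp, smul_zero]
              by_cases hij : i + j = -a
              · exact hx y ⟨hy, mem_gr hyj (by simp only [Set.mem_Iic]; linarith)⟩
              · exact chi_lie_eq_zero_of_wt H.mem hxi hyj hij
          exact le_annih_comm.mp h2 (Submodule.mem_span_singleton_self x)
        rw [h.perp] at h1
        exact sup_le_sup_right (le_sup_left : n ≤ _) (LinearMap.ker (ad ℂ L e)) h1
    · refine sup_le (sup_le ?_ ?_) (ker_le_annih e _)
      · exact h.right_le_annih.trans (annih_anti e inf_le_left)
      · refine (gr_le_annih_gr H.mem fun i hi j hj => ?_).trans (annih_anti e inf_le_right)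
        simp only [Set.mem_Iio, Set.mem_Iic] at *
        exact ne_of_lt (by linarith)

section Chains

variable [FiniteDimensional ℂ L] [IsKilling ℂ L] {d e : L} {a : ℤ}

lemma Adm.linked (H : IsOptimalFor d e a) {m n m' n' : Submodule ℂ L} (h : Adm d e a m n)
    (h' : Adm d e a m' n') (hm : m ≤ m') (hn : n' ≤ n) (hlie : ∀ x ∈ n, ∀ y ∈ m', ⁅x, y⁆ ∈ m') :
    Linked e (m, n) (m', n') :=
  .rel _ _ ⟨⟨wt d, a, H.rational.isQGrading, H.one_lt, H.mem, h.isAdmissiblePairQ H.rational,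
    h'.isAdmissiblePairQ H.rational, Or.inl ⟨hm, h'.le, hn⟩⟩,
    h.naturalIso H.rational h' hm hn hlie, h.le, h'.le⟩

lemma Adm.linked_truncate (H : IsOptimalFor d e a) {m n : Submodule ℂ L} (h : Adm d e a m n) :
    Linked e (m ⊓ gr d (Set.Iic (-(a / 2 : ℚ))), n ⊔ gr d (Set.Iio (-(a / 2 : ℚ)))) (m, n) := by
  have ha := H.pos
  obtain ⟨ε, hε, hgap⟩ := exists_gap d (-a)
  have chain : ∀ i : ℕ, Linked e
      (m ⊓ gr d (Set.Iic (-(a / 2 : ℚ))), n ⊔ gr d (Set.Iio (-(a / 2 : ℚ))))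
      (m ⊓ gr d (Set.Iic (-(a / 2 : ℚ) + i * ε)),
        n ⊔ gr d (Set.Iio (-a - (-(a / 2 : ℚ) + i * ε)))) := by
    intro i
    induction i with
    | zero =>
      have h1 : -(a / 2 : ℚ) + (0 : ℕ) * ε = -(a / 2 : ℚ) := by simp
      have h2 : -a - -(a / 2 : ℚ) = -(a / 2 : ℚ) := by ring
      rw [h1, h2]
      exact .refl _
    | succ i ih =>
      refine ih.trans _ _ _ ?_
      have hiε : 0 ≤ i * ε := by positivity
      push_cast
      refine (h.truncate H (by linarith)).linked H (h.truncate H (by linarith)) ?_ ?_ ?_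
      · exact inf_le_inf_left _ (gr_mono (Set.Iic_subset_Iic.mpr (by linarith)))
      · exact sup_le_sup_left (gr_mono (Set.Iio_subset_Iio (by linarith))) _
      · rintro x hx y ⟨hym, hy⟩
        have hx0 : x ∈ gr d (Set.Iio 0) := (h.truncate H (by linarith)).le_gr hx
        obtain ⟨x, hxn, u, hu, rfl⟩ := Submodule.mem_sup.mp hx
        refine ⟨?_, lie_mem_Iic hx0 hy⟩
        rw [add_lie]
        refine m.add_mem (h.lie_left x hxn y hym) (h.gr_le ?_)
        have h1 : ⁅u, y⁆ ∈ gr d (Set.Iio (-a + ε)) :=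
          lie_mem_gr (fun i hi j hj => by simp only [Set.mem_Iio, Set.mem_Iic] at *; linarith) hu hy
        refine _root_.gr_le.mpr (fun j hj z hz => ?_) h1
        by_cases hjb : wt d j = ⊥
        · rw [hjb, Submodule.mem_bot] at hz
          rw [hz]; exact Submodule.zero_mem _
        · exact mem_gr hz (hgap j hj hjb)
  obtain ⟨i, hi⟩ := exists_nat_gt ((a / 2 : ℚ) / ε)
  rw [div_lt_iff₀ hε] at hi
  have h1 : m ⊓ gr d (Set.Iic (-(a / 2 : ℚ) + i * ε)) = m := inf_eq_left.mpr
    (h.le.trans (h.le_gr.trans (gr_mono fun j hj => by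
      simp only [Set.mem_Iio, Set.mem_Iic] at *; linarith)))
  have h2 : n ⊔ gr d (Set.Iio (-a - (-(a / 2 : ℚ) + i * ε))) = n := sup_eq_left.mpr
    ((gr_mono fun j hj => by simp only [Set.mem_Iio, Set.mem_Iic] at *; linarith).trans
      (h.gr_le.trans h.le))
  have := chain i
  rwa [h1, h2] at this

/-- The admissible pairs with `𝔪 = ⨁_{j < -a/2} 𝔤_j`. -/
lemma IsOptimalFor.adm (H : IsOptimalFor d e a) {s : Submodule ℂ L}
    (hs : s ≤ wt d (-(a / 2 : ℚ))) (hsK : ∀ x ∈ s, ⁅e, x⁆ = 0 → x = 0)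
    (hsup : wt d (-(a / 2 : ℚ)) ≤ s ⊔ LinearMap.ker (ad ℂ L e)) :
    Adm d e a (gr d (Set.Iio (-(a / 2 : ℚ)))) (gr d (Set.Iio (-(a / 2 : ℚ))) ⊔ s) := by
  have ha := H.pos
  have hnle : gr d (Set.Iio (-(a / 2 : ℚ))) ⊔ s ≤ gr d (Set.Iic (-(a / 2 : ℚ))) :=
    sup_le (gr_mono Set.Iio_subset_Iic_self) (hs.trans (wt_le_gr (Set.mem_Iic.mpr le_rfl)))
  have hnle0 : gr d (Set.Iic (-(a / 2 : ℚ))) ≤ gr d (Set.Iio 0) := gr_mono fun j hj => by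
    simp only [Set.mem_Iio, Set.mem_Iic] at *; linarith
  have hst : IsStable d (gr d (Set.Iio (-(a / 2 : ℚ))) ⊔ s) :=
    (isStable_gr d _).sup (isStable_of_le_wt hs)
  have hlie : ∀ x ∈ gr d (Set.Iio (-(a / 2 : ℚ))) ⊔ s, ∀ y ∈ gr d (Set.Iio (-(a / 2 : ℚ))) ⊔ s,
      ⁅x, y⁆ ∈ gr d (Set.Iio (-(a / 2 : ℚ))) := fun x hx y hy =>
    lie_mem_gr (fun i hi j hj => by simp only [Set.mem_Iio, Set.mem_Iic] at *; linarith)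
      (hnle hx) (hnle hy)
  refine ⟨isStable_gr d _, hst, fun x hx y hy => Submodule.mem_sup_left (hlie x hx y hy),
    fun x hx y hy => hlie x hx y (Submodule.mem_sup_left hy), gr_mono fun j hj => ?_, le_sup_left,
    hnle.trans hnle0, eq_zero_of_forall_wt H.rational H.mem hst fun j x hx hxj hex => ?_, ?_⟩
  · simp only [Set.mem_Iio, Set.mem_Iic] at *; linarith
  · rcases lt_trichotomy j (-(a / 2 : ℚ)) with hj | rfl | hj
    · exact H.eq_zero x (mem_gr hxj hj) hex
    · refine hsK x ?_ hex
      obtain ⟨y, hy, z, hz, rfl⟩ := Submodule.mem_sup.mp hx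
      have h1 : y ∈ wt d (-(a / 2 : ℚ)) := by simpa using Submodule.sub_mem _ hxj (hs hz)
      rw [eq_zero_of_wt h1 hy (by simp), zero_add]
      exact hz
    · exact eq_zero_of_wt hxj (hnle hx) (by simpa using hj)
  · refine le_antisymm (((isStable_gr d _).annih H.mem).le_of_wt H.rational
      fun j x hx hxj => ?_) (sup_le (sup_le ?_ ?_) (ker_le_annih e _))
    · rcases lt_trichotomy j (-(a / 2 : ℚ)) with hj | rfl | hj
      · exact Submodule.mem_sup_left (Submodule.mem_sup_left (mem_gr hxj hj))
      · exact sup_le_sup_right (le_sup_right : s ≤ _) (LinearMap.ker (ad ℂ L e)) (hsup hxj)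
      · refine Submodule.mem_sup_right (lie_eq_zero_of_wt H.rational H.mem hxj fun y hy => ?_)
        exact hx y (mem_gr hy (by simp only [Set.mem_Iio]; linarith))
    · exact gr_le_annih_gr H.mem fun i hi j hj => by
        simp only [Set.mem_Iio] at *; exact ne_of_lt (by linarith)
    · refine (hs.trans (wt_le_gr (Set.mem_Iic.mpr le_rfl))).trans
        (gr_le_annih_gr H.mem fun i hi j hj => ?_)
      simp only [Set.mem_Iio, Set.mem_Iic] at *; exact ne_of_lt (by linarith)

/-- Every admissible pair is linked to one with `𝔪 = ⨁_{j < -a/2} 𝔤_j`. -/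
lemma Adm.exists_linked (H : IsOptimalFor d e a) {m n : Submodule ℂ L} (h : Adm d e a m n) :
    ∃ s, IsHalfComplement d e a s ∧ Linked e (m, n)
      (gr d (Set.Iio (-(a / 2 : ℚ))), gr d (Set.Iio (-(a / 2 : ℚ))) ⊔ s) := by
  have ha := H.pos
  have h0 := h.truncate H le_rfl
  rw [show -a - -(a / 2 : ℚ) = -(a / 2 : ℚ) by ring] at h0
  have hlink0 := (h.linked_truncate H).symm
  set m₀ := m ⊓ gr d (Set.Iic (-(a / 2 : ℚ)))
  set n₀ := n ⊔ gr d (Set.Iio (-(a / 2 : ℚ))) with hn₀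
  set G := gr d (Set.Iio (-(a / 2 : ℚ))) with hG
  have hGn : G ≤ n₀ := le_sup_right
  have hm₁n : m₀ ⊔ G ≤ n₀ := sup_le h0.le hGn
  have hm₁le : m₀ ⊔ G ≤ gr d (Set.Iic (-(a / 2 : ℚ))) :=
    sup_le inf_le_right (gr_mono Set.Iio_subset_Iic_self)
  have hiso : m₀ ⊔ G ≤ annih e (m₀ ⊔ G) := by
    have hIic : gr d (Set.Iic (-(a / 2 : ℚ))) ≤ annih e G :=
      gr_le_annih_gr H.mem fun i hi j hj => by
        simp only [Set.mem_Iio, Set.mem_Iic] at *; exact ne_of_lt (by linarith)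
    rw [annih_sup]
    refine le_inf (sup_le (h0.le.trans h0.right_le_annih) ?_) (hm₁le.trans hIic)
    exact le_annih_comm.mp (inf_le_right.trans hIic)
  have hlie : ∀ x ∈ n₀, ∀ y ∈ m₀ ⊔ G, ⁅x, y⁆ ∈ m₀ ⊔ G := by
    intro x hx y hy
    obtain ⟨y, hym, z, hz, rfl⟩ := Submodule.mem_sup.mp hy
    rw [lie_add]
    exact Submodule.add_mem_sup (h0.lie_left x hx y hym) (lie_mem_Iio (h0.le_gr hx) hz)
  have h1 := h0.shrink H.mem (h0.stable_left.sup (isStable_gr d _)) le_sup_left hm₁n hiso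
    fun x hx _ => hlie x hx
  have hlink1 := h0.linked H h1 le_sup_left inf_le_left hlie
  set n₁ := n₀ ⊓ annih e (m₀ ⊔ G) with hn₁
  have hn₁le : n₁ ≤ gr d (Set.Iic (-(a / 2 : ℚ))) := by
    refine h1.stable_right.le_of_wt H.rational fun j x hx hxj => ?_
    by_cases hj : j ≤ -(a / 2 : ℚ)
    · exact mem_gr hxj hj
    · have h2 := lie_eq_zero_of_wt H.rational H.mem hxj fun y hy =>
        hx.2 y (Submodule.mem_sup_right (mem_gr hy (by simp only [Set.mem_Iio]; linarith)))
      rw [h1.eq_zero x hx h2]; exact Submodule.zero_mem _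
  obtain ⟨s, hs, hle⟩ : ∃ s, IsHalfComplement d e a s ∧ n₁ ⊓ wt d (-(a / 2 : ℚ)) ≤ s := by
    have hdisj : Disjoint (n₁ ⊓ wt d (-(a / 2 : ℚ)))
        (LinearMap.ker (ad ℂ L e) ⊓ wt d (-(a / 2 : ℚ))) :=
      Submodule.disjoint_def.mpr fun x hx hx' => h1.eq_zero x hx.1 hx'.1
    obtain ⟨s₀, hle, hs₀⟩ := hdisj.exists_isCompl
    refine ⟨s₀ ⊓ wt d (-(a / 2 : ℚ)), ⟨inf_le_right, fun x hx hex => ?_, fun x hx => ?_⟩,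
      le_inf hle inf_le_right⟩
    · exact Submodule.disjoint_def.mp hs₀.disjoint x hx.1 ⟨hex, hx.2⟩
    · have hx' : x ∈ s₀ ⊔ LinearMap.ker (ad ℂ L e) ⊓ wt d (-(a / 2 : ℚ)) := by
        rw [hs₀.sup_eq_top]; trivial
      obtain ⟨y, hy, z, hz, rfl⟩ := Submodule.mem_sup.mp hx'
      exact Submodule.add_mem_sup ⟨hy, by simpa using Submodule.sub_mem _ hx hz.2⟩ hz.1
  refine ⟨s, hs, hlink0.trans _ _ _ (hlink1.trans _ _ _ (.symm _ _ ?_))⟩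
  refine (H.adm hs.le hs.eq_zero hs.sup).linked H h1 le_sup_right ?_
    (lie_mem_of_Iio_le H le_sup_right hm₁le hs.sup_le_gr)
  refine h1.stable_right.le_of_wt H.rational fun j x hx hxj => ?_
  rcases lt_trichotomy j (-(a / 2 : ℚ)) with hj | rfl | hj
  · exact Submodule.mem_sup_left (mem_gr hxj hj)
  · exact Submodule.mem_sup_right (hle ⟨hx, hxj⟩)
  · rw [eq_zero_of_wt hxj (hn₁le hx) (by simpa using hj)]; exact Submodule.zero_mem _

/-- The intermediate pair used to exchange two half complements. -/
lemma IsHalfComplement.linked_span (H : IsOptimalFor d e a) {s : Submodule ℂ L}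
    (hs : IsHalfComplement d e a s) {y : L} (hy : y ∈ s) :
    Linked e (gr d (Set.Iio (-(a / 2 : ℚ))), gr d (Set.Iio (-(a / 2 : ℚ))) ⊔ s)
      (gr d (Set.Iio (-(a / 2 : ℚ))) ⊔ Submodule.span ℂ {y},
        gr d (Set.Iio (-(a / 2 : ℚ))) ⊔ (s ⊓ annih e (Submodule.span ℂ {y}))) := by
  have ha := H.pos
  have h := H.adm hs.le hs.eq_zero hs.sup
  have hys : Submodule.span ℂ {y} ≤ s := by simpa using hy
  set G := gr d (Set.Iio (-(a / 2 : ℚ)))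
  have hm'n : G ⊔ Submodule.span ℂ {y} ≤ G ⊔ s := sup_le_sup_left hys _
  have hann : G ⊔ s ≤ annih e G := h.right_le_annih
  have hyy : Submodule.span ℂ {y} ≤ annih e (Submodule.span ℂ {y}) := by
    intro z hz w hw
    obtain ⟨c, rfl⟩ := Submodule.mem_span_singleton.mp hz
    obtain ⟨c', rfl⟩ := Submodule.mem_span_singleton.mp hw
    rw [smul_lie, lie_smul, lie_self]; simp
  have hGy : G ≤ annih e (Submodule.span ℂ {y}) :=
    le_annih_comm.mp (hys.trans (le_sup_right.trans hann))
  have hiso : G ⊔ Submodule.span ℂ {y} ≤ annih e (G ⊔ Submodule.span ℂ {y}) := by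
    rw [annih_sup]
    exact le_inf (hm'n.trans hann) (sup_le hGy hyy)
  have hlie := lie_mem_of_Iio_le H le_sup_left (hm'n.trans hs.sup_le_gr) hs.sup_le_gr
  have h' := h.shrink H.mem ((isStable_gr d _).sup (isStable_of_le_wt (hys.trans hs.le)))
    le_sup_left hm'n hiso fun x hx _ => hlie x hx
  have heq : (G ⊔ s) ⊓ annih e (G ⊔ Submodule.span ℂ {y})
      = G ⊔ (s ⊓ annih e (Submodule.span ℂ {y})) := by
    rw [annih_sup, ← inf_assoc, inf_eq_left.mpr hann, sup_inf_assoc_of_le _ hGy]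
  rw [heq] at h'
  exact h.linked H h' le_sup_left (sup_le_sup_left inf_le_left _) hlie

omit [FiniteDimensional ℂ L] [IsKilling ℂ L] in
lemma IsHalfComplement.eq_of_le {s s' : Submodule ℂ L} (hs : IsHalfComplement d e a s)
    (hs' : IsHalfComplement d e a s') (h : s' ≤ s) : s = s' := by
  refine le_antisymm (fun x hx => ?_) h
  obtain ⟨y, hy, z, hz, rfl⟩ := Submodule.mem_sup.mp (hs'.sup (hs.le hx))
  rw [hs.eq_zero z (by simpa using s.sub_mem hx (h hy)) hz, add_zero]
  exact hy

lemma IsHalfComplement.exists_lie_ne_zero (H : IsOptimalFor d e a) {s : Submodule ℂ L}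
    (hs : IsHalfComplement d e a s) {y : L} (hy : y ∈ s) (hy0 : y ≠ 0) :
    ∃ x ∈ s, killingForm ℂ L e ⁅x, y⁆ ≠ 0 := by
  by_contra! hcon
  refine hy0 (hs.eq_zero y hy (lie_eq_zero_of_wt H.rational H.mem (hs.le hy) fun z hz => ?_))
  rw [show -a - -(a / 2 : ℚ) = -(a / 2 : ℚ) by ring] at hz
  have h1 : s ⊔ LinearMap.ker (ad ℂ L e) ≤ annih e (Submodule.span ℂ {y}) := by
    refine sup_le (fun x hx w hw => ?_) (ker_le_annih e _)
    obtain ⟨c, rfl⟩ := Submodule.mem_span_singleton.mp hw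
    rw [lie_smul, map_smul, hcon x hx, smul_zero]
  exact chi_lie_swap.mp (h1 (hs.sup hz) y (Submodule.mem_span_singleton_self y))

omit [IsKilling ℂ L] in
lemma exists_mem_annih_of_lt {e : L} {s t : Submodule ℂ L} (h : t < s) :
    ∃ y ∈ s, y ≠ 0 ∧ y ∈ annih e t := by
  let φ : s →ₗ[ℂ] Module.Dual ℂ t :=
    t.dualRestrict ∘ₗ ((ad ℂ L : L →ₗ[ℂ] L →ₗ[ℂ] L).compr₂ (killingForm ℂ L e)) ∘ₗ s.subtype
  have hφ : LinearMap.ker φ ≠ ⊥ := LinearMap.ker_ne_bot_of_finrank_lt (by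
    rw [Subspace.dual_finrank_eq]; exact Submodule.finrank_lt_finrank_of_lt h)
  obtain ⟨y, hy, hy0⟩ := Submodule.exists_mem_ne_zero_of_ne_bot hφ
  exact ⟨y, y.2, by simpa using hy0, fun z hz => LinearMap.congr_fun hy ⟨z, hz⟩⟩

/-- Two half complements can be made closer to each other by a one-dimensional exchange. -/
lemma IsHalfComplement.exists_exchange (H : IsOptimalFor d e a) {s s' : Submodule ℂ L}
    (hs : IsHalfComplement d e a s) (hs' : IsHalfComplement d e a s') (hne : ¬ s' ≤ s) :
    ∃ s'', IsHalfComplement d e a s'' ∧ s ⊓ s' < s'' ⊓ s' ∧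
      Linked e (gr d (Set.Iio (-(a / 2 : ℚ))), gr d (Set.Iio (-(a / 2 : ℚ))) ⊔ s)
        (gr d (Set.Iio (-(a / 2 : ℚ))), gr d (Set.Iio (-(a / 2 : ℚ))) ⊔ s'') := by
  have hlt : s ⊓ s' < s := lt_of_le_of_ne inf_le_left fun h =>
    hne (hs'.eq_of_le hs (inf_eq_left.mp h)).le
  obtain ⟨y, hys, hy0, hyann⟩ := exists_mem_annih_of_lt (e := e) hlt
  obtain ⟨x, hxs, hxy⟩ := hs.exists_lie_ne_zero H hys hy0
  obtain ⟨x', hx', r, hr, hx'r⟩ := Submodule.mem_sup.mp (hs'.sup (hs.le hxs))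
  have hmem : ∀ {z}, z ∈ annih e (Submodule.span ℂ {y}) ↔ killingForm ℂ L e ⁅z, y⁆ = 0 := by
    refine fun {z} => ⟨fun h => h y (Submodule.mem_span_singleton_self y), fun h w hw => ?_⟩
    obtain ⟨c, rfl⟩ := Submodule.mem_span_singleton.mp hw
    rw [lie_smul, map_smul, h, smul_zero]
  have hx'y : killingForm ℂ L e ⁅x', y⁆ ≠ 0 := by
    rw [← hx'r, add_lie, map_add, hmem.mp (ker_le_annih e _ hr), add_zero] at hxy
    exact hxy
  have hyH : y ∈ s ⊓ annih e (Submodule.span ℂ {y}) := ⟨hys, hmem.mpr (by simp)⟩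
  set I := s ⊓ annih e (Submodule.span ℂ {y}) with hI
  have hkey : ∀ z ∈ I ⊔ Submodule.span ℂ {x'}, killingForm ℂ L e ⁅z, y⁆ = 0 → z ∈ I := by
    intro z hz hzy
    obtain ⟨u, hu, v, hv, rfl⟩ := Submodule.mem_sup.mp hz
    obtain ⟨c, rfl⟩ := Submodule.mem_span_singleton.mp hv
    rw [add_lie, map_add, hmem.mp hu.2, smul_lie, map_smul, zero_add, smul_eq_mul,
      mul_eq_zero, or_iff_left hx'y] at hzy
    rwa [hzy, zero_smul, add_zero]
  have hs'' : IsHalfComplement d e a (I ⊔ Submodule.span ℂ {x'}) := by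
    refine ⟨sup_le (inf_le_left.trans hs.le) (by simpa using hs'.le hx'), fun z hz hez => ?_,
      hs.sup.trans (sup_le (fun v hv => ?_) le_sup_right)⟩
    · exact hs.eq_zero z (hkey z hz (hmem.mp (ker_le_annih e _ hez))).1 hez
    · set c := killingForm ℂ L e ⁅v, y⁆ / killingForm ℂ L e ⁅x, y⁆
      have h1 : v - c • x ∈ I := ⟨s.sub_mem hv (s.smul_mem c hxs), hmem.mpr (by
        rw [sub_lie, map_sub, smul_lie, map_smul, smul_eq_mul, div_mul_cancel₀ _ hxy, sub_self])⟩
      have h2 : x ∈ I ⊔ Submodule.span ℂ {x'} ⊔ LinearMap.ker (ad ℂ L e) := by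
        rw [← hx'r]
        exact Submodule.add_mem_sup
          (Submodule.mem_sup_right (Submodule.mem_span_singleton_self x')) hr
      rw [← sub_add_cancel v (c • x)]
      exact Submodule.add_mem _ (Submodule.mem_sup_left (Submodule.mem_sup_left h1))
        (Submodule.smul_mem _ c h2)
  have hI'' : (I ⊔ Submodule.span ℂ {x'}) ⊓ annih e (Submodule.span ℂ {y}) = I :=
    le_antisymm (fun z hz => hkey z hz.1 (hmem.mp hz.2)) (le_inf le_sup_left inf_le_right)
  refine ⟨_, hs'', ?_, ?_⟩
  · have hle : s ⊓ s' ≤ I := le_inf inf_le_left fun z hz =>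
      hmem.mpr (chi_lie_swap.mp (hyann z hz))
    refine lt_of_le_not_ge (le_inf (hle.trans le_sup_left) inf_le_right) fun h => ?_
    have := h ⟨Submodule.mem_sup_right (Submodule.mem_span_singleton_self x'), hx'⟩
    exact hx'y (chi_lie_swap.mp (hyann x' this))
  · have h1 := hs.linked_span H hys
    have h2 := hs''.linked_span H (Submodule.mem_sup_left hyH)
    rw [hI''] at h2
    exact h1.trans _ _ _ (h2.symm _ _)

lemma IsHalfComplement.linked (H : IsOptimalFor d e a) {s s' : Submodule ℂ L}
    (hs : IsHalfComplement d e a s) (hs' : IsHalfComplement d e a s') :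
    Linked e (gr d (Set.Iio (-(a / 2 : ℚ))), gr d (Set.Iio (-(a / 2 : ℚ))) ⊔ s)
      (gr d (Set.Iio (-(a / 2 : ℚ))), gr d (Set.Iio (-(a / 2 : ℚ))) ⊔ s') := by
  suffices h : ∀ (k : ℕ) (s : Submodule ℂ L), IsHalfComplement d e a s →
      finrank ℂ s' ≤ finrank ℂ ↥(s ⊓ s') + k →
      Linked e (gr d (Set.Iio (-(a / 2 : ℚ))), gr d (Set.Iio (-(a / 2 : ℚ))) ⊔ s)
        (gr d (Set.Iio (-(a / 2 : ℚ))), gr d (Set.Iio (-(a / 2 : ℚ))) ⊔ s') from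
    h _ s hs (Nat.le_add_left _ _)
  intro k
  induction k with
  | zero =>
    intro s hs hk
    rw [hs.eq_of_le hs' (inf_eq_right.mp (Submodule.eq_of_le_of_finrank_le inf_le_right hk))]
    exact .refl _
  | succ k ih =>
    intro s hs hk
    by_cases hle : s' ≤ s
    · rw [hs.eq_of_le hs' hle]
      exact .refl _
    · obtain ⟨s'', hs'', hlt, hlink⟩ := hs.exists_exchange H hs' hle
      have := Submodule.finrank_lt_finrank_of_lt hlt
      exact hlink.trans _ _ _ (ih s'' hs'' (by omega))

/-- All admissible pairs relative to an optimal grading are linked. -/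
lemma Adm.linked_of_isOptimalFor (H : IsOptimalFor d e a) {m n m' n' : Submodule ℂ L}
    (h : Adm d e a m n) (h' : Adm d e a m' n') : Linked e (m, n) (m', n') := by
  obtain ⟨s, hs, hl⟩ := h.exists_linked H
  obtain ⟨s', hs', hl'⟩ := h'.exists_linked H
  exact hl.trans _ _ _ ((hs.linked H hs').trans _ _ _ (hl'.symm _ _))

end Chains

/-! ### A graded version of the Jacobson–Morozov theorem -/

/-- The Kleinecke–Shirokov theorem for nilpotent elements. -/
lemma isNilpotent_of_commute_commutator {R : Type*} [Ring R] [Algebra ℂ R] {x z : R}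
    (hx : IsNilpotent x) (h : Commute x (x * z - z * x)) : IsNilpotent (x * z - z * x) := by
  let δ : R →ₗ[ℂ] R := LinearMap.mulLeft ℂ x - LinearMap.mulRight ℂ x
  have hδ : IsNilpotent δ := (LinearMap.commute_mulLeft_right x x).isNilpotent_sub
    ((LinearMap.isNilpotent_mulLeft_iff ℂ x).mpr hx)
    ((LinearMap.isNilpotent_mulRight_iff ℂ x).mpr hx)
  have happ : ∀ t, δ t = x * t - t * x := fun t => rfl
  set w := x * z - z * x with hw
  have hmul : ∀ s t, δ (s * t) = δ s * t + s * δ t := fun s t => by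
    simp only [happ]; noncomm_ring
  have hδw : ∀ n : ℕ, δ (w ^ n) = 0 := fun n => by
    rw [happ, (h.pow_right n).eq, sub_self]
  have hstep : ∀ (k : ℕ) (t : R), (δ ^ (k + 1)) (t * z) =
      (δ ^ (k + 1)) t * z + (k + 1) • ((δ ^ k) t * w) := by
    intro k t
    induction k with
    | zero => simp [hmul, happ z, ← hw]
    | succ k ih =>
      rw [pow_succ', Module.End.mul_apply, ih, map_add, map_nsmul, hmul, hmul, happ z, ← hw,
        ← pow_one w, hδw 1, mul_zero, add_zero, ← Module.End.mul_apply, ← Module.End.mul_apply,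
        ← pow_succ', ← pow_succ', add_assoc, pow_one, succ_nsmul' _ (k + 1)]
  have hmain : ∀ n : ℕ, (δ ^ n) (z ^ n) = n.factorial • w ^ n := by
    intro n
    induction n with
    | zero => simp
    | succ n ih =>
      rw [pow_succ z, hstep, pow_succ' δ, Module.End.mul_apply, ih, map_nsmul, hδw, smul_zero,
        zero_mul, zero_add, smul_mul_assoc, ← pow_succ, smul_smul, Nat.factorial_succ]
  obtain ⟨N, hN⟩ := hδ
  refine ⟨N, ?_⟩
  have h1 := hmain N
  rw [hN, LinearMap.zero_apply, ← Nat.cast_smul_eq_nsmul ℂ] at h1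
  exact (smul_eq_zero.mp h1.symm).resolve_left (by exact_mod_cast N.factorial_ne_zero)

lemma commute_ad {x y : L} (h : ⁅x, y⁆ = 0) : Commute (ad ℂ L x) (ad ℂ L y) := by
  ext z
  simp only [Module.End.mul_apply, ad_apply]
  rw [leibniz_lie, h, zero_lie, zero_add]

lemma killingForm_eq_zero_of_commute [FiniteDimensional ℂ L] {x y : L}
    (hx : IsNilpotent (ad ℂ L x)) (h : ⁅x, y⁆ = 0) : killingForm ℂ L x y = 0 := by
  rw [killingForm_apply_apply]
  exact (LinearMap.isNilpotent_trace_of_isNilpotent ((commute_ad h).isNilpotent_mul_right hx)).eq_zero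

/-- Projection to a weight space. -/
lemma exists_mem_wt_sub_mem_gr {d : L} (hd : IsRational d) (x : L) (j : ℚ) :
    ∃ y ∈ wt d j, x - y ∈ gr d {j}ᶜ := by
  have hx : x ∈ gr d ({j} ∪ {j}ᶜ) := by
    rw [Set.union_compl_self, gr_univ hd]; trivial
  rw [gr_union] at hx
  obtain ⟨y, hy, z, hz, rfl⟩ := Submodule.mem_sup.mp hx
  exact ⟨y, by simpa [gr] using hy, by simpa using hz⟩

/-- If `x` is homogeneous and in the image of `ad e`, it has a homogeneous preimage. -/
lemma exists_mem_wt_lie_eq {d e x : L} {a j : ℚ} (hd : IsRational d) (he : e ∈ wt d a)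
    (hx : x ∈ wt d (a + j)) (h : x ∈ LinearMap.range (ad ℂ L e)) : ∃ y ∈ wt d j, ⁅e, y⁆ = x := by
  obtain ⟨z, rfl⟩ := h
  obtain ⟨y, hy, hzy⟩ := exists_mem_wt_sub_mem_gr hd z j
  refine ⟨y, hy, ?_⟩
  rw [ad_apply] at hx ⊢
  have h1 : ⁅e, z - y⁆ ∈ gr d {a + j}ᶜ := by
    refine lie_mem_gr (S := {a}) (fun i hi k hk => ?_) (mem_gr he rfl) hzy
    rw [Set.mem_singleton_iff.mp hi]
    simpa using hk
  rw [lie_sub] at h1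
  have h2 := eq_zero_of_wt ((wt d (a + j)).sub_mem hx (lie_mem_wt he hy)) h1 (by simp)
  exact (sub_eq_zero.mp h2).symm

section JacobsonMorozov

variable [FiniteDimensional ℂ L] [IsKilling ℂ L]

lemma mem_range_of_forall {T T' : L →ₗ[ℂ] L}
    (hT : ∀ y z, killingForm ℂ L (T y) z = killingForm ℂ L y (T' z)) {x : L}
    (h : ∀ z, T' z = 0 → killingForm ℂ L x z = 0) : x ∈ LinearMap.range T := by
  have h1 := LinearMap.BilinForm.orthogonal_orthogonal
    (IsKilling.killingForm_nondegenerate ℂ L) (LieModule.traceForm_isSymm ℂ L L).isRefl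
    (LinearMap.range T)
  rw [← h1, LinearMap.BilinForm.mem_orthogonal_iff]
  intro z hz
  change killingForm ℂ L z x = 0
  rw [killingForm_symm]
  refine h z ((IsKilling.killingForm_nondegenerate ℂ L).1 _ fun y => ?_)
  rw [killingForm_symm, ← hT]
  exact hz _ ⟨y, rfl⟩

/-- A nilpotent homogeneous `e` of nonzero weight lies in the image of `(ad e)²`. -/
lemma exists_eq_lie_lie {d e : L} {a : ℚ} (hd : IsRational d) (he : e ∈ wt d a) (ha : a ≠ 0)
    (hnil : IsNilpotent (ad ℂ L e)) : ∃ y ∈ wt d (-a), ⁅e, ⁅e, y⁆⁆ = e := by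
  have hskew : ∀ y z, killingForm ℂ L ⁅e, y⁆ z = -killingForm ℂ L y ⁅e, z⁆ := fun y z => by
    rw [← lie_skew, map_neg, LinearMap.neg_apply, ← killingForm_lie_comm]
  have hperp : ∀ z, ⁅e, ⁅e, z⁆⁆ = 0 → killingForm ℂ L e z = 0 := by
    have hst : IsStable d ((LinearMap.ker (ad ℂ L e)).comap (ad ℂ L e)) := by
      intro z hz
      rw [Submodule.mem_comap, ad_apply] at hz ⊢
      rw [leibniz_lie, ← lie_skew e d, mem_wt.mp he, neg_lie, smul_lie]
      exact Submodule.add_mem _ (Submodule.neg_mem _ (Submodule.smul_mem _ _ hz))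
        (isStable_ker he _ hz)
    have hle : (LinearMap.ker (ad ℂ L e)).comap (ad ℂ L e) ≤ LinearMap.ker (killingForm ℂ L e) := by
      refine hst.le_of_wt hd fun j z hz hzj => ?_
      rw [LinearMap.mem_ker]
      by_cases hj : a + j = 0
      · have hw : ⁅⁅e, z⁆, d⁆ = 0 := by
          have := lie_mem_wt he hzj
          rw [hj, mem_wt, Rat.cast_zero, zero_smul] at this
          rw [← lie_skew, this, neg_zero]
        have hcomm : ad ℂ L ⁅e, z⁆ = ad ℂ L e * ad ℂ L z - ad ℂ L z * ad ℂ L e := by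
          ext v
          simp
        have hzz : ⁅e, ⁅e, z⁆⁆ = 0 := hz
        have hn : IsNilpotent (ad ℂ L ⁅e, z⁆) := by
          rw [hcomm]
          exact isNilpotent_of_commute_commutator hnil (hcomm ▸ commute_ad hzz)
        have h1 := killingForm_eq_zero_of_commute hn hw
        rw [killingForm_symm, killingForm_lie_comm, mem_wt.mp he, map_smul, LinearMap.smul_apply,
          smul_eq_mul] at h1
        exact (mul_eq_zero.mp h1).resolve_left (by exact_mod_cast ha)
      · exact killingForm_eq_zero_of_wt he hzj hj
    exact fun z hz => hle (x := z) hz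
  obtain ⟨y, hy⟩ := mem_range_of_forall (T := ad ℂ L e ∘ₗ ad ℂ L e) (T' := ad ℂ L e ∘ₗ ad ℂ L e)
    (fun y z => by simp [hskew]) (x := e) hperp
  obtain ⟨u, hu, huy⟩ := exists_mem_wt_sub_mem_gr hd y (-a)
  refine ⟨u, hu, ?_⟩
  have h1 : ⁅e, ⁅e, y - u⁆⁆ ∈ gr d {a}ᶜ := by
    refine lie_mem_gr (S := {a}) (T := {0}ᶜ) (fun i hi k hk => ?_) (mem_gr he rfl)
      (lie_mem_gr (S := {a}) (fun i hi k hk => ?_) (mem_gr he rfl) huy)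
    · rw [Set.mem_singleton_iff.mp hi]
      simpa using hk
    · rw [Set.mem_singleton_iff.mp hi]
      simp only [Set.mem_compl_iff, Set.mem_singleton_iff] at hk ⊢
      exact fun h => hk (by linarith)
  simp only [LinearMap.comp_apply, ad_apply] at hy
  rw [lie_sub, lie_sub, hy] at h1
  have h2 := lie_mem_wt he (lie_mem_wt he hu)
  rw [add_neg_cancel, add_zero] at h2
  exact (sub_eq_zero.mp (eq_zero_of_wt ((wt d a).sub_mem he h2) h1 (by simp))).symm

lemma exists_jordan (x : L) : ∃ s n : L, x = s + n ∧ (⨆ μ : ℂ, (ad ℂ L s).eigenspace μ = ⊤) ∧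
    IsNilpotent (ad ℂ L n) ∧ ∀ (μ : ℂ) (v : L), ⁅x, v⁆ = μ • v → ⁅n, v⁆ = 0 := by
  obtain ⟨N, -, S, hS₀, hN, hS, hSN⟩ := (ad ℂ L x).exists_isNilpotent_isSemisimple
  replace hS₀ : Commute (ad ℂ L x) S := Algebra.commute_of_mem_adjoin_self hS₀
  have hN' := hN
  rw [eq_sub_of_add_eq hSN.symm] at hN'
  have aux {μ : ℂ} {y : L} (hy : y ∈ (ad ℂ L x).maxGenEigenspace μ) : S y = μ • y := by
    rw [Module.End.maxGenEigenspace_eq] at hy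
    exact Module.End.apply_eq_of_mem_of_comm_of_isFinitelySemisimple_of_isNil hy hS₀
      hS.isFinitelySemisimple hN'
  have htop : ⨆ μ : ℂ, (ad ℂ L x).maxGenEigenspace μ = ⊤ :=
    Module.End.iSup_maxGenEigenspace_eq_top _
  have h_der (y z : L) : S ⁅y, z⁆ = ⁅S y, z⁆ + ⁅y, S z⁆ := by
    have hy : y ∈ ⨆ μ : ℂ, (ad ℂ L x).maxGenEigenspace μ := by rw [htop]; trivial
    have hz : z ∈ ⨆ μ : ℂ, (ad ℂ L x).maxGenEigenspace μ := by rw [htop]; trivial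
    induction hy using Submodule.iSup_induction' with
    | mem α y hy =>
      induction hz using Submodule.iSup_induction' with
      | mem β z hz =>
        have hyz : ⁅y, z⁆ ∈ (ad ℂ L x).maxGenEigenspace (α + β) :=
          LieModule.lie_mem_maxGenEigenspace_toEnd hy hz
        rw [aux hy, aux hz, aux hyz, smul_lie, lie_smul, ← add_smul]
      | zero => simp
      | add _ _ _ _ h h' => simp only [lie_add, map_add, h, h']; abel
    | zero => simp
    | add _ _ _ _ h h' => simp only [add_lie, map_add, h, h']; abel
  replace h_der : ∀ y z : L, S ⁅y, z⁆ = ⁅y, S z⁆ - ⁅z, S y⁆ := by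
    simp_rw [← lie_skew (S _) _, add_comm, ← sub_eq_add_neg] at h_der; assumption
  obtain ⟨s, hs⟩ := LieDerivation.IsKilling.exists_eq_ad (R := ℂ) (L := L)
    { toLinearMap := S, leibniz' := h_der }
  have hsS : ad ℂ L s = S := by
    ext v
    have h := DFunLike.congr_fun hs v
    rwa [LieDerivation.ad_apply_apply] at h
  have hnN : ad ℂ L (x - s) = N := by rw [map_sub, hSN, hsS, add_sub_cancel_right]
  refine ⟨s, x - s, (add_sub_cancel s x).symm, ?_, hnN ▸ hN, fun μ v hv => ?_⟩
  · rw [hsS]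
    exact hS.iSup_eigenspace_eq_top
  · have h1 : v ∈ (ad ℂ L x).maxGenEigenspace μ :=
      (Module.End.mem_maxGenEigenspace _ _ _).mpr ⟨1, by simp [hv]⟩
    have h2 := aux h1
    rw [← hsS, ad_apply] at h2
    rw [sub_lie, hv, h2, sub_self]

end JacobsonMorozov

lemma pow_ad_lie {e f h : L} (hhe : ⁅h, e⁆ = (2 : ℂ) • e) (hef : ⁅e, f⁆ = h) (u : L) (i : ℕ) :
    ((ad ℂ L e) ^ (i + 1)) ⁅f, u⁆ = ⁅f, ((ad ℂ L e) ^ (i + 1)) u⁆ +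
      ((i : ℂ) + 1) • (⁅h, ((ad ℂ L e) ^ i) u⁆ - (i : ℂ) • ((ad ℂ L e) ^ i) u) := by
  induction i with
  | zero => simp [leibniz_lie e f u, hef, add_comm]
  | succ i ih =>
    have h1 : ∀ v : L, ⁅e, ⁅h, v⁆⁆ = ⁅h, ⁅e, v⁆⁆ - (2 : ℂ) • ⁅e, v⁆ := fun v => by
      rw [leibniz_lie e h v, ← lie_skew e h, hhe, neg_lie, smul_lie]; abel
    rw [pow_succ', Module.End.mul_apply, ih, map_add, map_smul, map_sub, map_smul]
    simp only [ad_apply]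
    rw [h1, leibniz_lie e f (((ad ℂ L e) ^ (i + 1)) u), hef,
      Module.End.mul_apply, ad_apply,
      pow_succ' _ i, Module.End.mul_apply, ad_apply]
    push_cast
    module

/-- The weights of the centralizer of `e` are natural numbers. -/
lemma ker_le_gr {e f h : L} (hnil : IsNilpotent (ad ℂ L e)) (hhe : ⁅h, e⁆ = (2 : ℂ) • e)
    (hef : ⁅e, f⁆ = h) :
    LinearMap.ker (ad ℂ L e) ≤ gr h (Set.range (Nat.cast : ℕ → ℚ)) := by
  obtain ⟨N, hN⟩ := hnil
  have key : ∀ m k : ℕ, N ≤ k + m → ∀ u, ⁅e, ((ad ℂ L e) ^ k) u⁆ = 0 →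
      ((ad ℂ L e) ^ k) u ∈ gr h (Nat.cast '' Set.Ici k) := by
    intro m
    induction m with
    | zero =>
      intro k hk u _
      rw [pow_eq_zero_of_le (by omega) hN]
      exact Submodule.zero_mem _
    | succ m ih =>
      intro k hk u hu
      set v := ((ad ℂ L e) ^ k) u with hv
      have h1 := pow_ad_lie hhe hef u k
      rw [pow_succ' _ k, Module.End.mul_apply _ _ u, ad_apply, ← hv, hu, lie_zero, zero_add,
        ← pow_succ'] at h1
      have h2 : ⁅h, v⁆ - (k : ℂ) • v ∈ gr h (Nat.cast '' Set.Ici (k + 1)) := by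
        have hk0 : ((k : ℂ) + 1) ≠ 0 := by exact_mod_cast k.succ_ne_zero
        refine (Submodule.smul_mem_iff _ hk0).mp ?_
        rw [← h1]
        refine ih (k + 1) (by omega) _ ?_
        rw [h1, lie_smul, lie_sub, lie_smul, hu, leibniz_lie e h v, ← lie_skew e h, hhe, neg_lie, smul_lie,
          hu]
        simp
      have h3 : gr h (Nat.cast '' Set.Ici (k + 1)) ≤
          (gr h (Nat.cast '' Set.Ici (k + 1))).map (ad ℂ L h - (k : ℂ) • 1) := by
        refine gr_le.mpr fun j hj x hx => ?_
        have hjk : (j : ℂ) - k ≠ 0 := by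
          obtain ⟨i, hi, rfl⟩ := hj
          rw [sub_ne_zero]
          have : k ≠ i := (Nat.lt_of_succ_le hi).ne
          exact_mod_cast this.symm
        refine ⟨((j : ℂ) - k)⁻¹ • x, Submodule.smul_mem _ _ (mem_gr hx hj), ?_⟩
        simp only [LinearMap.sub_apply, LinearMap.smul_apply, Module.End.one_apply, ad_apply,
          lie_smul, mem_wt.mp hx]
        rw [smul_comm (k : ℂ), ← smul_sub, ← sub_smul, smul_smul, inv_mul_cancel₀ hjk, one_smul]
      obtain ⟨w, hw, hwv⟩ := h3 h2
      simp only [LinearMap.sub_apply, LinearMap.smul_apply, Module.End.one_apply, ad_apply] at hwv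
      have h4 : v - w ∈ wt h k := by
        rw [mem_wt, lie_sub, smul_sub]
        push_cast
        rw [← sub_eq_zero, ← sub_eq_zero.mpr hwv.symm]
        abel
      have h5 := Submodule.add_mem _ (mem_gr h4 (S := Nat.cast '' Set.Ici k) ⟨k, Set.self_mem_Ici, rfl⟩)
        (gr_mono (Set.image_mono (Set.Ici_subset_Ici.mpr k.le_succ)) hw)
      rwa [sub_add_cancel] at h5
  intro v hv
  refine gr_mono (Set.image_subset_range _ _) (key N 0 (by omega) v ?_)
  simpa using hv

lemma exists_int_of_mem_eigenspace {e s v : L} {μ : ℂ} (hnil : IsNilpotent (ad ℂ L e))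
    (hse : ⁅s, e⁆ = (2 : ℂ) • e)
    (hK : LinearMap.ker (ad ℂ L e) ≤ gr s (Set.range (Nat.cast : ℕ → ℚ)))
    (hv : ⁅s, v⁆ = μ • v) (hv0 : v ≠ 0) : ∃ n : ℤ, μ = n := by
  have hex : ∃ k : ℕ, ((ad ℂ L e) ^ k) v = 0 := by
    obtain ⟨N, hN⟩ := hnil
    exact ⟨N, by rw [hN, LinearMap.zero_apply]⟩
  classical
  obtain ⟨k, hk, hk'⟩ : ∃ k : ℕ, ((ad ℂ L e) ^ k) v ≠ 0 ∧ ((ad ℂ L e) ^ (k + 1)) v = 0 := by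
    have h0 : Nat.find hex ≠ 0 := fun h => hv0 (by simpa [h] using Nat.find_spec hex)
    obtain ⟨k, hk⟩ := Nat.exists_eq_succ_of_ne_zero h0
    exact ⟨k, Nat.find_min hex (by omega), by
      have := Nat.find_spec hex
      rwa [hk] at this⟩
  have hw : ∀ i : ℕ, ⁅s, ((ad ℂ L e) ^ i) v⁆ = (μ + 2 * i) • ((ad ℂ L e) ^ i) v := by
    intro i
    induction i with
    | zero => simp [hv]
    | succ i ih =>
      rw [pow_succ', Module.End.mul_apply, ad_apply, leibniz_lie, ih, hse, smul_lie, lie_smul]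
      push_cast
      module
  rw [pow_succ', Module.End.mul_apply] at hk'
  have hmem := hK (x := ((ad ℂ L e) ^ k) v) hk'
  by_contra! hcon
  have hle : gr s (Set.range (Nat.cast : ℕ → ℚ)) ≤
      ⨆ ν ≠ μ + 2 * k, (ad ℂ L s).eigenspace ν := by
    refine iSup₂_le fun j hj => ?_
    obtain ⟨i, rfl⟩ := hj
    refine le_biSup (fun ν => (ad ℂ L s).eigenspace ν) fun h => hcon (i - 2 * k) ?_
    push_cast at h ⊢
    rw [h]; ring
  refine hk ?_
  simpa using (Module.End.eigenspaces_iSupIndep (ad ℂ L s) (μ + 2 * k)).le_bot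
    ⟨Module.End.mem_eigenspace_iff.mpr (hw k), hle hmem⟩

section JacobsonMorozov

variable [FiniteDimensional ℂ L] [IsKilling ℂ L]

/-- **Jacobson–Morozov** with `h` of degree zero for a given grading. -/
lemma exists_sl2 {d e : L} {a : ℚ} (hd : IsRational d) (he : e ∈ wt d a) (ha : a ≠ 0)
    (hnil : IsNilpotent (ad ℂ L e)) :
    ∃ h f : L, h ∈ wt d 0 ∧ ⁅h, e⁆ = (2 : ℂ) • e ∧ ⁅e, f⁆ = h ∧ ⁅h, f⁆ = (-2 : ℂ) • f ∧
      IsRational h ∧ (∀ j, wt h j ≠ ⊥ → ∃ n : ℤ, j = n) ∧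
      LinearMap.ker (ad ℂ L e) ≤ gr h (Set.range (Nat.cast : ℕ → ℚ)) := by
  obtain ⟨y, hy, hyy⟩ := exists_eq_lie_lie hd he ha hnil
  have hx0 : ⁅e, (-2 : ℂ) • y⁆ ∈ wt d 0 := by
    have := lie_mem_wt he ((wt d (-a)).smul_mem (-2 : ℂ) hy)
    rwa [add_neg_cancel] at this
  have hxe : ⁅⁅e, (-2 : ℂ) • y⁆, e⁆ = (2 : ℂ) • e := by
    rw [← lie_skew, lie_smul, lie_smul, hyy, neg_smul, neg_neg]
  have hKx := ker_le_gr hnil hxe rfl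
  set x := ⁅e, (-2 : ℂ) • y⁆ with hx
  obtain ⟨s, n, hsn, hs, hn, hker⟩ := exists_jordan x
  have hne : ⁅n, e⁆ = 0 := hker _ _ hxe
  have hnK : LinearMap.ker (ad ℂ L e) ≤ LinearMap.ker (ad ℂ L n) :=
    hKx.trans (gr_le.mpr fun j _ v hv => hker _ v (mem_wt.mp hv))
  have hnrange : n ∈ LinearMap.range (ad ℂ L e) := by
    refine mem_range_of_forall (T' := -(ad ℂ L e : L →ₗ[ℂ] L)) (fun y z => ?_) fun z hz => ?_
    · rw [ad_apply, LinearMap.neg_apply, map_neg, ad_apply, ← lie_skew, map_neg,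
        LinearMap.neg_apply, ← killingForm_lie_comm]
    · exact killingForm_eq_zero_of_commute hn (hnK (by simpa [-lie_skew] using neg_eq_zero.mp hz))
  have hs_eq : s = x - n := by rw [hsn, add_sub_cancel_right]
  have hd0 : ⁅n, d⁆ = 0 := hker 0 d (by
    have := mem_wt.mp hx0
    rw [← lie_skew, this]; simp)
  have hsd : s ∈ wt d 0 := by
    rw [hs_eq]
    refine (wt d 0).sub_mem hx0 (mem_wt.mpr ?_)
    rw [← lie_skew, hd0]; simp
  have hse : ⁅s, e⁆ = (2 : ℂ) • e := by rw [hs_eq, sub_lie, hxe, hne, sub_zero]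
  have hsrange : s ∈ LinearMap.range (ad ℂ L e) := by
    rw [hs_eq]
    exact Submodule.sub_mem _ ⟨_, rfl⟩ hnrange
  obtain ⟨f, hf⟩ := hsrange
  have hKs := ker_le_gr hnil hse hf
  have hint := fun μ v => exists_int_of_mem_eigenspace (μ := μ) (v := v) hnil hse hKs
  have hrat : IsRational s := by
    refine top_unique (hs.ge.trans (iSup_le fun μ v hv => ?_))
    by_cases hv0 : v = 0
    · rw [hv0]; exact Submodule.zero_mem _
    · rw [Module.End.mem_eigenspace_iff, ad_apply] at hv
      obtain ⟨n, rfl⟩ := hint μ v hv hv0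
      exact Submodule.mem_iSup_of_mem (n : ℚ) (mem_wt.mpr (by simpa using hv))
  have hss : s ∈ wt s (2 + -2) := by rw [mem_wt]; simp
  obtain ⟨f', hf', hef'⟩ := exists_mem_wt_lie_eq hrat (a := 2) (mem_wt.mpr (by simpa using hse))
    hss ⟨f, hf⟩
  refine ⟨s, f', hsd, hse, hef', by simpa using mem_wt.mp hf', hrat, fun j hj => ?_, hKs⟩
  obtain ⟨v, hv, hv0⟩ := Submodule.exists_mem_ne_zero_of_ne_bot hj
  obtain ⟨n, hn⟩ := hint j v (mem_wt.mp hv) hv0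
  exact ⟨n, by exact_mod_cast hn⟩

end JacobsonMorozov

/-! ### Deformation to the Dynkin grading -/

lemma isStable_gr_of_mem_wt_zero {c d : L} (hc : c ∈ wt d 0) (S : Set ℚ) : IsStable c (gr d S) :=
  fun _ hx => lie_mem_gr (S := {0}) (fun i hi j hj => by
    rw [Set.mem_singleton_iff.mp hi, zero_add]; exact hj) (mem_gr hc rfl) hx

lemma mem_wt_zero_comm {c d : L} : c ∈ wt d 0 ↔ d ∈ wt c 0 := by
  simp only [mem_wt, Rat.cast_zero, zero_smul]
  rw [← lie_skew, neg_eq_zero]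

/-- Containment of a stable subspace can be checked on joint eigenvectors. -/
lemma le_of_mem_wt_of_mem_wt {d h : L} (hd : IsRational d) (hh : IsRational h) (hdh : h ∈ wt d 0)
    {X Y : Submodule ℂ L} (hXd : IsStable d X) (hXh : IsStable h X)
    (hXY : ∀ i j, ∀ x ∈ X, x ∈ wt d i → x ∈ wt h j → x ∈ Y) : X ≤ Y := by
  refine hXd.le_of_wt hd fun i x hx hxi => ?_
  have h1 : IsStable h (wt d i) := fun y hy => by simpa using lie_mem_wt hdh hy
  exact (hXh.inf h1).le_of_wt hh (fun j y hy hyj => hXY i j y hy.1 hy.2 hyj) ⟨hx, hxi⟩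

/-- The segment joining `d` to `p • h`. -/
def deform (d h : L) (p t : ℚ) : L := ((1 - t : ℚ) : ℂ) • d + ((t * p : ℚ) : ℂ) • h

lemma mem_wt_deform {d h x : L} {i j : ℚ} (hxi : x ∈ wt d i) (hxj : x ∈ wt h j) (p t : ℚ) :
    x ∈ wt (deform d h p t) ((1 - t) * i + t * p * j) := by
  rw [mem_wt, deform, add_lie, smul_lie, smul_lie, mem_wt.mp hxi, mem_wt.mp hxj, smul_smul,
    smul_smul, ← add_smul]
  push_cast; rfl

lemma deform_mem_wt_zero {d h : L} (hdh : h ∈ wt d 0) (p t t' : ℚ) :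
    deform d h p t ∈ wt (deform d h p t') 0 := by
  have hd : ∀ c : L, c ∈ wt c 0 := fun c => by simp [mem_wt]
  have h1 := mem_wt_deform (hd d) (mem_wt_zero_comm.mp hdh) p t'
  have h2 := mem_wt_deform hdh (hd h) p t'
  simp only [mul_zero, add_zero] at h1 h2
  exact Submodule.add_mem _ (Submodule.smul_mem _ _ h1) (Submodule.smul_mem _ _ h2)

section Deformation

variable {d e h : L} {a : ℤ} (H : IsOptimalFor d e a) (hh : IsRational h) (hdh : h ∈ wt d 0)
  (hhe : ⁅h, e⁆ = (2 : ℂ) • e)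
  (hK : LinearMap.ker (ad ℂ L e) ≤ gr h (Set.range (Nat.cast : ℕ → ℚ)))

include hdh in
lemma isStable_gr_deform (p t : ℚ) (S : Set ℚ) :
    IsStable d (gr (deform d h p t) S) ∧ IsStable h (gr (deform d h p t) S) := by
  have hd : ∀ c : L, c ∈ wt c 0 := fun c => by simp [mem_wt]
  constructor
  · refine isStable_gr_of_mem_wt_zero ?_ S
    simpa using mem_wt_deform (hd d) (mem_wt_zero_comm.mp hdh) p t
  · refine isStable_gr_of_mem_wt_zero ?_ S
    simpa using mem_wt_deform hdh (hd h) p t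

include H hh hdh in
lemma isRational_deform (p t : ℚ) : IsRational (deform d h p t) := by
  refine top_unique (le_of_mem_wt_of_mem_wt H.rational hh hdh (fun _ _ => trivial)
    (fun _ _ => trivial) fun i j x _ hxi hxj => ?_)
  exact Submodule.mem_iSup_of_mem _ (mem_wt_deform hxi hxj p t)

include H hhe in
lemma mem_wt_deform_self (t : ℚ) : e ∈ wt (deform d h (a / 2) t) a := by
  have := mem_wt_deform H.mem (j := 2) (mem_wt.mpr (by simpa using hhe)) (a / 2) t
  convert this using 1
  ring

include H hh hdh hhe hK in
/-- The weights on the centralizer of `e` are at least `-(1 - t) * a / 2`. -/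
lemma eq_zero_of_mem_gr_deform {t : ℚ} (ht0 : 0 ≤ t) (ht1 : t ≤ 1) {S : Set ℚ}
    (hS : ∀ j ∈ S, j < (1 - t) * -(a / 2)) : ∀ x ∈ gr (deform d h (a / 2) t) S, ⁅e, x⁆ = 0 → x = 0 := by
  have ha := H.pos
  obtain ⟨h1, h2⟩ := isStable_gr_deform hdh (a / 2) t S
  have he : e ∈ wt h 2 := mem_wt.mpr (by simpa using hhe)
  have key := le_of_mem_wt_of_mem_wt (Y := ⊥) H.rational hh hdh (h1.inf (isStable_ker H.mem))
    (h2.inf (isStable_ker he)) fun i j x hx hxi hxj => by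
      rw [Submodule.mem_bot]
      by_contra hx0
      have hj : 0 ≤ j := by
        by_contra! hj
        refine hx0 (eq_zero_of_wt hxj (hK hx.2) ?_)
        rintro ⟨n, rfl⟩
        exact absurd hj (not_lt.mpr n.cast_nonneg)
      have hi : -(a / 2) ≤ i := by
        by_contra! hi
        exact hx0 (H.eq_zero x (mem_gr hxi hi) hx.2)
      refine hx0 (eq_zero_of_wt (mem_wt_deform hxi hxj (a / 2) t) hx.1 fun hmem => ?_)
      have h3 := hS _ hmem
      have h4 : 0 ≤ t * (a / 2) * j := by positivity
      nlinarith
  exact fun x hx hex => key ⟨hx, hex⟩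

include H hh hdh hhe hK in
lemma isOptimalFor_deform {t : ℚ} (ht0 : 0 ≤ t) (ht1 : t ≤ 1) :
    IsOptimalFor (deform d h (a / 2) t) e a where
  rational := isRational_deform H hh hdh _ t
  mem := mem_wt_deform_self H hhe t
  one_lt := H.one_lt
  eq_zero := eq_zero_of_mem_gr_deform H hh hdh hhe hK ht0 ht1 fun j hj => by
    have := H.pos
    rw [Set.mem_Iio] at hj
    nlinarith

variable [FiniteDimensional ℂ L] [IsKilling ℂ L]

include H hh hdh hhe hK in
lemma adm_deform {t : ℚ} (ht0 : 0 < t) (ht1 : t ≤ 1) :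
    Adm (deform d h (a / 2) t) e a (gr (deform d h (a / 2) t) (Set.Iio (-(a / 2))))
      (gr (deform d h (a / 2) t) (Set.Iic (-(a / 2)))) := by
  have ha := H.pos
  have h1 := (isOptimalFor_deform H hh hdh hhe hK ht0.le ht1).adm le_rfl
    (fun x hx => eq_zero_of_mem_gr_deform H hh hdh hhe hK ht0.le ht1 (S := {-(a / 2 : ℚ)})
      (fun j hj => by rw [Set.mem_singleton_iff.mp hj]; nlinarith) x (mem_gr hx rfl)) le_sup_left
  have h2 : gr (deform d h (a / 2) t) (Set.Iic (-(a / 2))) =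
      gr (deform d h (a / 2) t) (Set.Iio (-(a / 2))) ⊔ wt (deform d h (a / 2) t) (-(a / 2)) := by
    rw [← Set.Iio_union_right, gr_union, gr, gr]
    simp
  rwa [h2]

include H hh hdh hhe hK in
lemma adm_deform_of_near {t t' : ℚ} (ht0 : 0 < t) (ht1 : t ≤ 1)
    (hnear : ∀ i j, wt d i ≠ ⊥ → wt h j ≠ ⊥ → |(t - t') * (i - a / 2 * j)| < a / 2) :
    Adm (deform d h (a / 2) t') e a (gr (deform d h (a / 2) t) (Set.Iio (-(a / 2))))
      (gr (deform d h (a / 2) t) (Set.Iic (-(a / 2)))) := by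
  have h0 := adm_deform H hh hdh hhe hK ht0 ht1
  have hmem := deform_mem_wt_zero hdh (a / 2) t' t
  have move : ∀ (s s' : ℚ) (S T : Set ℚ), s - s' = t - t' ∨ s - s' = -(t - t') →
      (∀ i ∈ S, ∀ j, |j - i| < a / 2 → j ∈ T) →
      gr (deform d h (a / 2) s) S ≤ gr (deform d h (a / 2) s') T := by
    intro s s' S T hs hST
    obtain ⟨h1, h2⟩ := isStable_gr_deform hdh (a / 2) s S
    refine le_of_mem_wt_of_mem_wt H.rational hh hdh h1 h2 fun i j x hx hxi hxj => ?_
    by_cases hx0 : x = 0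
    · rw [hx0]; exact Submodule.zero_mem _
    have h3 : (1 - s) * i + s * (a / 2) * j ∈ S := by
      by_contra hcon
      exact hx0 (eq_zero_of_wt (mem_wt_deform hxi hxj (a / 2) s) hx hcon)
    refine mem_gr (mem_wt_deform hxi hxj (a / 2) s') (hST _ h3 _ ?_)
    have h4 := hnear i j (Submodule.ne_bot_iff _ |>.mpr ⟨x, hxi, hx0⟩)
      (Submodule.ne_bot_iff _ |>.mpr ⟨x, hxj, hx0⟩)
    have h5 : (1 - s') * i + s' * (a / 2) * j - ((1 - s) * i + s * (a / 2) * j) =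
        (s - s') * (i - a / 2 * j) := by ring
    rw [h5]
    rcases hs with hs | hs
    · rwa [hs]
    · rwa [hs, neg_mul, abs_neg]
  refine ⟨isStable_gr_of_mem_wt_zero hmem _, isStable_gr_of_mem_wt_zero hmem _, h0.lie_right,
    h0.lie_left, move t' t _ _ (by right; ring) fun i hi j hij => ?_, h0.le,
    move t t' _ _ (by left; rfl) fun i hi j hij => ?_, h0.eq_zero, h0.perp⟩
  all_goals
    simp only [Set.mem_Iic, Set.mem_Iio] at *
    have := (abs_lt.mp hij).2
    linarith

include H hh hdh hhe hK in
lemma Adm.linked_deform_one {m n : Submodule ℂ L} (h₀ : Adm d e a m n) :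
    Linked e (m, n) (gr (deform d h (a / 2) 1) (Set.Iio (-(a / 2))),
      gr (deform d h (a / 2) 1) (Set.Iic (-(a / 2)))) := by
  have ha := H.pos
  obtain ⟨M, hM⟩ : ∃ M : ℚ, ∀ i j, wt d i ≠ ⊥ → wt h j ≠ ⊥ → |i - a / 2 * j| ≤ M := by
    obtain ⟨M, hM⟩ := (((finite_weights d).prod (finite_weights h)).image
      fun x : ℚ × ℚ => |x.1 - a / 2 * x.2|).bddAbove
    exact ⟨M, fun i j hi hj => hM ⟨(i, j), ⟨hi, hj⟩, rfl⟩⟩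
  obtain ⟨N, hN⟩ := exists_nat_gt (max M 0 / (a / 2))
  have hN0 : (0 : ℚ) < N := lt_of_le_of_lt (by positivity) hN
  rw [div_lt_iff₀ (by positivity)] at hN
  have hnear : ∀ k : ℕ, ∀ i j, wt d i ≠ ⊥ → wt h j ≠ ⊥ →
      |(((k + 1 : ℕ) : ℚ) / N - k / N) * (i - a / 2 * j)| < a / 2 := by
    intro k i j hi hj
    have h1 : ((k + 1 : ℕ) : ℚ) / N - k / N = 1 / N := by push_cast; ring
    rw [h1, abs_mul, abs_of_pos (by positivity), one_div_mul_eq_div, div_lt_iff₀ hN0]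
    exact (hM i j hi hj).trans_lt (lt_of_le_of_lt (le_max_left M 0) (by linarith))
  have chain : ∀ k : ℕ, k + 1 ≤ N → Linked e (m, n)
      (gr (deform d h (a / 2) ((k + 1 : ℕ) / N)) (Set.Iio (-(a / 2))),
        gr (deform d h (a / 2) ((k + 1 : ℕ) / N)) (Set.Iic (-(a / 2)))) := by
    intro k
    induction k with
    | zero =>
      intro hk
      have h1 := adm_deform_of_near H hh hdh hhe hK (t := (0 + 1 : ℕ) / N) (by positivity)
        ((div_le_one hN0).mpr (by exact_mod_cast hk)) (hnear 0)
      have h2 : deform d h (a / 2) ((0 : ℕ) / N) = d := by simp [deform]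
      rw [h2] at h1
      exact h₀.linked_of_isOptimalFor H h1
    | succ k ih =>
      intro hk
      have hk1 : ((k + 1 : ℕ) : ℚ) / N ≤ 1 := (div_le_one hN0).mpr (by exact_mod_cast (by omega))
      have h1 := adm_deform_of_near H hh hdh hhe hK (t := (k + 1 + 1 : ℕ) / N) (by positivity)
        ((div_le_one hN0).mpr (by exact_mod_cast hk)) (hnear (k + 1))
      have hpos : (0 : ℚ) < (k + 1 : ℕ) / N := by positivity
      exact (ih (by omega)).trans _ _ _ ((adm_deform H hh hdh hhe hK hpos hk1).linked_of_isOptimalFor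
        (isOptimalFor_deform H hh hdh hhe hK hpos.le hk1) h1)
  obtain ⟨k, rfl⟩ := Nat.exists_eq_succ_of_ne_zero (n := N) (by rintro rfl; simp at hN0)
  have := chain k le_rfl
  rwa [div_self hN0.ne'] at this

end Deformation

lemma gr_deform_one {d h : L} {p : ℚ} (hp : 0 < p) (hint : ∀ j, wt h j ≠ ⊥ → ∃ n : ℤ, j = n)
    {S : Set ℚ} {T : ℤ → Prop} (hST : ∀ n : ℤ, p * n ∈ S ↔ T n) :
    gr (deform d h p 1) S = ⨆ j : ℤ, ⨆ _ : T j, Module.End.eigenspace (ad ℂ L h) (j : ℂ) := by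
  have hwt : ∀ j, wt (deform d h p 1) j = wt h (j / p) := by
    intro j
    have hp' : (p : ℂ) ≠ 0 := by exact_mod_cast hp.ne'
    ext x
    rw [mem_wt, mem_wt, deform]
    simp only [sub_self, Rat.cast_zero, zero_smul, zero_add, one_mul, smul_lie]
    rw [Rat.cast_div, div_eq_inv_mul, mul_smul, eq_inv_smul_iff₀ hp']
  refine le_antisymm (gr_le.mpr fun j hj x hx => ?_) (iSup₂_le fun n hn => ?_)
  · rw [hwt] at hx
    by_cases hx0 : x = 0
    · rw [hx0]; exact Submodule.zero_mem _
    obtain ⟨n, hn⟩ := hint _ (Submodule.ne_bot_iff _ |>.mpr ⟨x, hx, hx0⟩)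
    have hTn : T n := by
      rw [← hST, ← hn, mul_div_cancel₀ _ hp.ne']
      exact hj
    refine Submodule.mem_iSup_of_mem n (Submodule.mem_iSup_of_mem hTn ?_)
    rw [hn] at hx
    simpa [wt] using hx
  · have h1 : Module.End.eigenspace (ad ℂ L h) (n : ℂ) = wt (deform d h p 1) (p * n) := by
      rw [hwt, mul_div_cancel_left₀ _ hp.ne', wt, Rat.cast_intCast]
    rw [h1]
    exact wt_le_gr ((hST n).mpr hn)

/-- **Theorem 6.9 (Sadaka).** The `e`-admissible pairs relative to any `b`-optimal grading
for `e` are equivalent to the optimal `e`-admissible pair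
`(⊕_{j≤−2} 𝔤(j), ⊕_{j<0} 𝔤(j))` of a Dynkin grading associated to `e` (the grading by the
eigenspaces `𝔤(j)` of `ad h` for an `sl₂`-triple `(e, h, f)`).  In particular, the
associated finite W-algebras are isomorphic. -/
theorem stmt_15 {L : Type*} [LieRing L] [LieAlgebra ℂ L]
    [FiniteDimensional ℂ L] [LieAlgebra.IsSimple ℂ L]
    (e : L) (he : IsNilpotent (ad ℂ L e))
    (g : ℚ → Submodule ℂ L) (hg : IsQGrading g)
    (b : ℚ) (hb : 0 < b)
    (hopt : (⨆ j < -b, g j) ⊓ LinearMap.ker (ad ℂ L e) = ⊥)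
    (a : ℤ) (ha : 2 ≤ a) (hea : e ∈ g (a : ℚ)) (hab : 2 * b ≤ (a : ℚ)) :
    ∃ h f : L, ⁅h, e⁆ = (2 : ℂ) • e ∧ ⁅e, f⁆ = h ∧ ⁅h, f⁆ = (-2 : ℂ) • f ∧
      ∀ (a₁ : ℤ) (m n : Submodule ℂ L), 1 < a₁ → e ∈ g (a₁ : ℚ) →
        IsAdmissiblePairQ g e a₁ m n →
        EquivalentPairs e (m, n)
          (⨆ j : ℤ, ⨆ _ : j ≤ -2, Module.End.eigenspace (ad ℂ L h) (j : ℂ),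
           ⨆ j : ℤ, ⨆ _ : j < 0, Module.End.eigenspace (ad ℂ L h) (j : ℂ)) ∧
        WAlgebraIso e m n
          (⨆ j : ℤ, ⨆ _ : j ≤ -2, Module.End.eigenspace (ad ℂ L h) (j : ℂ))
          (⨆ j : ℤ, ⨆ _ : j < 0, Module.End.eigenspace (ad ℂ L h) (j : ℂ)) := by
  by_cases he0 : e = 0
  · subst he0
    have hbot : ∀ j : ℤ, j < 0 →
        Module.End.eigenspace (ad ℂ L (0 : L)) (j : ℂ) = ⊥ := fun j hj => by
      refine eq_bot_iff.mpr fun x hx => ?_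
      rw [Module.End.mem_eigenspace_iff, ad_apply, zero_lie, eq_comm, smul_eq_zero] at hx
      exact hx.resolve_left (by exact_mod_cast hj.ne)
    refine ⟨0, 0, by simp, by simp, by simp, fun a₁ m n _ _ hadm => ?_⟩
    obtain ⟨-, -, -, -, -, hmn, -, -, hn, -⟩ := hadm
    have hn0 : n = ⊥ := by simpa using hn
    subst hn0
    obtain rfl := le_bot_iff.mp hmn
    have h1 : ⨆ j : ℤ, ⨆ _ : j ≤ -2, Module.End.eigenspace (ad ℂ L (0 : L)) (j : ℂ) = ⊥ :=
      iSup₂_eq_bot.mpr fun j hj => hbot j (by omega)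
    have h2 : ⨆ j : ℤ, ⨆ _ : j < 0, Module.End.eigenspace (ad ℂ L (0 : L)) (j : ℂ) = ⊥ :=
      iSup₂_eq_bot.mpr hbot
    rw [h1, h2]
    exact ⟨.refl, .refl _ _ _⟩
  obtain ⟨d, hd, rfl⟩ := hg.exists_eq_wt
  have H : IsOptimalFor d e a := by
    refine ⟨hd, hea, by omega, fun x hx hex => ?_⟩
    have h1 : x ∈ gr d (Set.Iio (-b)) := gr_mono (Set.Iio_subset_Iio (by linarith)) hx
    exact (Submodule.mem_bot ℂ).mp (hopt.le ⟨h1, hex⟩)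
  have hapos := H.pos
  obtain ⟨h, f, hdh, hhe, hef, hhf, hh, hint, hK⟩ := exists_sl2 hd hea hapos.ne' he
  refine ⟨h, f, hhe, hef, hhf, fun a₁ m n _ hea₁ hadm => ?_⟩
  obtain rfl : a₁ = a := by
    have h1 := (mem_wt.mp hea₁).symm.trans (mem_wt.mp hea)
    exact_mod_cast smul_left_injective ℂ he0 h1
  have hlink := hadm.adm.linked_deform_one H hh hdh hhe hK
  have hp : (0 : ℚ) < a₁ / 2 := by positivity
  rw [gr_deform_one hp hint (T := (· ≤ -2)) fun n => ?_,
    gr_deform_one hp hint (T := (· < 0)) fun n => ?_] at hlink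
  · exact ⟨hlink.equivalentPairs_and_wAlgebraIso.1.1, hlink.equivalentPairs_and_wAlgebraIso.2.1⟩
  · have h1 : (a₁ / 2 : ℚ) * n ≤ -(a₁ / 2) ↔ (n : ℚ) ≤ (-1 : ℤ) := by
      push_cast
      rw [← mul_neg_one, mul_le_mul_iff_right₀ hp]
    rw [Set.mem_Iic, h1, Int.cast_le]
    omega
  · have h1 : (a₁ / 2 : ℚ) * n < -(a₁ / 2) ↔ (n : ℚ) < (-1 : ℤ) := by
      push_cast
      rw [← mul_neg_one, mul_lt_mul_iff_right₀ hp]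
    rw [Set.mem_Iio, h1, Int.cast_lt]
    omega
end
end

section
/- Let (𝔪,𝔫) be an e-admissible pair relative to a grading Γ : 𝔤 = ⊕_{j∈ℚ} 𝔤_j with e ∈ 𝔤_a (a ≥ 2 an integer), and let b ∈ (0, a/2]. Set U′ = 𝔪 ∩ 𝔤_{b−a}, V′ = 𝔪 ∩ 𝔤_{−b}, U = 𝔫 ∩ 𝔤_{b−a}, V = 𝔫 ∩ 𝔤_{−b}. Then dim U + dim V′ = dim 𝔤_{−b} − dim(𝔤_{−b} ∩ 𝔤^e) = dim U′ + dim V. -/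
open Module LieAlgebra

noncomputable section

variable {L : Type*} [LieRing L] [LieAlgebra ℂ L]

/-- A bilinear form pairs `V` modulo its left kernel perfectly with `W` modulo its right
kernel. -/
theorem LinearMap.finrank_add_finrank_of_pairing {K E F : Type*} [Field K]
    [AddCommGroup E] [Module K E] [FiniteDimensional K E]
    [AddCommGroup F] [Module K F] [FiniteDimensional K F]
    (c : E →ₗ[K] F →ₗ[K] K) {V P : Submodule K E} {W Q : Submodule K F}
    (hP : ∀ x, x ∈ P ↔ x ∈ V ∧ ∀ y ∈ W, c x y = 0)
    (hQ : ∀ y, y ∈ Q ↔ y ∈ W ∧ ∀ x ∈ V, c x y = 0) :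
    finrank K V + finrank K Q = finrank K W + finrank K P := by
  set d : V →ₗ[K] W →ₗ[K] K := c.domRestrict₁₂ V W with hd
  have hPd : P = (LinearMap.ker d).map V.subtype := by
    ext x
    simp [hP, hd, LinearMap.ext_iff, LinearMap.domRestrict₁₂_apply, and_comm]
  have hQd : Q = (LinearMap.ker d.flip).map W.subtype := by
    ext y
    simp [hQ, hd, LinearMap.ext_iff, LinearMap.domRestrict₁₂_apply, and_comm]
  have hflip : d.flip = d.dualMap ∘ₗ (Module.evalEquiv K W).toLinearMap := by
    ext; simp
  have hrange : finrank K (LinearMap.range d.flip) = finrank K (LinearMap.range d) := by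
    rw [hflip, LinearMap.range_comp_of_range_eq_top _ (LinearEquiv.range _),
      LinearMap.finrank_range_dualMap_eq_finrank_range]
  have h₁ := d.finrank_range_add_finrank_ker
  have h₂ := d.flip.finrank_range_add_finrank_ker
  rw [hPd, hQd, Submodule.finrank_map_subtype_eq, Submodule.finrank_map_subtype_eq]
  omega

namespace IsQGrading

variable {g : ℚ → Submodule ℂ L}

theorem killingForm_eq_zero [FiniteDimensional ℂ L] (hg : IsQGrading g) {i j : ℚ}
    (hij : i + j ≠ 0) {x y : L} (hx : x ∈ g i) (hy : y ∈ g j) : killingForm ℂ L x y = 0 := by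
  rw [killingForm_apply_apply]
  refine LinearMap.trace_eq_zero_of_mapsTo_ne hg.1 (fun k ↦ i + (j + k)) (fun k hk ↦ hij ?_)
    fun k z hz ↦ ?_
  · linarith
  · simpa using hg.2 _ _ x hx _ (hg.2 _ _ y hy z hz)

/-- To be Killing-orthogonal to a graded subspace, a homogeneous element only has to be
orthogonal to its component of opposite degree. -/
theorem killingForm_eq_zero_of_graded [FiniteDimensional ℂ L] (hg : IsQGrading g) {i j : ℚ}
    (hij : i + j = 0) {m : Submodule ℂ L} (hm : m = ⨆ k, g k ⊓ m) {z : L} (hz : z ∈ g i)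
    (h : ∀ y ∈ m ⊓ g j, killingForm ℂ L z y = 0) {y : L} (hy : y ∈ m) :
    killingForm ℂ L z y = 0 := by
  rw [hm] at hy
  induction hy using Submodule.iSup_induction' with
  | mem k y hy =>
    by_cases hk : i + k = 0
    · obtain rfl : k = j := by linarith
      exact h y ⟨hy.2, hy.1⟩
    · exact hg.killingForm_eq_zero hk hz hy.1
  | zero => simp
  | add y₁ y₂ _ _ h₁ h₂ => rw [map_add, h₁, h₂, add_zero]

theorem eq_zero_of_killingForm_eq_zero [FiniteDimensional ℂ L] [IsKilling ℂ L]
    (hg : IsQGrading g) {i j : ℚ} (hij : i + j = 0) {z : L} (hz : z ∈ g i)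
    (h : ∀ y ∈ g j, killingForm ℂ L z y = 0) : z = 0 := by
  have htop : (⊤ : Submodule ℂ L) = ⨆ k, g k ⊓ ⊤ := by
    simpa using hg.1.submodule_iSup_eq_top.symm
  refine (IsKilling.killingForm_nondegenerate ℂ L).1 z fun y ↦ ?_
  exact hg.killingForm_eq_zero_of_graded hij htop hz (by simpa using h) Submodule.mem_top

theorem mem_of_lie_mem (hg : IsQGrading g) {a i : ℚ} {e : L} (he : e ∈ g a)
    {n : Submodule ℂ L} (hn : n = ⨆ k, g k ⊓ n) (hker : n ⊓ LinearMap.ker (ad ℂ L e) = ⊥)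
    {x : L} (hx : x ∈ n) (hex : ⁅e, x⁆ ∈ g (a + i)) : x ∈ g i := by
  have hx' : x ∈ ⨆ k, g k ⊓ n := hn ▸ hx
  rw [iSup_split_single _ i] at hx'
  obtain ⟨y, hy, z, hz, rfl⟩ := Submodule.mem_sup.mp hx'
  have hez : ⁅e, z⁆ ∈ ⨆ k ≠ a + i, g k := by
    have hle : (⨆ k ≠ i, g k ⊓ n) ≤ (⨆ k ≠ a + i, g k).comap (ad ℂ L e) := by
      refine iSup₂_le fun k hk w hw ↦ ?_
      exact Submodule.mem_iSup_of_mem (a + k) <| Submodule.mem_iSup_of_mem (by simpa using hk)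
        (hg.2 _ _ e he w hw.1)
    exact hle hz
  have hez' : ⁅e, z⁆ ∈ g (a + i) := by
    simpa using sub_mem hex (hg.2 _ _ e he y hy.1)
  have h0 : ⁅e, z⁆ = 0 :=
    Submodule.disjoint_def.mp (hg.1.submodule_iSupIndep (a + i)) _ hez' hez
  have hzn : z ∈ n := by simpa using sub_mem hx hy.2
  have : z ∈ n ⊓ LinearMap.ker (ad ℂ L e) := ⟨hzn, h0⟩
  rw [hker, Submodule.mem_bot] at this
  simpa [this] using hy.1

theorem killingForm_lie_skew (e x y : L) :
    killingForm ℂ L ⁅e, x⁆ y = -killingForm ℂ L x ⁅e, y⁆ := by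
  rw [← lie_skew, map_neg, LinearMap.neg_apply, LieModule.traceForm_apply_lie_apply]

/-- The pairing `(x, y) ↦ ⟨[e, x], y⟩` on `𝔤_i × 𝔤_j`, where `i + j = -a`, has kernels
`𝔤_i ∩ 𝔤^e` and `𝔤_j ∩ 𝔤^e`. -/
theorem finrank_add_finrank_ker [FiniteDimensional ℂ L] [IsKilling ℂ L]
    (hg : IsQGrading g) {a i j : ℚ} (hij : a + i + j = 0) {e : L} (he : e ∈ g a) :
    finrank ℂ (g i) + finrank ℂ ↥(g j ⊓ LinearMap.ker (ad ℂ L e))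
      = finrank ℂ (g j) + finrank ℂ ↥(g i ⊓ LinearMap.ker (ad ℂ L e)) := by
  refine LinearMap.finrank_add_finrank_of_pairing (killingForm ℂ L ∘ₗ ad ℂ L e)
    (fun x ↦ and_congr_right fun hx ↦ ⟨fun h y _ ↦ ?_, fun h ↦ ?_⟩)
    (fun y ↦ and_congr_right fun hy ↦ ⟨fun h x _ ↦ ?_, fun h ↦ ?_⟩)
  · rw [LinearMap.comp_apply, LinearMap.mem_ker.mp h, map_zero, LinearMap.zero_apply]
  · exact hg.eq_zero_of_killingForm_eq_zero hij (hg.2 _ _ e he x hx) h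
  · rw [LinearMap.comp_apply, ad_apply, killingForm_lie_skew, ← ad_apply ℂ,
      LinearMap.mem_ker.mp h, map_zero, neg_zero]
  · refine hg.eq_zero_of_killingForm_eq_zero (j := i) (by linarith) (hg.2 _ _ e he y hy)
      fun x hx ↦ ?_
    rw [LieModule.traceForm_comm]
    exact neg_eq_zero.mp ((killingForm_lie_skew e x y).symm.trans (h x hx))

end IsQGrading

theorem IsAdmissiblePairQ.finrank_inf_add_finrank_inf [FiniteDimensional ℂ L] [IsKilling ℂ L]
    {g : ℚ → Submodule ℂ L} (hg : IsQGrading g) {a : ℤ} {i j : ℚ} (hij : (a : ℚ) + i + j = 0)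
    {e : L} (he : e ∈ g a) {m n : Submodule ℂ L} (hp : IsAdmissiblePairQ g e a m n) :
    finrank ℂ ↥(n ⊓ g i) + finrank ℂ ↥(m ⊓ g j) +
      finrank ℂ ↥(g i ⊓ LinearMap.ker (ad ℂ L e)) = finrank ℂ (g i) := by
  obtain ⟨-, -, hm, hn, -, hmn, -, horth, hker, -, -⟩ := hp
  have hpair : finrank ℂ (g i) + finrank ℂ (⊥ : Submodule ℂ L) = finrank ℂ ↥(m ⊓ g j) +
      finrank ℂ ↥((n ⊓ g i) ⊔ (g i ⊓ LinearMap.ker (ad ℂ L e))) := by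
    refine LinearMap.finrank_add_finrank_of_pairing (killingForm ℂ L ∘ₗ ad ℂ L e)
      (fun x ↦ ⟨fun h ↦ ?_, fun ⟨hx, h⟩ ↦ ?_⟩) (fun y ↦ ⟨fun h ↦ ?_, fun ⟨hy, h⟩ ↦ ?_⟩)
    · obtain ⟨u, hu, v, hv, rfl⟩ := Submodule.mem_sup.mp h
      refine ⟨add_mem hu.2 hv.1, fun y hy ↦ ?_⟩
      have hmem := horth.ge (Submodule.mem_map_of_mem hu.1)
      rw [LinearMap.comp_apply, map_add, LinearMap.mem_ker.mp hv.2, add_zero,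
        LieModule.traceForm_comm]
      exact hmem.1 y hy.1
    · have hex := hg.2 _ _ e he x hx
      have hmem : ad ℂ L e x ∈ Submodule.map (ad ℂ L e) n := by
        rw [← horth]
        refine ⟨fun y hy ↦ ?_, x, rfl⟩
        rw [LieModule.traceForm_comm]
        exact hg.killingForm_eq_zero_of_graded hij hm hex h hy
      obtain ⟨u, hu, hux⟩ := hmem
      have hui : u ∈ g i := hg.mem_of_lie_mem he hn hker hu (by
        rw [← ad_apply ℂ, hux]; exact hex)
      refine Submodule.mem_sup.mpr ⟨u, ⟨hu, hui⟩, x - u, ⟨sub_mem hx hui, ?_⟩, by abel⟩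
      exact LinearMap.mem_ker.mpr (by rw [map_sub, hux, sub_self])
    · rw [Submodule.mem_bot] at h
      subst h
      exact ⟨zero_mem _, fun x _ ↦ map_zero _⟩
    · have hey : ⁅e, y⁆ = 0 := by
        refine hg.eq_zero_of_killingForm_eq_zero (j := i) (by linarith)
          (hg.2 _ _ e he y hy.2) fun x hx ↦ ?_
        rw [LieModule.traceForm_comm]
        exact neg_eq_zero.mp ((IsQGrading.killingForm_lie_skew e x y).symm.trans (h x hx))
      exact hker.le ⟨hmn hy.1, hey⟩
  have hinf : (n ⊓ g i) ⊓ (g i ⊓ LinearMap.ker (ad ℂ L e)) = ⊥ :=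
    eq_bot_iff.mpr (hker ▸ inf_le_inf inf_le_left inf_le_right)
  have hsup := Submodule.finrank_sup_add_finrank_inf_eq (n ⊓ g i)
    (g i ⊓ LinearMap.ker (ad ℂ L e))
  rw [hinf] at hsup
  simp only [finrank_bot] at hpair hsup
  omega

/-- **Proposition 6.3 (Sadaka).** Let `(𝔪, 𝔫)` be an `e`-admissible pair relative to a
grading `Γ : 𝔤 = ⊕_{j∈ℚ} 𝔤_j` with `e ∈ 𝔤_a` (`a ≥ 2` an integer), and let
`b ∈ (0, a/2]`.  With `U′ = 𝔪 ∩ 𝔤_{b−a}`, `V′ = 𝔪 ∩ 𝔤_{−b}`, `U = 𝔫 ∩ 𝔤_{b−a}`,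
`V = 𝔫 ∩ 𝔤_{−b}`, one has
`dim U + dim V′ = dim 𝔤_{−b} − dim (𝔤_{−b} ∩ 𝔤^e) = dim U′ + dim V`. -/
theorem stmt_17 {L : Type*} [LieRing L] [LieAlgebra ℂ L]
    [FiniteDimensional ℂ L] [LieAlgebra.IsSimple ℂ L]
    (e : L) (he : IsNilpotent (ad ℂ L e))
    (g : ℚ → Submodule ℂ L) (hg : IsQGrading g)
    (a : ℤ) (ha : 2 ≤ a) (hea : e ∈ g (a : ℚ))
    (m n : Submodule ℂ L) (hp : IsAdmissiblePairQ g e a m n)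
    (b : ℚ) (hb : 0 < b) (hb2 : b ≤ (a : ℚ) / 2) :
    Module.finrank ℂ ↥(n ⊓ g ((b : ℚ) - a)) + Module.finrank ℂ ↥(m ⊓ g (-b))
        = Module.finrank ℂ ↥(g (-b))
          - Module.finrank ℂ ↥(g (-b) ⊓ LinearMap.ker (ad ℂ L e)) ∧
    Module.finrank ℂ ↥(m ⊓ g ((b : ℚ) - a)) + Module.finrank ℂ ↥(n ⊓ g (-b))
        = Module.finrank ℂ ↥(g (-b))
          - Module.finrank ℂ ↥(g (-b) ⊓ LinearMap.ker (ad ℂ L e)) := by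
  have h₁ := hp.finrank_inf_add_finrank_inf hg (i := b - a) (j := -b) (by ring) hea
  have h₂ := hp.finrank_inf_add_finrank_inf hg (i := -b) (j := b - a) (by ring) hea
  have h₃ := hg.finrank_add_finrank_ker (i := b - a) (j := -b) (by ring) hea
  omega
end
end
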